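/- (Sharir–Solomon incidence bound for lines on a surface) There is an absolute constant C such that the following holds. Let f be a nonzero real polynomial in three variables of total degree d ≥ 2 having no linear factor (no polynomial of total degree 1 divides f). Let P be a finite set of points and L a finite set of lines in ℝ³, all contained in the zero set of f, and suppose at most s lines of L are contained in any affine plane, where s ≤ d. Then the number of incidences satisfies I(P,L) ≤ C·(|P|^{1/2}·|L|^{1/2}·d^{1/2} + |P|^{2/3}·d^{2/3}·s^{1/3} + |P| + |L|). -/

import Mathlib

open scoped Classical

/-- A line in `ℝ³`: a one-dimensional affine subspace, as a set of points. -/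
def IsLine (l : Set (Fin 3 → ℝ)) : Prop :=
  ∃ p v : Fin 3 → ℝ, v ≠ 0 ∧ l = {x | ∃ t : ℝ, x = p + t • v}

/-- An affine plane in `ℝ³`: the solution set of a nontrivial linear equation. -/
def IsPlane (π : Set (Fin 3 → ℝ)) : Prop :=
  ∃ (f : Fin 3 → ℝ) (c : ℝ), f ≠ 0 ∧ π = {x | ∑ i, f i * x i = c}

namespace SharirSolomon

open MvPolynomial

/-! ### Restriction of polynomials to lines and affine substitutions -/

section Basic

variable {σ : Type*}

/-- The univariate polynomial `t ↦ f (p + t v)`. -/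
noncomputable def restr (p v : σ → ℝ) : MvPolynomial σ ℝ →ₐ[ℝ] Polynomial ℝ :=
  aeval (fun i => Polynomial.C (p i) + Polynomial.C (v i) * Polynomial.X)

lemma eval_restr (p v : σ → ℝ) (f : MvPolynomial σ ℝ) (t : ℝ) :
    (restr p v f).eval t = eval (p + t • v) f := by
  have : ((Polynomial.aeval t).comp (restr p v)) = aeval (p + t • v) := by
    apply MvPolynomial.algHom_ext
    intro i
    simp only [restr, AlgHom.coe_comp, Function.comp_apply, aeval_X, Polynomial.coe_aeval_eq_eval,
      Polynomial.eval_add, Polynomial.eval_C, Polynomial.eval_mul, Polynomial.eval_X, Pi.add_apply,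
      Pi.smul_apply, smul_eq_mul]
    ring
  have h := congrArg (fun φ => φ f) this
  simpa [Polynomial.aeval_def, Polynomial.eval₂_eq_eval_map, aeval_eq_eval] using h

lemma natDegree_restr_le (p v : σ → ℝ) (f : MvPolynomial σ ℝ) :
    (restr p v f).natDegree ≤ f.totalDegree := by
  rw [restr]
  refine (aeval_natDegree_le f le_rfl _ (n := 1) ?_).trans (by simp)
  intro i
  refine (Polynomial.natDegree_add_le _ _).trans ?_
  simp only [Polynomial.natDegree_C, zero_le, sup_of_le_right]
  exact (Polynomial.natDegree_C_mul_le _ _).trans Polynomial.natDegree_X_le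

lemma restr_eq_zero_iff (p v : σ → ℝ) (f : MvPolynomial σ ℝ) :
    restr p v f = 0 ↔ ∀ t : ℝ, eval (p + t • v) f = 0 := by
  constructor
  · intro h t
    rw [← eval_restr, h, Polynomial.eval_zero]
  · intro h
    apply Polynomial.funext
    intro t
    rw [eval_restr, h, Polynomial.eval_zero]

/-- A polynomial that does not vanish at one point of a line has at most degree many zeros on it. -/
lemma card_zeros_on_line_le (p v : σ → ℝ) (f : MvPolynomial σ ℝ) (h : restr p v f ≠ 0)
    (s : Finset ℝ) (hs : ∀ t ∈ s, eval (p + t • v) f = 0) : s.card ≤ f.totalDegree := by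
  refine le_trans ?_ (natDegree_restr_le p v f)
  refine le_trans ?_ (Polynomial.card_roots' _)
  refine le_trans (Finset.card_le_card ?_) (Multiset.toFinset_card_le _)
  intro t ht
  rw [Multiset.mem_toFinset, Polynomial.mem_roots h, Polynomial.IsRoot, eval_restr]
  exact hs t ht

lemma exists_eval_ne_zero {f : MvPolynomial σ ℝ} (hf : f ≠ 0) : ∃ x, eval x f ≠ 0 := by
  by_contra! h
  exact hf (MvPolynomial.funext (by simpa using h))

/-- Affine substitution: `x ↦ A x + b`. -/
noncomputable def asub {τ : Type*} [Fintype τ] (A : Matrix σ τ ℝ) (b : σ → ℝ) :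
    MvPolynomial σ ℝ →ₐ[ℝ] MvPolynomial τ ℝ :=
  aeval (fun i => ∑ j, C (A i j) * X j + C (b i))

lemma eval_asub {τ : Type*} [Fintype τ] (A : Matrix σ τ ℝ) (b : σ → ℝ)
    (f : MvPolynomial σ ℝ) (x : τ → ℝ) :
    eval x (asub A b f) = eval (A.mulVec x + b) f := by
  have : ((aeval x).comp (asub A b)) = aeval (A.mulVec x + b) := by
    ext i
    simp [asub, Matrix.mulVec, dotProduct]
  have h := congrArg (fun φ => φ f) this
  simpa [aeval_eq_eval] using h

lemma totalDegree_asub_le [Fintype σ] {τ : Type*} [Fintype τ] (A : Matrix σ τ ℝ) (b : σ → ℝ)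
    (f : MvPolynomial σ ℝ) : (asub A b f).totalDegree ≤ f.totalDegree := by
  rw [asub, aeval_def, eval₂_eq']
  refine totalDegree_finsetSum_le fun m hm => ?_
  refine (totalDegree_mul _ _).trans ?_
  rw [algebraMap_eq, totalDegree_C, zero_add]
  refine (totalDegree_finsetProd _ _).trans ?_
  have hle := le_totalDegree hm
  rw [Finsupp.sum_fintype _ _ (fun _ => rfl)] at hle
  refine le_trans (Finset.sum_le_sum fun i _ => ?_) hle
  refine (totalDegree_pow _ _).trans ?_
  refine (Nat.mul_le_mul_left _ ?_).trans_eq (mul_one _)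
  refine (totalDegree_add _ _).trans ?_
  simp only [totalDegree_C, zero_le, sup_of_le_left]
  refine totalDegree_finsetSum_le fun j _ => ?_
  refine (totalDegree_mul _ _).trans ?_
  simp

/-- An invertible linear substitution as an algebra automorphism. -/
noncomputable def linEquiv [Fintype σ] [DecidableEq σ] (A B : Matrix σ σ ℝ) (hAB : A * B = 1) (hBA : B * A = 1) :
    MvPolynomial σ ℝ ≃ₐ[ℝ] MvPolynomial σ ℝ :=
  AlgEquiv.ofAlgHom (asub A 0) (asub B 0)
    (by
      apply AlgHom.ext
      intro f
      apply MvPolynomial.funext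
      intro x
      simp [eval_asub, Matrix.mulVec_mulVec, hBA])
    (by
      apply AlgHom.ext
      intro f
      apply MvPolynomial.funext
      intro x
      simp [eval_asub, Matrix.mulVec_mulVec, hAB])

lemma eval_linEquiv [Fintype σ] [DecidableEq σ] (A B : Matrix σ σ ℝ) (hAB : A * B = 1) (hBA : B * A = 1)
    (f : MvPolynomial σ ℝ) (x : σ → ℝ) :
    eval x (linEquiv A B hAB hBA f) = eval (A.mulVec x) f := by
  have : linEquiv A B hAB hBA f = asub A 0 f := rfl
  rw [this, eval_asub, add_zero]

lemma totalDegree_linEquiv [Fintype σ] [DecidableEq σ] (A B : Matrix σ σ ℝ) (hAB : A * B = 1) (hBA : B * A = 1)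
    (f : MvPolynomial σ ℝ) : (linEquiv A B hAB hBA f).totalDegree = f.totalDegree := by
  apply le_antisymm
  · exact totalDegree_asub_le A 0 f
  · have h : f = asub B 0 (linEquiv A B hAB hBA f) :=
      ((linEquiv A B hAB hBA).symm_apply_apply f).symm
    conv_lhs => rw [h]
    exact totalDegree_asub_le B 0 _

end Basic

/-! ### Elimination -/

lemma totalDegree_coeff_finSuccEquiv_le {n : ℕ} (f : MvPolynomial (Fin (n + 1)) ℝ) (i : ℕ) :
    ((finSuccEquiv ℝ n f).coeff i).totalDegree ≤ f.totalDegree := by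
  by_cases hi : (finSuccEquiv ℝ n f).coeff i = 0
  · simp [hi]
  · have := totalDegree_coeff_finSuccEquiv_add_le f i hi
    omega

lemma natDegree_finSuccEquiv_le {n : ℕ} (f : MvPolynomial (Fin (n + 1)) ℝ) :
    (finSuccEquiv ℝ n f).natDegree ≤ f.totalDegree := by
  rw [natDegree_finSuccEquiv]
  exact degreeOf_le_totalDegree f 0

lemma totalDegree_det_le {ι τ : Type*} [Fintype ι] [DecidableEq ι]
    (M : Matrix ι ι (MvPolynomial τ ℝ)) (e : ι → ℕ) (h : ∀ i j, (M i j).totalDegree ≤ e j) :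
    M.det.totalDegree ≤ ∑ j, e j := by
  rw [Matrix.det_apply]
  refine totalDegree_finsetSum_le fun s _ => ?_
  have : (Equiv.Perm.sign s • ∏ i, M (s i) i).totalDegree ≤ (∏ i, M (s i) i).totalDegree := by
    rcases Int.units_eq_one_or (Equiv.Perm.sign s) with h | h <;> simp [h, totalDegree_neg]
  refine this.trans ((totalDegree_finsetProd _ _).trans (Finset.sum_le_sum fun i _ => h _ _))

lemma totalDegree_resultant_le {τ : Type*} (f g : Polynomial (MvPolynomial τ ℝ)) (m n a b : ℕ)
    (hf : ∀ i, (f.coeff i).totalDegree ≤ a) (hg : ∀ i, (g.coeff i).totalDegree ≤ b) :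
    (Polynomial.resultant f g m n).totalDegree ≤ m * b + n * a := by
  rw [Polynomial.resultant]
  refine (totalDegree_det_le _ (fun j => j.addCases (fun _ => b) (fun _ => a)) ?_).trans ?_
  · intro i j
    refine Fin.addCases (fun j => ?_) (fun j => ?_) j
    · simp only [Polynomial.sylvester, Matrix.of_apply, Fin.addCases_left]
      split_ifs
      · exact hg _
      · simp
    · simp only [Polynomial.sylvester, Matrix.of_apply, Fin.addCases_right]
      split_ifs
      · exact hf _
      · simp
  · rw [Fin.sum_univ_add]
    simp

/-- Eliminating the first variable from an irreducible polynomial and one it does not divide. -/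
lemma exists_elimination {n : ℕ} (φ g : MvPolynomial (Fin (n + 1)) ℝ) (hφ : Irreducible φ)
    (hg : ¬ φ ∣ g) :
    ∃ R : MvPolynomial (Fin n) ℝ, R ≠ 0 ∧
      R.totalDegree ≤ φ.totalDegree * (2 * g.totalDegree + 1) ∧
      ∀ x : Fin (n + 1) → ℝ, eval x φ = 0 → eval x g = 0 → eval (fun i => x i.succ) R = 0 := by
  set Φ := finSuccEquiv ℝ n φ with hΦ
  set Γ := finSuccEquiv ℝ n g with hΓ
  have hΦirr : Irreducible Φ := (MulEquiv.irreducible_iff (finSuccEquiv ℝ n)).2 hφ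
  have hev : ∀ (q : MvPolynomial (Fin (n + 1)) ℝ) (x : Fin (n + 1) → ℝ),
      eval x q = Polynomial.eval (x 0) (Polynomial.map (eval (fun i => x i.succ))
        (finSuccEquiv ℝ n q)) := by
    intro q x
    have := eval_eq_eval_mv_eval' (fun i : Fin n => x i.succ) (x 0) q
    rw [← this]
    congr 2
    ext i
    refine Fin.cases ?_ (fun i => ?_) i <;> simp
  by_cases hd : Φ.natDegree = 0
  · refine ⟨Φ.coeff 0, ?_, ?_, ?_⟩
    · intro h
      rw [Polynomial.eq_C_of_natDegree_eq_zero hd, h] at hΦirr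
      simp at hΦirr
    · refine (totalDegree_coeff_finSuccEquiv_le φ 0).trans ?_
      exact Nat.le_mul_of_pos_right _ (by omega)
    · intro x hx _
      rw [hev, ← hΦ, Polynomial.eq_C_of_natDegree_eq_zero hd] at hx
      simpa using hx
  · refine ⟨Polynomial.resultant Φ Γ, ?_, ?_, ?_⟩
    · intro h
      let K := FractionRing (MvPolynomial (Fin n) ℝ)
      have hinj : Function.Injective (algebraMap (MvPolynomial (Fin n) ℝ) K) :=
        IsFractionRing.injective _ _
      have hprim : Φ.IsPrimitive := hΦirr.isPrimitive hd
      have h1 : Polynomial.resultant (Φ.map (algebraMap _ K)) (Γ.map (algebraMap _ K)) = 0 := by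
        have := Polynomial.resultant_map_map Φ Γ Φ.natDegree Γ.natDegree (algebraMap _ K)
        rw [h, map_zero] at this
        rw [Polynomial.natDegree_map_eq_of_injective hinj,
          Polynomial.natDegree_map_eq_of_injective hinj]
        exact this
      rw [Polynomial.resultant_eq_zero_iff] at h1
      have hirr := (hprim.irreducible_iff_irreducible_map_fraction_map (K := K)).1 hΦirr
      have h2 : Φ.map (algebraMap _ K) ∣ Γ.map (algebraMap _ K) := by
        by_contra h3
        exact h1.2 ((Irreducible.coprime_iff_not_dvd hirr).2 h3)
      have h3 : Φ ∣ Γ := (hprim.dvd_iff_fraction_map_dvd_fraction_map K).2 h2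
      apply hg
      exact (map_dvd_iff (finSuccEquiv ℝ n)).1 h3
    · refine (totalDegree_resultant_le Φ Γ _ _ φ.totalDegree g.totalDegree
        (totalDegree_coeff_finSuccEquiv_le φ) (totalDegree_coeff_finSuccEquiv_le g)).trans ?_
      have h1 := natDegree_finSuccEquiv_le φ
      have h2 := natDegree_finSuccEquiv_le g
      rw [← hΦ] at h1
      rw [← hΓ] at h2
      nlinarith
    · intro x hx hx'
      obtain ⟨p, q, -, -, h⟩ := Polynomial.exists_mul_add_mul_eq_C_resultant Φ Γ le_rfl le_rfl
        (Or.inl hd)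
      rw [hev, ← hΦ] at hx
      rw [hev, ← hΓ] at hx'
      have h1 := congrArg (fun r => Polynomial.eval (x 0)
        (Polynomial.map (eval (fun i => x i.succ)) r)) h
      simp only [Polynomial.map_add, Polynomial.map_mul, Polynomial.eval_add, Polynomial.eval_mul,
        hx, hx', zero_mul, add_zero, Polynomial.map_C, Polynomial.eval_C] at h1
      exact h1.symm

/-! ### Lines -/

/-- The line through `p` with direction `v`. -/
def ln (p v : Fin 3 → ℝ) : Set (Fin 3 → ℝ) := {x | ∃ t : ℝ, x = p + t • v}

lemma mem_ln {p v x : Fin 3 → ℝ} : x ∈ ln p v ↔ ∃ t : ℝ, x = p + t • v := Iff.rfl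

lemma isLine_iff {l : Set (Fin 3 → ℝ)} : IsLine l ↔ ∃ p v, v ≠ 0 ∧ l = ln p v := Iff.rfl

lemma isLine_ln {p v : Fin 3 → ℝ} (hv : v ≠ 0) : IsLine (ln p v) := ⟨p, v, hv, rfl⟩

lemma self_mem_ln (p v : Fin 3 → ℝ) : p ∈ ln p v := ⟨0, by simp⟩

lemma add_smul_mem_ln (p v : Fin 3 → ℝ) (t : ℝ) : p + t • v ∈ ln p v := ⟨t, rfl⟩

lemma ln_eq_of_mem {p v q : Fin 3 → ℝ} (h : q ∈ ln p v) : ln p v = ln q v := by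
  obtain ⟨t, rfl⟩ := h
  ext x
  constructor
  · rintro ⟨s, rfl⟩
    exact ⟨s - t, by module⟩
  · rintro ⟨s, rfl⟩
    exact ⟨s + t, by module⟩

lemma ln_smul {p v : Fin 3 → ℝ} {c : ℝ} (hc : c ≠ 0) : ln p (c • v) = ln p v := by
  ext x
  constructor
  · rintro ⟨s, rfl⟩
    exact ⟨s * c, by module⟩
  · rintro ⟨s, rfl⟩
    refine ⟨s / c, ?_⟩
    rw [smul_smul, div_mul_cancel₀ _ hc]

/-- A line is determined by two of its points. -/
lemma IsLine.eq_ln_of_mem {l : Set (Fin 3 → ℝ)} (hl : IsLine l) {p q : Fin 3 → ℝ} (hp : p ∈ l)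
    (hq : q ∈ l) (hpq : p ≠ q) : l = ln p (q - p) := by
  obtain ⟨a, v, hv, rfl⟩ := hl
  change p ∈ ln a v at hp
  change q ∈ ln a v at hq
  change ln a v = _
  rw [ln_eq_of_mem hp] at hq ⊢
  obtain ⟨t, rfl⟩ := hq
  have ht : t ≠ 0 := by
    rintro rfl
    simp at hpq
  rw [add_sub_cancel_left, ln_smul ht]

lemma IsLine.eq_of_mem {l m : Set (Fin 3 → ℝ)} (hl : IsLine l) (hm : IsLine m)
    {p q : Fin 3 → ℝ} (hp : p ∈ l) (hq : q ∈ l) (hp' : p ∈ m) (hq' : q ∈ m) (hpq : p ≠ q) :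
    l = m := by
  rw [IsLine.eq_ln_of_mem hl hp hq hpq, IsLine.eq_ln_of_mem hm hp' hq' hpq]

lemma IsLine.exists_eq_ln {l : Set (Fin 3 → ℝ)} (hl : IsLine l) {p : Fin 3 → ℝ} (hp : p ∈ l) :
    ∃ v, v ≠ 0 ∧ l = ln p v := by
  obtain ⟨a, v, hv, rfl⟩ := hl
  exact ⟨v, hv, ln_eq_of_mem hp⟩

/-- The zero set of a polynomial. -/
def zset (f : MvPolynomial (Fin 3) ℝ) : Set (Fin 3 → ℝ) := {x | eval x f = 0}

lemma mem_zset {f : MvPolynomial (Fin 3) ℝ} {x : Fin 3 → ℝ} : x ∈ zset f ↔ eval x f = 0 := Iff.rfl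

lemma ln_subset_zset_iff {f : MvPolynomial (Fin 3) ℝ} {p v : Fin 3 → ℝ} :
    ln p v ⊆ zset f ↔ restr p v f = 0 := by
  rw [restr_eq_zero_iff]
  constructor
  · intro h t
    exact h (add_smul_mem_ln p v t)
  · rintro h x ⟨t, rfl⟩
    exact h t

lemma subset_zset_prod {ι : Type*} {s : Finset ι} {f : ι → MvPolynomial (Fin 3) ℝ}
    {l : Set (Fin 3 → ℝ)} (hl : IsLine l) :
    l ⊆ zset (∏ i ∈ s, f i) ↔ ∃ i ∈ s, l ⊆ zset (f i) := by
  obtain ⟨p, v, hv, rfl⟩ := hl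
  change ln p v ⊆ _ ↔ ∃ i ∈ s, ln p v ⊆ _
  simp only [ln_subset_zset_iff, map_prod, Finset.prod_eq_zero_iff]

/-- The number of points of a line in a zero set not containing it. -/
lemma card_points_on_line_le {f : MvPolynomial (Fin 3) ℝ} {l : Set (Fin 3 → ℝ)} (hl : IsLine l)
    (h : ¬ l ⊆ zset f) (s : Finset (Fin 3 → ℝ)) (hs : ∀ x ∈ s, x ∈ l ∧ eval x f = 0) :
    s.card ≤ f.totalDegree := by
  obtain ⟨p, v, hv, rfl⟩ := hl
  change ¬ ln p v ⊆ _ at h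
  rw [ln_subset_zset_iff] at h
  have h1 : ∀ x ∈ s, ∃ t : ℝ, x = p + t • v := fun x hx => (hs x hx).1
  choose! τ hτ using h1
  rw [← Finset.card_image_of_injOn (f := τ) (s := s)]
  · refine card_zeros_on_line_le p v f h _ ?_
    intro t ht
    obtain ⟨x, hx, rfl⟩ := Finset.mem_image.1 ht
    rw [← hτ x hx]
    exact (hs x hx).2
  · intro x hx y hy hxy
    rw [hτ x hx, hτ y hy, hxy]

/-! ### General position -/

lemma exists_notMem_of_finite_subspaces {E ι : Type*} [AddCommGroup E] [Module ℝ E]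
    (s : Finset ι) (W : ι → Submodule ℝ E) (hW : ∀ i ∈ s, W i ≠ ⊤) : ∃ w, ∀ i ∈ s, w ∉ W i := by
  have h := Subspace.biUnion_ne_univ_of_top_notMem (s := s.image W) (by
    intro h
    obtain ⟨i, hi, h⟩ := Finset.mem_image.1 h
    exact hW i hi h)
  by_contra! h'
  apply h
  rw [Set.eq_univ_iff_forall]
  intro w
  obtain ⟨i, hi, hw⟩ := h' w
  simp only [Set.mem_iUnion]
  exact ⟨W i, Finset.mem_image_of_mem W hi, hw⟩

lemma span_pair_ne_top (a b : Fin 3 → ℝ) : Submodule.span ℝ {a, b} ≠ ⊤ := by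
  intro h
  have h1 := finrank_span_le_card (R := ℝ) ({a, b} : Set (Fin 3 → ℝ))
  rw [h, finrank_top, Module.finrank_fin_fun] at h1
  have : ({a, b} : Set (Fin 3 → ℝ)).toFinset.card ≤ 2 := by
    rw [Set.toFinset_insert, Set.toFinset_singleton]
    exact Finset.card_le_two
  omega

lemma finrank_span_pair_eq_two {a b : Fin 3 → ℝ} (h : LinearIndependent ℝ ![a, b]) :
    Module.finrank ℝ (Submodule.span ℝ {a, b}) = 2 := by
  have h1 := finrank_span_eq_card h
  have h2 : Set.range ![a, b] = {a, b} := by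
    ext x
    simp [eq_comm, or_comm]
  rwa [h2, Fintype.card_fin] at h1

/-- Distinct hyperplanes in the zero set of a polynomial, none through the point `a`. -/
lemma card_hyperplanes_le {E ι : Type*} [Fintype E] (R : MvPolynomial E ℝ) (a : E → ℝ)
    (ha : eval a R ≠ 0) (s : Finset ι) (μ : ι → (E → ℝ) →ₗ[ℝ] ℝ) (hμ : Set.InjOn μ s)
    (h0 : ∀ i ∈ s, μ i ≠ 0)
    (hz : ∀ i ∈ s, ∀ x, μ i x = 1 → eval (a + x) R = 0) : s.card ≤ R.totalDegree := by
  obtain ⟨b, hb⟩ := exists_notMem_of_finite_subspaces ((s.image fun i => (μ i)) ∪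
    ((s ×ˢ s).filter (fun q => q.1 ≠ q.2)).image (fun q => μ q.1 - μ q.2)) (fun m => LinearMap.ker m) (by
        intro m hm
        rw [ne_eq, LinearMap.ker_eq_top]
        rcases Finset.mem_union.1 hm with hm | hm
        · obtain ⟨i, hi, rfl⟩ := Finset.mem_image.1 hm
          exact h0 i hi
        · obtain ⟨q, hq, rfl⟩ := Finset.mem_image.1 hm
          rw [Finset.mem_filter, Finset.mem_product] at hq
          rw [sub_eq_zero]
          exact fun h => hq.2 (hμ hq.1.1 hq.1.2 h))
  have hb1 : ∀ i ∈ s, μ i b ≠ 0 := fun i hi h =>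
    hb (μ i) (Finset.mem_union_left _ (Finset.mem_image_of_mem _ hi)) h
  have hb2 : ∀ i ∈ s, ∀ j ∈ s, i ≠ j → μ i b ≠ μ j b := fun i hi j hj hij h =>
    hb (μ i - μ j) (Finset.mem_union_right _ (Finset.mem_image.2 ⟨(i, j), by simp [*], rfl⟩))
      (by simp [h])
  have hr : restr a b R ≠ 0 := by
    intro h
    rw [restr_eq_zero_iff] at h
    exact ha (by simpa using h 0)
  rw [← Finset.card_image_of_injOn (f := fun i => (μ i b)⁻¹) (s := s)]
  · refine card_zeros_on_line_le a b R hr _ ?_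
    intro t ht
    obtain ⟨i, hi, rfl⟩ := Finset.mem_image.1 ht
    apply hz i hi
    simp [hb1 i hi]
  · intro i hi j hj hij
    by_contra h
    exact hb2 i hi j hj h (inv_injective hij)

/-! ### Elimination in an arbitrary direction and Bézout for lines -/

lemma exists_algEquiv_of_linearEquiv {σ : Type*} [Fintype σ]
    (e : (σ → ℝ) ≃ₗ[ℝ] (σ → ℝ)) : ∃ Ψ : MvPolynomial σ ℝ ≃ₐ[ℝ] MvPolynomial σ ℝ,
      (∀ f x, eval x (Ψ f) = eval (e x) f) ∧ ∀ f, (Ψ f).totalDegree = f.totalDegree := by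
  have h1 : LinearMap.toMatrix' e.toLinearMap * LinearMap.toMatrix' e.symm.toLinearMap = 1 := by
    rw [← LinearMap.toMatrix'_comp]
    simp
  have h2 : LinearMap.toMatrix' e.symm.toLinearMap * LinearMap.toMatrix' e.toLinearMap = 1 := by
    rw [← LinearMap.toMatrix'_comp]
    simp
  refine ⟨linEquiv _ _ h1 h2, ?_, totalDegree_linEquiv _ _ h1 h2⟩
  intro f x
  rw [eval_linEquiv, LinearMap.toMatrix'_mulVec]
  rfl

lemma exists_elimination_along (φ g : MvPolynomial (Fin 3) ℝ) (hφ : Irreducible φ)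
    (hg : ¬ φ ∣ g) (w : Fin 3 → ℝ) (hw : w ≠ 0) :
    ∃ R : MvPolynomial (Fin 3) ℝ, R ≠ 0 ∧
      R.totalDegree ≤ φ.totalDegree * (2 * g.totalDegree + 1) ∧
      (∀ x, ∀ s : ℝ, eval (x + s • w) R = eval x R) ∧
      ∀ x, eval x φ = 0 → eval x g = 0 → eval x R = 0 := by
  obtain ⟨A, hA⟩ := SeparatingDual.exists_continuousLinearEquiv_apply_eq (R := ℝ)
    (x := (Pi.single 0 1 : Fin 3 → ℝ)) (y := w) (by simp) hw
  have hAs : A.symm w = Pi.single 0 1 := by rw [← hA, A.symm_apply_apply]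
  obtain ⟨Ψ, hΨ, hΨd⟩ := exists_algEquiv_of_linearEquiv A.toLinearEquiv
  obtain ⟨Θ, hΘ, hΘd⟩ := exists_algEquiv_of_linearEquiv A.symm.toLinearEquiv
  obtain ⟨R, hR0, hRd, hR⟩ := exists_elimination (Ψ φ) (Ψ g)
    ((MulEquiv.irreducible_iff Ψ).2 hφ) (fun h => hg ((map_dvd_iff Ψ).1 h))
  rw [hΨd, hΨd] at hRd
  have hΘr : ∀ x, eval x (Θ (rename Fin.succ R)) = eval (fun i : Fin 2 => A.symm x i.succ) R := by
    intro x
    rw [hΘ, eval_rename]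
    rfl
  refine ⟨Θ (rename Fin.succ R), ?_, ?_, ?_, ?_⟩
  · rw [map_ne_zero_iff _ Θ.injective, map_ne_zero_iff _ (rename_injective _ (Fin.succ_injective 2))]
    exact hR0
  · rw [hΘd]
    exact (totalDegree_rename_le _ _).trans hRd
  · intro x s
    rw [hΘr, hΘr]
    congr 2
    ext i
    simp [hAs]
  · intro x h1 h2
    rw [hΘr]
    apply hR (A.symm x)
    · rw [hΨ]
      simpa using h1
    · rw [hΨ]
      simpa using h2

/-- Bézout's theorem for lines common to an irreducible surface and another one. -/
theorem card_common_lines_le (φ g : MvPolynomial (Fin 3) ℝ) (hφ : Irreducible φ)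
    (hg : ¬ φ ∣ g) (L : Finset (Set (Fin 3 → ℝ)))
    (hL : ∀ l ∈ L, IsLine l ∧ l ⊆ zset φ ∧ l ⊆ zset g) :
    L.card ≤ φ.totalDegree * (2 * g.totalDegree + 1) := by
  have h1 : ∀ l ∈ L, ∃ p v, v ≠ 0 ∧ l = ln p v := fun l hl => (hL l hl).1
  choose! p v hv hl using h1
  let d : Set (Fin 3 → ℝ) × Set (Fin 3 → ℝ) → (Fin 3 → ℝ) := fun q =>
    if v q.2 ∈ Submodule.span ℝ {v q.1} then p q.2 - p q.1 else v q.2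
  have hd : ∀ l ∈ L, ∀ m ∈ L, l ≠ m → d (l, m) ∉ Submodule.span ℝ {v l} := by
    intro l hlL m hmL hlm
    by_cases h : v m ∈ Submodule.span ℝ {v l}
    · rw [show d (l, m) = p m - p l from if_pos h]
      intro h'
      apply hlm
      rw [Submodule.mem_span_singleton] at h h'
      obtain ⟨a, ha⟩ := h
      obtain ⟨b, hb⟩ := h'
      have ha0 : a ≠ 0 := by
        rintro rfl
        exact hv m hmL (by simpa using ha.symm)
      rw [hl l hlL, hl m hmL, ← ha, ln_smul ha0]
      apply ln_eq_of_mem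
      exact ⟨b, by rw [hb]; abel⟩
    · rwa [show d (l, m) = v m from if_neg h]
  obtain ⟨w, hw⟩ := exists_notMem_of_finite_subspaces ((L ×ˢ L) ∪ L.image (fun l => (l, l)) ∪
    {(∅, ∅)}) (fun q => Submodule.span ℝ {v q.1, d q}) (fun q _ => span_pair_ne_top _ _)
  have hw0 : w ≠ 0 := by
    rintro rfl
    exact hw (∅, ∅) (by simp) (Submodule.zero_mem _)
  obtain ⟨R, hR0, hRd, hRw, hRz⟩ := exists_elimination_along φ g hφ hg w hw0
  refine le_trans ?_ hRd
  obtain ⟨a, ha⟩ := exists_eval_ne_zero hR0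
  have hzero : ∀ l ∈ L, ∀ s t : ℝ, eval (p l + s • v l + t • w) R = 0 := by
    intro l hlL s t
    rw [hRw]
    have : p l + s • v l ∈ l := (Set.ext_iff.1 (hl l hlL) _).2 (add_smul_mem_ln _ _ _)
    exact hRz _ ((hL l hlL).2.1 this) ((hL l hlL).2.2 this)
  have hμ : ∀ l ∈ L, ∃ μ : (Fin 3 → ℝ) →ₗ[ℝ] ℝ, μ (v l) = 0 ∧ μ w = 0 ∧ μ (p l - a) = 1 := by
    intro l hlL
    have : p l - a ∉ Submodule.span ℝ {v l, w} := by
      intro h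
      obtain ⟨s, t, hst⟩ := Submodule.mem_span_pair.1 h
      apply ha
      have := hzero l hlL (-s) (-t)
      rw [eq_sub_iff_add_eq] at hst
      rwa [← hst, show s • v l + t • w + a + -s • v l + -t • w = a by module] at this
    obtain ⟨f, hf, hk⟩ := Submodule.exists_le_ker_of_notMem this
    refine ⟨(f (p l - a))⁻¹ • f, ?_, ?_, ?_⟩
    · have : f (v l) = 0 := hk (Submodule.subset_span (by simp))
      simp [this]
    · have : f w = 0 := hk (Submodule.subset_span (by simp))
      simp [this]
    · rw [LinearMap.smul_apply, smul_eq_mul, inv_mul_cancel₀ hf]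
  choose! μ hμv hμw hμp using hμ
  have hker : ∀ l ∈ L, Module.finrank ℝ (LinearMap.ker (μ l)) ≤ 2 := by
    intro l hlL
    have hlt : LinearMap.ker (μ l) < ⊤ := by
      rw [lt_top_iff_ne_top, ne_eq, LinearMap.ker_eq_top]
      intro h
      have := hμp l hlL
      simp [h] at this
    have := Submodule.finrank_lt_finrank_of_lt hlt
    rw [finrank_top, Module.finrank_fin_fun] at this
    omega
  refine card_hyperplanes_le R a ha L μ ?_ ?_ ?_
  · intro l hlL m hmL hlm
    by_contra hne
    have hlL' : l ∈ L := hlL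
    have hmL' : m ∈ L := hmL
    have hdk : μ l (d (l, m)) = 0 := by
      by_cases h : v m ∈ Submodule.span ℝ {v l}
      · rw [show d (l, m) = p m - p l from if_pos h]
        have e1 := hμp l hlL
        have e2 := hμp m hmL
        rw [← hlm] at e2
        rw [map_sub] at e1 e2 ⊢
        linarith
      · rw [show d (l, m) = v m from if_neg h, hlm]
        exact hμv m hmL
    have hle : Submodule.span ℝ {v l, d (l, m)} ≤ LinearMap.ker (μ l) := by
      rw [Submodule.span_le]
      rintro x (rfl | rfl)
      · exact hμv l hlL
      · exact hdk
    have hli : LinearIndependent ℝ ![v l, d (l, m)] := by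
      rw [LinearIndependent.pair_iff' (hv l hlL)]
      intro c hc
      exact hd l hlL m hmL hne (Submodule.mem_span_singleton.2 ⟨c, hc⟩)
    have hfr := finrank_span_pair_eq_two hli
    have heq := Submodule.eq_of_le_of_finrank_le hle (by rw [hfr]; exact hker l hlL)
    apply hw (l, m) (by simp [hlL', hmL'])
    change w ∈ Submodule.span ℝ {v l, d (l, m)}
    rw [heq]
    exact hμw l hlL
  · intro l hlL h
    have := hμp l hlL
    simp [h] at this
  · intro l hlL x hx
    have hli : LinearIndependent ℝ ![v l, w] := by
      rw [LinearIndependent.pair_iff' (hv l hlL)]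
      intro c hc
      apply hw (l, l) (by simp [hlL])
      rw [← hc]
      exact Submodule.smul_mem _ _ (Submodule.subset_span (by simp))
    have hle : Submodule.span ℝ {v l, w} ≤ LinearMap.ker (μ l) := by
      rw [Submodule.span_le]
      rintro x (rfl | rfl)
      · exact hμv l hlL
      · exact hμw l hlL
    have hfr := finrank_span_pair_eq_two hli
    have heq := Submodule.eq_of_le_of_finrank_le hle (by rw [hfr]; exact hker l hlL)
    have hmem : a + x - p l ∈ Submodule.span ℝ {v l, w} := by
      rw [heq, LinearMap.mem_ker]
      have := hμp l hlL
      rw [map_sub] at this ⊢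
      rw [map_add, hx]
      linarith
    obtain ⟨s, t, hst⟩ := Submodule.mem_span_pair.1 hmem
    have := hzero l hlL s t
    rw [add_assoc, hst] at this
    simpa using this

/-! ### Linear polynomials and planes -/

/-- The polynomial `n · x - c`. -/
noncomputable def linPoly (n : Fin 3 → ℝ) (c : ℝ) : MvPolynomial (Fin 3) ℝ :=
  ∑ i, C (n i) * X i - C c

lemma eval_linPoly (n : Fin 3 → ℝ) (c : ℝ) (x : Fin 3 → ℝ) :
    eval x (linPoly n c) = ∑ i, n i * x i - c := by
  simp [linPoly]

lemma totalDegree_linPoly_le (n : Fin 3 → ℝ) (c : ℝ) : (linPoly n c).totalDegree ≤ 1 := by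
  refine (totalDegree_sub _ _).trans ?_
  simp only [totalDegree_C, zero_le, sup_of_le_left]
  refine totalDegree_finsetSum_le fun j _ => ?_
  refine (totalDegree_mul _ _).trans ?_
  simp

lemma totalDegree_linPoly {n : Fin 3 → ℝ} (hn : n ≠ 0) (c : ℝ) :
    (linPoly n c).totalDegree = 1 := by
  apply le_antisymm (totalDegree_linPoly_le n c)
  by_contra h
  have h0 : (linPoly n c).totalDegree = 0 := by omega
  rw [totalDegree_eq_zero_iff_eq_C] at h0
  apply hn
  ext i
  have h1 := eval_linPoly n c (Pi.single i 1)
  have h2 := eval_linPoly n c 0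
  rw [h0, eval_C] at h1 h2
  simp [Pi.single_apply] at h1 h2
  simp only [Pi.zero_apply]
  linarith

lemma irreducible_of_totalDegree_one {σ : Type*} {f : MvPolynomial σ ℝ} (h : f.totalDegree = 1) :
    Irreducible f := by
  apply irreducible_of_totalDegree_eq_one h
  intro x hx
  rw [isUnit_iff_ne_zero]
  rintro rfl
  have : f = 0 := by
    ext m
    simpa using hx m
  simp [this] at h

/-- A polynomial of degree one is affine. -/
lemma eval_of_totalDegree_le_one {f : MvPolynomial (Fin 3) ℝ} (h : f.totalDegree ≤ 1)
    (x : Fin 3 → ℝ) :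
    eval x f = f.coeff 0 + ∑ i, f.coeff (Finsupp.single i 1) * x i := by
  have hf : f = C (f.coeff 0) + ∑ i, C (f.coeff (Finsupp.single i 1)) * X i := by
    ext m
    simp only [coeff_add, coeff_C, coeff_sum, coeff_C_mul, coeff_X]
    by_cases h0 : m = 0
    · subst h0
      simp
    · rw [if_neg (Ne.symm h0), zero_add]
      by_cases h1 : ∃ i, m = Finsupp.single i 1
      · obtain ⟨i, rfl⟩ := h1
        simp [Finsupp.single_left_inj]
      · push Not at h1
        rw [Finset.sum_eq_zero fun i _ => by rw [if_neg (Ne.symm (h1 i)), mul_zero]]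
        by_contra hm
        have hle := le_totalDegree (mem_support_iff.2 hm)
        rw [Finsupp.sum_fintype _ _ (fun _ => rfl), Fin.sum_univ_three] at hle
        have hle1 : m 0 + m 1 + m 2 ≤ 1 := hle.trans h
        obtain ⟨i, hi⟩ : ∃ i, m i ≠ 0 := by
          by_contra! h2
          exact h0 (Finsupp.ext h2)
        apply h1 i
        ext j
        fin_cases i <;> fin_cases j <;> simp at hi ⊢ <;> omega
  conv_lhs => rw [hf]
  simp

lemma isPlane_zset {f : MvPolynomial (Fin 3) ℝ} (h : f.totalDegree = 1) : IsPlane (zset f) := by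
  refine ⟨fun i => f.coeff (Finsupp.single i 1), - f.coeff 0, ?_, ?_⟩
  · intro h0
    have h1 : f = C (f.coeff 0) := by
      apply MvPolynomial.funext
      intro x
      rw [eval_of_totalDegree_le_one h.le, eval_C]
      simp [fun i => congrFun h0 i]
    rw [h1, totalDegree_C] at h
    omega
  · ext x
    rw [mem_zset, eval_of_totalDegree_le_one h.le, Set.mem_ofPred_eq]
    constructor <;> intro h <;> linarith

lemma card_lines_in_plane_le {f : MvPolynomial (Fin 3) ℝ} {n : Fin 3 → ℝ} (hn : n ≠ 0) (c : ℝ)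
    (h : ¬ linPoly n c ∣ f) (L : Finset (Set (Fin 3 → ℝ)))
    (hL : ∀ l ∈ L, IsLine l ∧ l ⊆ zset f ∧ ∀ x ∈ l, ∑ i, n i * x i = c) :
    L.card ≤ 2 * f.totalDegree + 1 := by
  have := card_common_lines_le (linPoly n c) f
    (irreducible_of_totalDegree_one (totalDegree_linPoly hn c)) h L (by
      intro l hl
      refine ⟨(hL l hl).1, ?_, (hL l hl).2.1⟩
      intro x hx
      rw [mem_zset, eval_linPoly, (hL l hl).2.2 x hx, sub_self])
  rwa [totalDegree_linPoly hn, one_mul] at this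

lemma not_linPoly_dvd {φ : MvPolynomial (Fin 3) ℝ} (hφ : Irreducible φ) (hd : 2 ≤ φ.totalDegree)
    {n : Fin 3 → ℝ} (hn : n ≠ 0) (c : ℝ) : ¬ linPoly n c ∣ φ := by
  intro h
  have h1 := irreducible_of_totalDegree_one (totalDegree_linPoly hn c)
  have h2 : φ ∣ linPoly n c := (h1.associated_of_dvd hφ h).symm.dvd
  have h3 := totalDegree_le_of_dvd_of_isDomain h2 h1.ne_zero
  rw [totalDegree_linPoly hn] at h3
  omega

/-- An irreducible nonlinear surface contains only finitely many lines of a given plane. -/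
lemma finite_lines_in_plane {φ : MvPolynomial (Fin 3) ℝ} (hφ : Irreducible φ)
    (hd : 2 ≤ φ.totalDegree) {n : Fin 3 → ℝ} (hn : n ≠ 0) (c : ℝ) :
    {l | IsLine l ∧ l ⊆ zset φ ∧ ∀ x ∈ l, ∑ i, n i * x i = c}.Finite := by
  by_contra hinf
  obtain ⟨T, hT, hc⟩ := Set.Infinite.exists_subset_card_eq hinf (2 * φ.totalDegree + 2)
  have := card_lines_in_plane_le hn c (not_linPoly_dvd hφ hd hn c) T (fun l hl => hT hl)
  omega

/-- A surface with infinitely many lines through a point is a cone. -/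
lemma cone_of_infinite {φ : MvPolynomial (Fin 3) ℝ} (hφ : Irreducible φ) (p : Fin 3 → ℝ)
    (hinf : {l | IsLine l ∧ l ⊆ zset φ ∧ p ∈ l}.Infinite) {x : Fin 3 → ℝ} (hx : x ∈ zset φ) :
    ln p (x - p) ⊆ zset φ := by
  rintro y ⟨s, rfl⟩
  let g := asub (s • (1 : Matrix (Fin 3) (Fin 3) ℝ)) ((1 - s) • p) φ
  have hg : ∀ z, eval z g = eval (p + s • (z - p)) φ := by
    intro z
    rw [eval_asub]
    congr 2
    rw [Matrix.smul_mulVec, Matrix.one_mulVec]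
    module
  have hdvd : φ ∣ g := by
    by_contra h
    obtain ⟨T, hT, hc⟩ := Set.Infinite.exists_subset_card_eq hinf
      (φ.totalDegree * (2 * g.totalDegree + 1) + 1)
    have := card_common_lines_le φ g hφ h T (by
      intro l hl
      obtain ⟨h1, h2, h3⟩ := hT hl
      refine ⟨h1, h2, ?_⟩
      obtain ⟨v, hv, rfl⟩ := IsLine.exists_eq_ln h1 h3
      rintro z ⟨t, rfl⟩
      rw [mem_zset, hg]
      apply h2
      exact ⟨s * t, by module⟩)
    omega
  obtain ⟨q, hq⟩ := hdvd
  rw [mem_zset, ← hg, hq, map_mul, show eval x φ = 0 from hx, zero_mul]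

/-- Three points span a plane. -/
lemma exists_plane_of_three (p q r : Fin 3 → ℝ) : ∃ (n : Fin 3 → ℝ) (c : ℝ), n ≠ 0 ∧
    ∑ i, n i * p i = c ∧ ∑ i, n i * q i = c ∧ ∑ i, n i * r i = c := by
  obtain ⟨w, hw⟩ : ∃ w, w ∉ Submodule.span ℝ {q - p, r - p} := by
    by_contra! h
    exact span_pair_ne_top (q - p) (r - p) (Submodule.eq_top_iff'.2 h)
  obtain ⟨f, hf, hk⟩ := Submodule.exists_le_ker_of_notMem hw
  have hfx : ∀ x, f x = ∑ i, f (Pi.single i 1) * x i := by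
    intro x
    rw [LinearMap.pi_apply_eq_sum_univ]
    refine Finset.sum_congr rfl fun i _ => ?_
    rw [smul_eq_mul, mul_comm]
    congr 2
    ext j
    simp [Pi.single_apply, eq_comm]
  have h1 : f (q - p) = 0 := hk (Submodule.subset_span (by simp))
  have h2 : f (r - p) = 0 := hk (Submodule.subset_span (by simp))
  refine ⟨fun i => f (Pi.single i 1), f p, ?_, (hfx p).symm, ?_, ?_⟩
  · intro h
    apply hf
    rw [hfx]
    exact Finset.sum_eq_zero fun i _ => by rw [show f (Pi.single i 1) = 0 from congrFun h i, zero_mul]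
  · rw [← hfx]
    rw [map_sub] at h1
    linarith
  · rw [← hfx]
    rw [map_sub] at h2
    linarith

lemma ln_subset_plane {n : Fin 3 → ℝ} {c : ℝ} {p q : Fin 3 → ℝ} (hp : ∑ i, n i * p i = c)
    (hq : ∑ i, n i * q i = c) : ∀ x ∈ ln p (q - p), ∑ i, n i * x i = c := by
  rintro x ⟨t, rfl⟩
  simp only [Fin.sum_univ_three, Pi.add_apply, Pi.smul_apply, Pi.sub_apply, smul_eq_mul] at *
  linear_combination (1 - t) * hp + t * hq

/-- An irreducible nonlinear surface cannot be a cone with two apexes on a line, with a point off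
this line. -/
lemma not_two_apexes {φ : MvPolynomial (Fin 3) ℝ} (hφ : Irreducible φ) (hd : 2 ≤ φ.totalDegree)
    {p q r : Fin 3 → ℝ} (hpq : p ≠ q) (hr : r ∈ zset φ) (hrl : r ∉ ln p (q - p))
    (hp : ∀ x ∈ zset φ, ln p (x - p) ⊆ zset φ) (hq : ∀ x ∈ zset φ, ln q (x - q) ⊆ zset φ) :
    False := by
  obtain ⟨n, c, hn, h1, h2, h3⟩ := exists_plane_of_three p q r
  have hrp : r ≠ p := by
    rintro rfl
    exact hrl (self_mem_ln _ _)
  have hqr : q ∉ ln p (r - p) := by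
    intro h
    apply hrl
    rw [← IsLine.eq_ln_of_mem (isLine_ln (sub_ne_zero.2 hrp)) (self_mem_ln _ _) h hpq]
    exact ⟨1, by module⟩
  refine (Set.infinite_of_injective_forall_mem (f := fun t : ℝ =>
    ln q (p + t • (r - p) - q)) ?_ ?_) (finite_lines_in_plane hφ hd hn c)
  · intro t t' htt
    by_contra hne
    have hm : ∀ u : ℝ, p + u • (r - p) ∈ ln q (p + u • (r - p) - q) := fun u => ⟨1, by module⟩
    have hne' : p + t • (r - p) ≠ p + t' • (r - p) := by
      intro h
      have h5 : (t - t') • (r - p) = 0 := by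
        rw [sub_smul, sub_eq_zero]
        exact add_left_cancel h
      rcases smul_eq_zero.1 h5 with h6 | h6
      · exact hne (sub_eq_zero.1 h6)
      · exact hrp (sub_eq_zero.1 h6)
    have hl1 : IsLine (ln q (p + t • (r - p) - q)) := by
      apply isLine_ln
      intro h
      exact hqr ⟨t, (sub_eq_zero.1 h).symm⟩
    have hm2 : p + t' • (r - p) ∈ ln q (p + t • (r - p) - q) := by
      simp only at htt
      rw [htt]
      exact hm t'
    have := IsLine.eq_of_mem hl1 (isLine_ln (sub_ne_zero.2 hrp)) (hm t) hm2
      (add_smul_mem_ln p (r - p) t) (add_smul_mem_ln p (r - p) t') hne'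
    apply hqr
    rw [← this]
    exact self_mem_ln _ _
  · intro t
    refine ⟨?_, ?_, ?_⟩
    · apply isLine_ln
      intro h
      exact hqr ⟨t, (sub_eq_zero.1 h).symm⟩
    · exact hq _ (hp r hr (add_smul_mem_ln _ _ _))
    · exact ln_subset_plane h2 (ln_subset_plane h1 h3 _ (add_smul_mem_ln _ _ _))

/-! ### Tangential differentiation on a surface -/

lemma hasStrictFDerivAt_eval {σ : Type*} [Fintype σ] (p : MvPolynomial σ ℝ) (x : σ → ℝ) :
    HasStrictFDerivAt (fun y : σ → ℝ => eval y p)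
      (∑ i, eval x (pderiv i p) • (ContinuousLinearMap.proj i : (σ → ℝ) →L[ℝ] ℝ)) x := by
  induction p using MvPolynomial.induction_on with
  | C a =>
    simp only [eval_C, pderiv_C, map_zero, zero_smul, Finset.sum_const_zero]
    exact hasStrictFDerivAt_const a x
  | add p q hp hq =>
    simp only [map_add, add_smul, Finset.sum_add_distrib]
    exact hp.add hq
  | mul_X p j hp =>
    have h := hp.mul (ContinuousLinearMap.proj j : (σ → ℝ) →L[ℝ] ℝ).hasStrictFDerivAt (x := x)
    simp only [ContinuousLinearMap.proj_apply] at h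
    simp only [map_mul, eval_X]
    refine HasStrictFDerivAt.congr_fderiv (f := fun y : σ → ℝ => eval y p * y j) h ?_
    symm
    ext v
    simp only [Derivation.leibniz, pderiv_X, smul_eq_mul, map_add, map_mul, eval_X,
      add_apply, smul_apply, sum_apply,
      ContinuousLinearMap.proj_apply, add_mul, Finset.sum_add_distrib, Finset.mul_sum]
    congr 1
    · rw [Finset.sum_eq_single j]
      · simp
      · intro i _ hij
        simp [hij.symm]
      · simp
    · refine Finset.sum_congr rfl fun i _ => ?_
      ring

/-- The gradient pairing `∑ τ i ∂ᵢφ(x)`. -/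
noncomputable def dAlong (φ : MvPolynomial (Fin 3) ℝ) (x τ : Fin 3 → ℝ) : ℝ :=
  ∑ i, eval x (pderiv i φ) * τ i

/-- A function vanishing on a surface near a smooth point has zero tangential derivatives there. -/
lemma tangential_deriv_eq_zero {φ : MvPolynomial (Fin 3) ℝ} {x τ : Fin 3 → ℝ} (hx : x ∈ zset φ)
    {i : Fin 3} (hi : eval x (pderiv i φ) ≠ 0) {V : Set (Fin 3 → ℝ)} (hV : V ∈ nhds x)
    {G : (Fin 3 → ℝ) → ℝ} {G' : (Fin 3 → ℝ) →L[ℝ] ℝ} (hG : HasStrictFDerivAt G G' x)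
    (hG0 : ∀ y ∈ V, y ∈ zset φ → G y = 0) (hτ : dAlong φ x τ = 0) : G' τ = 0 := by
  have hmin : IsLocalMinOn G {y | eval y φ = eval x φ} x := by
    filter_upwards [mem_nhdsWithin_of_mem_nhds hV, self_mem_nhdsWithin] with y hy hy'
    rw [hG0 x (mem_of_mem_nhds hV) hx, hG0 y hy]
    exact hy'.trans hx
  obtain ⟨a, b, hab, h⟩ := IsLocalExtrOn.exists_multipliers_of_hasStrictFDerivAt_1d
    (Or.inl hmin) (hasStrictFDerivAt_eval φ x) hG
  have hb : b ≠ 0 := by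
    rintro rfl
    have h1 := congrArg (fun T => T (Pi.single i 1)) h
    simp only [zero_smul, add_zero, smul_apply, sum_apply,
      ContinuousLinearMap.proj_apply, smul_eq_mul, Pi.single_apply, mul_ite, mul_one, mul_zero,
      Finset.sum_ite_eq', Finset.mem_univ, if_true, zero_apply] at h1
    rcases mul_eq_zero.1 h1 with h1 | h1
    · exact hab (by simp [h1])
    · exact hi h1
  have h1 := congrArg (fun T => T τ) h
  simp only [add_apply, smul_apply,
    sum_apply, ContinuousLinearMap.proj_apply, smul_eq_mul,
    zero_apply] at h1
  rw [dAlong] at hτ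
  rw [hτ, mul_zero, zero_add] at h1
  exact (mul_eq_zero.1 h1).resolve_left hb

/-- Polynomials in a point (the left variables) and a direction (the right variables). -/
abbrev JetPoly := MvPolynomial (Fin 3 ⊕ Fin 3) ℝ

/-- Evaluation at a point and a direction. -/
noncomputable abbrev jeval (x v : Fin 3 → ℝ) : JetPoly →+* ℝ := eval (Sum.elim x v)

lemma hasStrictFDerivAt_jeval (p : JetPoly) {v : (Fin 3 → ℝ) → (Fin 3 → ℝ)}
    {v' : (Fin 3 → ℝ) →L[ℝ] (Fin 3 → ℝ)} {x : Fin 3 → ℝ} (hv : HasStrictFDerivAt v v' x) :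
    ∃ T : (Fin 3 → ℝ) →L[ℝ] ℝ, HasStrictFDerivAt (fun y => jeval y (v y) p) T x ∧
      ∀ τ, T τ = ∑ i, jeval x (v x) (pderiv (Sum.inl i) p) * τ i +
        ∑ i, jeval x (v x) (pderiv (Sum.inr i) p) * v' τ i := by
  have h1 : HasStrictFDerivAt (fun y => (Sum.elim y (v y) : Fin 3 ⊕ Fin 3 → ℝ))
      (ContinuousLinearMap.pi (fun s : Fin 3 ⊕ Fin 3 => s.elim
        (fun i => (ContinuousLinearMap.proj i : (Fin 3 → ℝ) →L[ℝ] ℝ))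
        (fun i => (ContinuousLinearMap.proj i : (Fin 3 → ℝ) →L[ℝ] ℝ).comp v'))) x := by
    rw [hasStrictFDerivAt_pi']
    rintro (i | i)
    · exact (ContinuousLinearMap.proj i : (Fin 3 → ℝ) →L[ℝ] ℝ).hasStrictFDerivAt
    · exact (ContinuousLinearMap.proj i : (Fin 3 → ℝ) →L[ℝ] ℝ).hasStrictFDerivAt.comp x hv
  refine ⟨_, (hasStrictFDerivAt_eval p _).comp x h1, fun τ => ?_⟩
  simp [Fintype.sum_sum_type]

/-- The derivation `∑ vᵢ ∂ᵢ` on polynomials in a point and a direction. -/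
noncomputable def flow : JetPoly → JetPoly := fun p =>
  ∑ i, X (Sum.inr i) * pderiv (Sum.inl i) p

/-- The `k`-th directional derivative of `φ`. -/
noncomputable def dirDeriv (φ : MvPolynomial (Fin 3) ℝ) (k : ℕ) : JetPoly :=
  flow^[k] (rename Sum.inl φ)

lemma dirDeriv_zero (φ : MvPolynomial (Fin 3) ℝ) : dirDeriv φ 0 = rename Sum.inl φ := rfl

lemma dirDeriv_succ (φ : MvPolynomial (Fin 3) ℝ) (k : ℕ) :
    dirDeriv φ (k + 1) = flow (dirDeriv φ k) := by
  rw [dirDeriv, dirDeriv, Function.iterate_succ_apply']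

lemma jeval_flow (x v : Fin 3 → ℝ) (p : JetPoly) :
    jeval x v (flow p) = ∑ i, jeval x v (pderiv (Sum.inl i) p) * v i := by
  simp [flow, mul_comm]

lemma jeval_rename (x v : Fin 3 → ℝ) (φ : MvPolynomial (Fin 3) ℝ) :
    jeval x v (rename Sum.inl φ) = eval x φ := by
  rw [jeval, eval_rename]
  rfl

lemma derivative_restr_jet (x v : Fin 3 → ℝ) (p : JetPoly) :
    Polynomial.derivative (restr (Sum.elim x v) (Sum.elim v 0) p) =
      restr (Sum.elim x v) (Sum.elim v 0) (flow p) := by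
  induction p using MvPolynomial.induction_on with
  | C a => simp [flow, restr]
  | add p q hp hq => simp only [flow] at hp hq; simp [flow, hp, hq, mul_add, Finset.sum_add_distrib]
  | mul_X p j hp =>
    have hfl : flow (p * X j) = flow p * X j + p * flow (X j) := by
      simp only [flow, Derivation.leibniz, smul_eq_mul, Finset.sum_mul, Finset.mul_sum,
        ← Finset.sum_add_distrib]
      refine Finset.sum_congr rfl fun i _ => ?_
      ring
    rw [hfl, map_mul, Polynomial.derivative_mul, hp, map_add, map_mul, map_mul]
    congr 2
    rcases j with j | j
    · have : flow (X (Sum.inl j)) = X (Sum.inr j) := by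
        simp only [flow, pderiv_X]
        rw [Finset.sum_eq_single j]
        · simp
        · intro i _ hij
          have h : (Sum.inl j : Fin 3 ⊕ Fin 3) ≠ Sum.inl i := fun h => hij (Sum.inl_injective h).symm
          rw [Pi.single_eq_of_ne h, mul_zero]
        · simp
      rw [this]
      simp [restr]
    · have : flow (X (Sum.inr j)) = 0 := by
        simp [flow, pderiv_X]
      rw [this]
      simp [restr]

/-- A line is contained in a surface once all directional derivatives vanish at one point. -/
lemma ln_subset_zset_of_dirDeriv {φ : MvPolynomial (Fin 3) ℝ} {x v : Fin 3 → ℝ}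
    (h : ∀ k, jeval x v (dirDeriv φ k) = 0) : ln x v ⊆ zset φ := by
  rw [ln_subset_zset_iff]
  have h1 : restr x v φ = restr (Sum.elim x v) (Sum.elim v 0) (dirDeriv φ 0) := by
    rw [dirDeriv_zero, restr, restr, aeval_rename]
    rfl
  have h2 : ∀ k, Polynomial.derivative^[k] (restr x v φ) =
      restr (Sum.elim x v) (Sum.elim v 0) (dirDeriv φ k) := by
    intro k
    induction k with
    | zero => exact h1
    | succ k ih => rw [Function.iterate_succ_apply', ih, derivative_restr_jet, dirDeriv_succ]
  ext k
  have h3 : (Polynomial.derivative^[k] (restr x v φ)).eval 0 = 0 := by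
    rw [h2, eval_restr, zero_smul, add_zero]
    exact h k
  rw [← Polynomial.coeff_zero_eq_eval_zero, Polynomial.coeff_iterate_derivative] at h3
  simp only [zero_add, Nat.descFactorial_self, nsmul_eq_mul, mul_eq_zero, Nat.cast_eq_zero] at h3
  simpa using h3.resolve_left (Nat.factorial_ne_zero k)

lemma dirDeriv_of_ln_subset {φ : MvPolynomial (Fin 3) ℝ} {x v : Fin 3 → ℝ}
    (h : ln x v ⊆ zset φ) (k : ℕ) : jeval x v (dirDeriv φ k) = 0 := by
  rw [ln_subset_zset_iff] at h
  have h1 : restr x v φ = restr (Sum.elim x v) (Sum.elim v 0) (dirDeriv φ 0) := by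
    rw [dirDeriv_zero, restr, restr, aeval_rename]
    rfl
  have h2 : ∀ k, restr (Sum.elim x v) (Sum.elim v 0) (dirDeriv φ k) = 0 := by
    intro k
    induction k with
    | zero => rw [← h1, h]
    | succ k ih => rw [dirDeriv_succ, ← derivative_restr_jet, ih, Polynomial.derivative_zero]
  have h3 := congrArg (Polynomial.eval 0) (h2 k)
  rwa [eval_restr, zero_smul, add_zero, Polynomial.eval_zero] at h3

/-- Data of a differentiable vector field `v` near smooth points of the surface `φ = 0`. -/
structure SmoothField (φ : MvPolynomial (Fin 3) ℝ) (V : Set (Fin 3 → ℝ))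
    (v : (Fin 3 → ℝ) → (Fin 3 → ℝ)) (v' : (Fin 3 → ℝ) → (Fin 3 → ℝ) →L[ℝ] (Fin 3 → ℝ)) : Prop where
  isOpen : IsOpen V
  smooth : ∀ x ∈ V, ∃ i, eval x (pderiv i φ) ≠ 0
  hasDeriv : ∀ x ∈ V, HasStrictFDerivAt v (v' x) x

lemma SmoothField.deriv_eq_zero {φ : MvPolynomial (Fin 3) ℝ} {V : Set (Fin 3 → ℝ)}
    {v : (Fin 3 → ℝ) → (Fin 3 → ℝ)} {v' : (Fin 3 → ℝ) → (Fin 3 → ℝ) →L[ℝ] (Fin 3 → ℝ)}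
    (hS : SmoothField φ V v v') {p : JetPoly}
    (hp : ∀ x ∈ V, x ∈ zset φ → jeval x (v x) p = 0) {x τ : Fin 3 → ℝ} (hxV : x ∈ V)
    (hx : x ∈ zset φ) (hτ : dAlong φ x τ = 0) :
    ∑ i, jeval x (v x) (pderiv (Sum.inl i) p) * τ i +
        ∑ i, jeval x (v x) (pderiv (Sum.inr i) p) * v' x τ i = 0 := by
  obtain ⟨T, hT, hT'⟩ := hasStrictFDerivAt_jeval p (hS.hasDeriv x hxV)
  obtain ⟨i, hi⟩ := hS.smooth x hxV
  rw [← hT']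
  exact tangential_deriv_eq_zero hx hi (hS.isOpen.mem_nhds hxV) hT hp hτ

/-- If a tangent field is constant along itself, its integral curves are lines. -/
lemma SmoothField.ln_subset {φ : MvPolynomial (Fin 3) ℝ} {V : Set (Fin 3 → ℝ)}
    {v : (Fin 3 → ℝ) → (Fin 3 → ℝ)} {v' : (Fin 3 → ℝ) → (Fin 3 → ℝ) →L[ℝ] (Fin 3 → ℝ)}
    (hS : SmoothField φ V v v') (ht : ∀ x ∈ V, x ∈ zset φ → dAlong φ x (v x) = 0)
    (hc : ∀ x ∈ V, x ∈ zset φ → v' x (v x) = 0) {x : Fin 3 → ℝ} (hxV : x ∈ V) (hx : x ∈ zset φ) :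
    ln x (v x) ⊆ zset φ := by
  have h : ∀ k, ∀ x ∈ V, x ∈ zset φ → jeval x (v x) (dirDeriv φ k) = 0 := by
    intro k
    induction k with
    | zero =>
      intro x _ hx
      rw [dirDeriv_zero, jeval_rename]
      exact hx
    | succ k ih =>
      intro x hxV hx
      have := hS.deriv_eq_zero ih hxV hx (ht x hxV hx)
      rw [hc x hxV hx] at this
      rw [dirDeriv_succ, jeval_flow]
      simpa using this
  exact ln_subset_zset_of_dirDeriv fun k => h k x hxV hx

/-! ### Second and third order forms of a surface -/

/-- The Hessian form. -/
noncomputable def hess (φ : MvPolynomial (Fin 3) ℝ) (x a b : Fin 3 → ℝ) : ℝ :=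
  ∑ i, ∑ j, eval x (pderiv i (pderiv j φ)) * a i * b j

/-- The third derivative form. -/
noncomputable def third (φ : MvPolynomial (Fin 3) ℝ) (x a b c : Fin 3 → ℝ) : ℝ :=
  ∑ i, ∑ j, ∑ k, eval x (pderiv i (pderiv j (pderiv k φ))) * a i * b j * c k

lemma pderiv_comm {σ : Type*} (i j : σ) (f : MvPolynomial σ ℝ) :
    pderiv i (pderiv j f) = pderiv j (pderiv i f) := by
  have h : ⁅(pderiv i : Derivation ℝ (MvPolynomial σ ℝ) (MvPolynomial σ ℝ)),
      (pderiv j : Derivation ℝ (MvPolynomial σ ℝ) (MvPolynomial σ ℝ))⁆ = 0 := by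
    ext k
    rw [Derivation.commutator_apply, pderiv_X, pderiv_X]
    simp only [Pi.single_apply, Derivation.coe_zero, Pi.zero_apply]
    split_ifs <;> simp
  have := congrArg (fun D => D f) h
  rw [Derivation.commutator_apply, Derivation.coe_zero, Pi.zero_apply] at this
  exact sub_eq_zero.1 this

lemma hess_symm (φ : MvPolynomial (Fin 3) ℝ) (x a b : Fin 3 → ℝ) :
    hess φ x a b = hess φ x b a := by
  rw [hess, hess, Finset.sum_comm]
  refine Finset.sum_congr rfl fun i _ => Finset.sum_congr rfl fun j _ => ?_
  rw [pderiv_comm]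
  ring

lemma third_swap_right (φ : MvPolynomial (Fin 3) ℝ) (x a b c : Fin 3 → ℝ) :
    third φ x a b c = third φ x a c b := by
  rw [third, third]
  refine Finset.sum_congr rfl fun i _ => ?_
  rw [Finset.sum_comm]
  refine Finset.sum_congr rfl fun j _ => Finset.sum_congr rfl fun k _ => ?_
  rw [pderiv_comm j k]
  ring

lemma third_swap_left (φ : MvPolynomial (Fin 3) ℝ) (x a b c : Fin 3 → ℝ) :
    third φ x a b c = third φ x b a c := by
  rw [third, third, Finset.sum_comm]
  refine Finset.sum_congr rfl fun i _ => Finset.sum_congr rfl fun j _ =>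
    Finset.sum_congr rfl fun k _ => ?_
  rw [pderiv_comm i j]
  ring

lemma pderiv_inl_rename (i : Fin 3) (p : MvPolynomial (Fin 3) ℝ) :
    pderiv (Sum.inl i : Fin 3 ⊕ Fin 3) (rename Sum.inl p) = rename Sum.inl (pderiv i p) :=
  pderiv_rename Sum.inl_injective _ _

lemma pderiv_inr_rename (i : Fin 3) (p : MvPolynomial (Fin 3) ℝ) :
    pderiv (Sum.inr i : Fin 3 ⊕ Fin 3) (rename Sum.inl p) = 0 := by
  induction p using MvPolynomial.induction_on with
  | C a => simp
  | add p q hp hq => simp [hp, hq]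
  | mul_X p j hp => simp [hp, pderiv_X]

lemma pderiv_inl_X_inr (i j : Fin 3) :
    pderiv (Sum.inl i : Fin 3 ⊕ Fin 3) (X (Sum.inr j) : JetPoly) = 0 := by
  simp [pderiv_X]

lemma pderiv_inr_X_inr (i j : Fin 3) :
    pderiv (Sum.inr i : Fin 3 ⊕ Fin 3) (X (Sum.inr j) : JetPoly) = if i = j then 1 else 0 := by
  by_cases h : i = j <;> simp [pderiv_X, h]

lemma flow_rename (p : MvPolynomial (Fin 3) ℝ) :
    flow (rename Sum.inl p) = ∑ i, X (Sum.inr i) * rename Sum.inl (pderiv i p) := by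
  simp only [flow, pderiv_inl_rename]

lemma dirDeriv_one (φ : MvPolynomial (Fin 3) ℝ) :
    dirDeriv φ 1 = ∑ i, X (Sum.inr i) * rename Sum.inl (pderiv i φ) := by
  rw [dirDeriv_succ, dirDeriv_zero, flow_rename]

lemma dirDeriv_two (φ : MvPolynomial (Fin 3) ℝ) :
    dirDeriv φ 2 = ∑ i, X (Sum.inr i) *
      ∑ j, X (Sum.inr j) * rename Sum.inl (pderiv i (pderiv j φ)) := by
  rw [dirDeriv_succ, dirDeriv_one, flow]
  refine Finset.sum_congr rfl fun i _ => ?_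
  simp only [map_sum, Derivation.leibniz, pderiv_inl_X_inr, mul_zero, add_zero, smul_eq_mul,
    pderiv_inl_rename]

lemma dirDeriv_three (φ : MvPolynomial (Fin 3) ℝ) :
    dirDeriv φ 3 = ∑ i, X (Sum.inr i) * ∑ j, X (Sum.inr j) *
      ∑ k, X (Sum.inr k) * rename Sum.inl (pderiv i (pderiv j (pderiv k φ))) := by
  rw [dirDeriv_succ, dirDeriv_two, flow]
  refine Finset.sum_congr rfl fun i _ => ?_
  simp only [map_sum, Derivation.leibniz, pderiv_inl_X_inr, mul_zero, add_zero, smul_eq_mul,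
    pderiv_inl_rename]

lemma jeval_dirDeriv_one (φ : MvPolynomial (Fin 3) ℝ) (x v : Fin 3 → ℝ) :
    jeval x v (dirDeriv φ 1) = dAlong φ x v := by
  rw [dirDeriv_one, dAlong, map_sum]
  refine Finset.sum_congr rfl fun i _ => ?_
  rw [map_mul, jeval_rename, eval_X, mul_comm]
  rfl

lemma jeval_dirDeriv_two (φ : MvPolynomial (Fin 3) ℝ) (x v : Fin 3 → ℝ) :
    jeval x v (dirDeriv φ 2) = hess φ x v v := by
  simp only [dirDeriv_two, hess, map_sum, map_mul, jeval_rename, eval_X, Sum.elim_inr,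
    Finset.mul_sum]
  refine Finset.sum_congr rfl fun i _ => Finset.sum_congr rfl fun j _ => ?_
  ring

lemma jeval_dirDeriv_three (φ : MvPolynomial (Fin 3) ℝ) (x v : Fin 3 → ℝ) :
    jeval x v (dirDeriv φ 3) = third φ x v v v := by
  simp only [dirDeriv_three, third, map_sum, map_mul, jeval_rename, eval_X, Sum.elim_inr,
    Finset.mul_sum]
  refine Finset.sum_congr rfl fun i _ => Finset.sum_congr rfl fun j _ =>
    Finset.sum_congr rfl fun k _ => ?_
  ring

section Field

variable {φ : MvPolynomial (Fin 3) ℝ} {V : Set (Fin 3 → ℝ)}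
    {v : (Fin 3 → ℝ) → (Fin 3 → ℝ)} {v' : (Fin 3 → ℝ) → (Fin 3 → ℝ) →L[ℝ] (Fin 3 → ℝ)}

lemma SmoothField.deriv_tangent (hS : SmoothField φ V v v')
    (h1 : ∀ x ∈ V, x ∈ zset φ → dAlong φ x (v x) = 0) {x τ : Fin 3 → ℝ} (hxV : x ∈ V)
    (hx : x ∈ zset φ) (hτ : dAlong φ x τ = 0) : hess φ x τ (v x) + dAlong φ x (v' x τ) = 0 := by
  have h := hS.deriv_eq_zero (p := dirDeriv φ 1)
    (fun x hxV hx => by rw [jeval_dirDeriv_one, h1 x hxV hx]) hxV hx hτ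
  rw [← h, dirDeriv_one]
  simp only [hess, dAlong, map_sum, Derivation.leibniz, pderiv_inl_X_inr, pderiv_inr_X_inr,
    pderiv_inl_rename, pderiv_inr_rename, add_zero, zero_add, smul_eq_mul, map_mul,
    jeval_rename, eval_X, Sum.elim_inr, mul_ite, mul_one, mul_zero, Finset.sum_ite_eq,
    Finset.mem_univ, if_true, Finset.sum_mul]
  congr 1
  refine Finset.sum_congr rfl fun i _ => Finset.sum_congr rfl fun j _ => ?_
  ring

lemma SmoothField.deriv_hess (hS : SmoothField φ V v v')
    (h1 : ∀ x ∈ V, x ∈ zset φ → hess φ x (v x) (v x) = 0) {x τ : Fin 3 → ℝ} (hxV : x ∈ V)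
    (hx : x ∈ zset φ) (hτ : dAlong φ x τ = 0) :
    third φ x τ (v x) (v x) + 2 * hess φ x (v' x τ) (v x) = 0 := by
  have h := hS.deriv_eq_zero (p := dirDeriv φ 2)
    (fun x hxV hx => by rw [jeval_dirDeriv_two, h1 x hxV hx]) hxV hx hτ
  rw [← h, dirDeriv_two]
  simp only [hess, third, Derivation.leibniz, pderiv_inl_X_inr, pderiv_inr_X_inr,
    pderiv_inl_rename, pderiv_inr_rename, add_zero, zero_add, smul_eq_mul, map_mul,
    map_add, jeval_rename, eval_X, Sum.elim_inr, mul_zero, Fin.sum_univ_three, apply_ite (jeval _ _),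
    map_zero, map_one]
  simp only [Fin.isValue, ↓reduceIte, mul_one, mul_zero, zero_add, add_zero, zero_ne_one, one_ne_zero,
    Fin.reduceEq, pderiv_comm (1 : Fin 3) 0,
    pderiv_comm (2 : Fin 3) 0, pderiv_comm (2 : Fin 3) 1]
  ring

end Field

/-! ### Surfaces ruled by a direction field -/

/-- The `i`-th basis vector. -/
noncomputable abbrev bv (i : Fin 3) : Fin 3 → ℝ := Pi.single i 1

lemma hess_expand (φ : MvPolynomial (Fin 3) ℝ) (x a b : Fin 3 → ℝ) :
    hess φ x a b = a 0 * hess φ x (bv 0) b + a 1 * hess φ x (bv 1) b + a 2 * hess φ x (bv 2) b := by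
  simp [hess, Fin.sum_univ_three]
  ring

lemma third_expand (φ : MvPolynomial (Fin 3) ℝ) (x a b c : Fin 3 → ℝ) :
    third φ x a b c = a 0 * third φ x (bv 0) b c + a 1 * third φ x (bv 1) b c +
      a 2 * third φ x (bv 2) b c := by
  simp [third, Fin.sum_univ_three]
  ring

lemma dAlong_expand (φ : MvPolynomial (Fin 3) ℝ) (x a : Fin 3 → ℝ) :
    dAlong φ x a = eval x (pderiv 0 φ) * a 0 + eval x (pderiv 1 φ) * a 1 +
      eval x (pderiv 2 φ) * a 2 := by
  simp [dAlong, Fin.sum_univ_three]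

/-- The tangent field with first coordinates `1, U`. -/
noncomputable def mfield (φ : MvPolynomial (Fin 3) ℝ) (U : (Fin 3 → ℝ) → ℝ) (x : Fin 3 → ℝ) :
    Fin 3 → ℝ :=
  ![1, U x, -(eval x (pderiv 0 φ) + U x * eval x (pderiv 1 φ)) / eval x (pderiv 2 φ)]

lemma dAlong_mfield {φ : MvPolynomial (Fin 3) ℝ} (U : (Fin 3 → ℝ) → ℝ) {x : Fin 3 → ℝ}
    (h2 : eval x (pderiv 2 φ) ≠ 0) : dAlong φ x (mfield φ U x) = 0 := by
  rw [dAlong_expand]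
  simp [mfield]
  field_simp
  ring

lemma exists_smoothField {φ : MvPolynomial (Fin 3) ℝ} {V : Set (Fin 3 → ℝ)} (hV : IsOpen V)
    (h2 : ∀ x ∈ V, eval x (pderiv 2 φ) ≠ 0) {U : (Fin 3 → ℝ) → ℝ}
    {U' : (Fin 3 → ℝ) → (Fin 3 → ℝ) →L[ℝ] ℝ} (hU : ∀ x ∈ V, HasStrictFDerivAt U (U' x) x) :
    ∃ v', SmoothField φ V (mfield φ U) v' ∧
      ∀ x ∈ V, ∀ τ, v' x τ 0 = 0 ∧ v' x τ 1 = U' x τ := by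
  have h : ∀ x ∈ V, ∃ T : (Fin 3 → ℝ) →L[ℝ] (Fin 3 → ℝ), HasStrictFDerivAt (mfield φ U) T x ∧
      ∀ τ, T τ 0 = 0 ∧ T τ 1 = U' x τ := by
    intro x hx
    have e0 : HasStrictFDerivAt (fun y => mfield φ U y 0) (0 : (Fin 3 → ℝ) →L[ℝ] ℝ) x := by
      simp only [mfield, Matrix.cons_val_zero]
      exact hasStrictFDerivAt_const _ _
    have e1 : HasStrictFDerivAt (fun y => mfield φ U y 1) (U' x) x := hU x hx
    have e2 : ∃ T : (Fin 3 → ℝ) →L[ℝ] ℝ, HasStrictFDerivAt (fun y => mfield φ U y 2) T x := by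
      simp only [mfield]
      exact ⟨_, ((((hasStrictFDerivAt_eval (pderiv 0 φ) x).add ((hU x hx).mul
        (hasStrictFDerivAt_eval (pderiv 1 φ) x))).neg).mul
        ((hasStrictDerivAt_inv (h2 x hx)).hasStrictFDerivAt.comp x
        (hasStrictFDerivAt_eval (pderiv 2 φ) x)))⟩
    obtain ⟨T, hT⟩ := e2
    refine ⟨ContinuousLinearMap.pi ![0, U' x, T], ?_, fun τ => ⟨by simp, by simp⟩⟩
    rw [hasStrictFDerivAt_pi']
    intro i
    fin_cases i
    · exact e0
    · exact e1
    · exact hT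
  choose! v' hv' using h
  exact ⟨v', ⟨hV, fun x hx => ⟨2, h2 x hx⟩, fun x hx => (hv' x hx).1⟩, fun x hx => (hv' x hx).2⟩

/-- The mixed Hessian whose vanishing detects a double root. -/
noncomputable def mixed (φ : MvPolynomial (Fin 3) ℝ) (x v : Fin 3 → ℝ) : ℝ :=
  eval x (pderiv 1 φ) * hess φ x (bv 2) v - eval x (pderiv 2 φ) * hess φ x (bv 1) v

section Ruled

variable {φ : MvPolynomial (Fin 3) ℝ} {V : Set (Fin 3 → ℝ)} {U : (Fin 3 → ℝ) → ℝ}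
    {U' : (Fin 3 → ℝ) → (Fin 3 → ℝ) →L[ℝ] ℝ}

lemma ruled_of_flat (hV : IsOpen V) (h2 : ∀ x ∈ V, eval x (pderiv 2 φ) ≠ 0)
    (hU : ∀ x ∈ V, HasStrictFDerivAt U (U' x) x)
    (hF2 : ∀ x ∈ V, x ∈ zset φ → hess φ x (mfield φ U x) (mfield φ U x) = 0)
    (hc : ∀ x ∈ V, x ∈ zset φ → U' x (mfield φ U x) = 0) :
    ∀ x ∈ V, x ∈ zset φ → ln x (mfield φ U x) ⊆ zset φ := by
  obtain ⟨v', hS, hv'⟩ := exists_smoothField hV h2 hU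
  have ht : ∀ x ∈ V, x ∈ zset φ → dAlong φ x (mfield φ U x) = 0 :=
    fun x hx _ => dAlong_mfield U (h2 x hx)
  intro x hx hxφ
  refine hS.ln_subset ht ?_ hx hxφ
  intro x hx hxφ
  have h3 := hS.deriv_tangent ht hx hxφ (ht x hx hxφ)
  rw [hF2 x hx hxφ, zero_add, dAlong_expand, (hv' x hx _).1, (hv' x hx _).2, hc x hx hxφ] at h3
  simp only [mul_zero, zero_add, mul_eq_zero, h2 x hx, false_or] at h3
  ext i
  fin_cases i
  · exact (hv' x hx _).1
  · exact (hv' x hx _).2.trans (hc x hx hxφ)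
  · exact h3

lemma ruled_of_simple (hV : IsOpen V) (h2 : ∀ x ∈ V, eval x (pderiv 2 φ) ≠ 0)
    (hU : ∀ x ∈ V, HasStrictFDerivAt U (U' x) x)
    (hF2 : ∀ x ∈ V, x ∈ zset φ → hess φ x (mfield φ U x) (mfield φ U x) = 0)
    (hF3 : ∀ x ∈ V, x ∈ zset φ →
      third φ x (mfield φ U x) (mfield φ U x) (mfield φ U x) = 0)
    (hJ : ∀ x ∈ V, x ∈ zset φ → mixed φ x (mfield φ U x) ≠ 0) :
    ∀ x ∈ V, x ∈ zset φ → ln x (mfield φ U x) ⊆ zset φ := by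
  obtain ⟨v', hS, hv'⟩ := exists_smoothField hV h2 hU
  have ht : ∀ x ∈ V, x ∈ zset φ → dAlong φ x (mfield φ U x) = 0 :=
    fun x hx _ => dAlong_mfield U (h2 x hx)
  refine ruled_of_flat hV h2 hU hF2 ?_
  intro x hx hxφ
  have h3 := hS.deriv_tangent ht hx hxφ (ht x hx hxφ)
  have h4 := hS.deriv_hess hF2 hx hxφ (ht x hx hxφ)
  rw [hF3 x hx hxφ, hess_expand, (hv' x hx _).1] at h4
  rw [hF2 x hx hxφ, dAlong_expand, (hv' x hx _).1] at h3
  have hJx := hJ x hx hxφ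
  rw [← (hv' x hx _).2]
  rw [mixed] at hJx
  by_contra hne
  refine mul_ne_zero hne hJx ?_
  linear_combination hess φ x (bv 2) (mfield φ U x) * h3 - eval x (pderiv 2 φ) / 2 * h4

lemma SmoothField.deriv_mixed {v : (Fin 3 → ℝ) → (Fin 3 → ℝ)}
    {v' : (Fin 3 → ℝ) → (Fin 3 → ℝ) →L[ℝ] (Fin 3 → ℝ)} (hS : SmoothField φ V v v')
    (h1 : ∀ x ∈ V, x ∈ zset φ → mixed φ x (v x) = 0) {x τ : Fin 3 → ℝ} (hxV : x ∈ V)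
    (hx : x ∈ zset φ) (hτ : dAlong φ x τ = 0) :
    hess φ x (bv 1) τ * hess φ x (bv 2) (v x) + eval x (pderiv 1 φ) * third φ x (bv 2) τ (v x) -
      hess φ x (bv 2) τ * hess φ x (bv 1) (v x) - eval x (pderiv 2 φ) * third φ x (bv 1) τ (v x) +
      eval x (pderiv 1 φ) * hess φ x (v' x τ) (bv 2) -
      eval x (pderiv 2 φ) * hess φ x (v' x τ) (bv 1) = 0 := by
  have hm : ∀ x v, jeval x v (rename Sum.inl (pderiv 1 φ) * flow (rename Sum.inl (pderiv 2 φ)) -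
      rename Sum.inl (pderiv 2 φ) * flow (rename Sum.inl (pderiv 1 φ))) = mixed φ x v := by
    intro x v
    simp only [flow_rename, mixed, hess, map_sub, map_mul, jeval_rename,
      Fin.sum_univ_three]
    simp [jeval_rename, pderiv_comm (1 : Fin 3) 0, pderiv_comm (2 : Fin 3) 0,
      pderiv_comm (2 : Fin 3) 1]
    ring
  have h := hS.deriv_eq_zero (fun x hxV hx => by rw [hm, h1 x hxV hx]) hxV hx hτ
  rw [← h]
  simp only [hess, third, flow_rename, map_sub, Derivation.leibniz, pderiv_inl_X_inr,
    pderiv_inr_X_inr, pderiv_inl_rename, pderiv_inr_rename, add_zero, zero_add,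
    smul_eq_mul, map_mul, map_add, jeval_rename, eval_X, Sum.elim_inr, mul_zero,
    Fin.sum_univ_three, apply_ite (jeval _ _), map_zero, map_one]
  simp [pderiv_comm (1 : Fin 3) 0, pderiv_comm (2 : Fin 3) 0, pderiv_comm (2 : Fin 3) 1]
  ring

lemma ruled_of_double (hV : IsOpen V) (h2 : ∀ x ∈ V, eval x (pderiv 2 φ) ≠ 0)
    (hU : ∀ x ∈ V, HasStrictFDerivAt U (U' x) x)
    (hF2 : ∀ x ∈ V, x ∈ zset φ → hess φ x (mfield φ U x) (mfield φ U x) = 0)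
    (hJ : ∀ x ∈ V, x ∈ zset φ → mixed φ x (mfield φ U x) = 0)
    (ha : ∀ x ∈ V, x ∈ zset φ → hess φ x
      ![0, eval x (pderiv 2 φ), - eval x (pderiv 1 φ)]
      ![0, eval x (pderiv 2 φ), - eval x (pderiv 1 φ)] ≠ 0) :
    ∀ x ∈ V, x ∈ zset φ → ln x (mfield φ U x) ⊆ zset φ := by
  obtain ⟨v', hS, hv'⟩ := exists_smoothField hV h2 hU
  have ht : ∀ x ∈ V, x ∈ zset φ → dAlong φ x (mfield φ U x) = 0 :=
    fun x hx _ => dAlong_mfield U (h2 x hx)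
  refine ruled_of_flat hV h2 hU hF2 ?_
  intro x hx hxφ
  set w : Fin 3 → ℝ := ![0, eval x (pderiv 2 φ), - eval x (pderiv 1 φ)] with hw
  have hw0 : w 0 = 0 := rfl
  have hw1 : w 1 = eval x (pderiv 2 φ) := rfl
  have hw2 : w 2 = - eval x (pderiv 1 φ) := rfl
  have hwt : dAlong φ x w = 0 := by
    rw [dAlong_expand, hw0, hw1, hw2]
    ring
  have hA := hJ x hx hxφ
  have hB := hS.deriv_tangent ht hx hxφ hwt
  have hC := hS.deriv_hess hF2 hx hxφ hwt
  have hD := hS.deriv_tangent ht hx hxφ (ht x hx hxφ)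
  have hE := hS.deriv_mixed hJ hx hxφ (ht x hx hxφ)
  have hx2 := h2 x hx
  have hax : hess φ x w w ≠ 0 := ha x hx hxφ
  rw [mixed] at hA
  rw [hess_expand, dAlong_expand, hw0, hw1, hw2, (hv' x hx _).1] at hB
  rw [third_expand, hess_expand, hw0, hw1, hw2, (hv' x hx _).1] at hC
  rw [hF2 x hx hxφ, dAlong_expand, (hv' x hx _).1] at hD
  rw [hess_expand φ x (v' x _) (bv 2), hess_expand φ x (v' x _) (bv 1), (hv' x hx _).1] at hE
  rw [hess_expand, hess_symm φ x (bv 0), hess_symm φ x (bv 1) w, hess_symm φ x (bv 2) w,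
    hess_expand φ x w, hess_expand φ x w, hess_expand φ x w, hw0, hw1, hw2] at hax
  rw [← (hv' x hx _).2]
  rw [hess_symm φ x (bv 2) (bv 1)] at hE hax
  generalize mfield φ U x = v at *
  generalize hess φ x (bv 1) v = H1 at *
  generalize hess φ x (bv 2) v = H2 at *
  generalize third φ x (bv 1) v v = T1 at *
  generalize third φ x (bv 2) v v = T2 at *
  generalize eval x (pderiv 1 φ) = f1 at *
  generalize eval x (pderiv 2 φ) = f2 at *
  have hG : f2 * (f2 * T1 - f1 * T2) = 0 := by
    linear_combination f2 * hC - 2 * H2 * hB + 2 * (v' x w 1 - H2) * hA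
  have hG' := (mul_eq_zero.1 hG).resolve_left hx2
  by_contra hne
  refine mul_ne_zero hne hax ?_
  linear_combination (-f2) * hE - f2 * hG' + (f1 * hess φ x (bv 2) (bv 2) - f2 * hess φ x (bv 1) (bv 2)) * hD

end Ruled

/-! ### The equations of asymptotic directions -/

lemma totalDegree_pderiv_le_sub_one {σ : Type*} (i : σ) (p : MvPolynomial σ ℝ) :
    (pderiv i p).totalDegree ≤ p.totalDegree - 1 := by
  conv_lhs => rw [p.as_sum, map_sum]
  refine totalDegree_finsetSum_le fun m hm => ?_
  rw [pderiv_monomial]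
  by_cases h : m i = 0
  · simp [h]
  · refine (totalDegree_monomial_le _ _).trans ?_
    have h1 : Finsupp.single i 1 ≤ m := by
      rw [Finsupp.single_le_iff]
      omega
    have h2 : m.degree ≤ p.totalDegree := le_totalDegree hm
    have h3 : (m - Finsupp.single i 1).degree + 1 = m.degree := by
      conv_rhs => rw [← tsub_add_cancel_of_le h1]
      rw [map_add, Finsupp.degree_single]
    change (m - Finsupp.single i 1).degree ≤ _
    omega

lemma totalDegree_pderiv_le {σ : Type*} (i : σ) (p : MvPolynomial σ ℝ) :
    (pderiv i p).totalDegree ≤ p.totalDegree :=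
  (totalDegree_pderiv_le_sub_one i p).trans (Nat.sub_le _ _)

lemma not_dvd_pderiv {φ : MvPolynomial (Fin 3) ℝ} (hd : 1 ≤ φ.totalDegree) {i : Fin 3}
    (h : pderiv i φ ≠ 0) : ¬ φ ∣ pderiv i φ := by
  intro hdvd
  have h1 := totalDegree_le_of_dvd_of_isDomain hdvd h
  have h2 := totalDegree_pderiv_le_sub_one i φ
  omega

section Forms

variable (φ : MvPolynomial (Fin 3) ℝ)

/-- First tangent vector. -/
noncomputable def tau0 : Fin 3 → MvPolynomial (Fin 3) ℝ := ![pderiv 2 φ, 0, - pderiv 0 φ]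

/-- Second tangent vector. -/
noncomputable def tau1 : Fin 3 → MvPolynomial (Fin 3) ℝ := ![0, pderiv 2 φ, - pderiv 1 φ]

/-- The Hessian form on polynomial vectors. -/
noncomputable def hessP (a b : Fin 3 → MvPolynomial (Fin 3) ℝ) : MvPolynomial (Fin 3) ℝ :=
  ∑ i, ∑ j, pderiv i (pderiv j φ) * a i * b j

/-- The third derivative form on polynomial vectors. -/
noncomputable def thirdP (a b c : Fin 3 → MvPolynomial (Fin 3) ℝ) : MvPolynomial (Fin 3) ℝ :=
  ∑ i, ∑ j, ∑ k, pderiv i (pderiv j (pderiv k φ)) * a i * b j * c k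

/-- Quadratic coefficient of the equation of asymptotic directions. -/
noncomputable def qa2 := hessP φ (tau1 φ) (tau1 φ)
/-- Linear coefficient of the equation of asymptotic directions. -/
noncomputable def qa1 := 2 * hessP φ (tau0 φ) (tau1 φ)
/-- Constant coefficient of the equation of asymptotic directions. -/
noncomputable def qa0 := hessP φ (tau0 φ) (tau0 φ)
/-- Cubic coefficient of the third order equation. -/
noncomputable def cb3 := thirdP φ (tau1 φ) (tau1 φ) (tau1 φ)
/-- Quadratic coefficient of the third order equation. -/
noncomputable def cb2 := 3 * thirdP φ (tau0 φ) (tau1 φ) (tau1 φ)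
/-- Linear coefficient of the third order equation. -/
noncomputable def cb1 := 3 * thirdP φ (tau0 φ) (tau0 φ) (tau1 φ)
/-- Constant coefficient of the third order equation. -/
noncomputable def cb0 := thirdP φ (tau0 φ) (tau0 φ) (tau0 φ)
/-- Discriminant of the equation of asymptotic directions. -/
noncomputable def disc := qa1 φ ^ 2 - 4 * qa2 φ * qa0 φ
/-- Linear coefficient of the remainder of the third order equation. -/
noncomputable def rem1 := qa2 φ ^ 2 * cb1 φ - qa2 φ * qa0 φ * cb3 φ -
  qa1 φ * (qa2 φ * cb2 φ - qa1 φ * cb3 φ)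
/-- Constant coefficient of the remainder of the third order equation. -/
noncomputable def rem0 := qa2 φ ^ 2 * cb0 φ - qa0 φ * (qa2 φ * cb2 φ - qa1 φ * cb3 φ)
/-- The resultant of the second and third order equations (flecnodal polynomial). -/
noncomputable def flec := qa2 φ * rem0 φ ^ 2 - qa1 φ * rem0 φ * rem1 φ + qa0 φ * rem1 φ ^ 2

lemma totalDegree_hessP_le {a b : Fin 3 → MvPolynomial (Fin 3) ℝ} {D : ℕ} (hφ : φ.totalDegree ≤ D)
    (ha : ∀ i, (a i).totalDegree ≤ D) (hb : ∀ i, (b i).totalDegree ≤ D) :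
    (hessP φ a b).totalDegree ≤ 3 * D := by
  refine totalDegree_finsetSum_le fun i _ => totalDegree_finsetSum_le fun j _ => ?_
  have h1 := totalDegree_mul (pderiv i (pderiv j φ) * a i) (b j)
  have h2 := totalDegree_mul (pderiv i (pderiv j φ)) (a i)
  have h3 := totalDegree_pderiv_le i (pderiv j φ)
  have h4 := totalDegree_pderiv_le j (φ)
  have := ha i
  have := hb j
  omega

lemma totalDegree_thirdP_le {a b c : Fin 3 → MvPolynomial (Fin 3) ℝ} {D : ℕ}
    (hφ : φ.totalDegree ≤ D) (ha : ∀ i, (a i).totalDegree ≤ D) (hb : ∀ i, (b i).totalDegree ≤ D)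
    (hc : ∀ i, (c i).totalDegree ≤ D) :
    (thirdP φ a b c).totalDegree ≤ 4 * D := by
  refine totalDegree_finsetSum_le fun i _ => totalDegree_finsetSum_le fun j _ =>
    totalDegree_finsetSum_le fun k _ => ?_
  have h0 := totalDegree_mul (pderiv i (pderiv j (pderiv k φ)) * a i * b j) (c k)
  have h1 := totalDegree_mul (pderiv i (pderiv j (pderiv k φ)) * a i) (b j)
  have h2 := totalDegree_mul (pderiv i (pderiv j (pderiv k φ))) (a i)
  have h3 := totalDegree_pderiv_le i (pderiv j (pderiv k φ))
  have h4 := totalDegree_pderiv_le j (pderiv k φ)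
  have h5 := totalDegree_pderiv_le k (φ)
  have := ha i
  have := hb j
  have := hc k
  omega

lemma totalDegree_tau0_le (i : Fin 3) : (tau0 φ i).totalDegree ≤ φ.totalDegree := by
  fin_cases i
  · exact totalDegree_pderiv_le _ _
  · simp [tau0]
  · simpa [tau0] using totalDegree_pderiv_le 0 φ

lemma totalDegree_tau1_le (i : Fin 3) : (tau1 φ i).totalDegree ≤ φ.totalDegree := by
  fin_cases i
  · simp [tau1]
  · exact totalDegree_pderiv_le _ _
  · simpa [tau1] using totalDegree_pderiv_le 1 φ

lemma totalDegree_qa2_le : (qa2 φ).totalDegree ≤ 3 * φ.totalDegree :=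
  totalDegree_hessP_le φ le_rfl (totalDegree_tau1_le φ) (totalDegree_tau1_le φ)

lemma totalDegree_natCast_mul_le (k : ℕ) (p : MvPolynomial (Fin 3) ℝ) :
    ((k : MvPolynomial (Fin 3) ℝ) * p).totalDegree ≤ p.totalDegree := by
  refine (totalDegree_mul _ _).trans ?_
  rw [← map_natCast C, totalDegree_C, zero_add]

lemma totalDegree_qa1_le : (qa1 φ).totalDegree ≤ 3 * φ.totalDegree :=
  (totalDegree_natCast_mul_le 2 _).trans
    (totalDegree_hessP_le φ le_rfl (totalDegree_tau0_le φ) (totalDegree_tau1_le φ))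

lemma totalDegree_qa0_le : (qa0 φ).totalDegree ≤ 3 * φ.totalDegree :=
  totalDegree_hessP_le φ le_rfl (totalDegree_tau0_le φ) (totalDegree_tau0_le φ)

lemma totalDegree_cb3_le : (cb3 φ).totalDegree ≤ 4 * φ.totalDegree :=
  totalDegree_thirdP_le φ le_rfl (totalDegree_tau1_le φ) (totalDegree_tau1_le φ)
    (totalDegree_tau1_le φ)

lemma totalDegree_cb2_le : (cb2 φ).totalDegree ≤ 4 * φ.totalDegree :=
  (totalDegree_natCast_mul_le 3 _).trans
    (totalDegree_thirdP_le φ le_rfl (totalDegree_tau0_le φ) (totalDegree_tau1_le φ)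
    (totalDegree_tau1_le φ))

lemma totalDegree_cb1_le : (cb1 φ).totalDegree ≤ 4 * φ.totalDegree :=
  (totalDegree_natCast_mul_le 3 _).trans
    (totalDegree_thirdP_le φ le_rfl (totalDegree_tau0_le φ) (totalDegree_tau0_le φ)
    (totalDegree_tau1_le φ))

lemma totalDegree_cb0_le : (cb0 φ).totalDegree ≤ 4 * φ.totalDegree :=
  totalDegree_thirdP_le φ le_rfl (totalDegree_tau0_le φ) (totalDegree_tau0_le φ)
    (totalDegree_tau0_le φ)

lemma totalDegree_mul_le_of_le {p q : MvPolynomial (Fin 3) ℝ} {a b : ℕ} (hp : p.totalDegree ≤ a)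
    (hq : q.totalDegree ≤ b) : (p * q).totalDegree ≤ a + b :=
  (totalDegree_mul _ _).trans (add_le_add hp hq)

lemma totalDegree_sub_le_of_le {p q : MvPolynomial (Fin 3) ℝ} {a : ℕ} (hp : p.totalDegree ≤ a)
    (hq : q.totalDegree ≤ a) : (p - q).totalDegree ≤ a :=
  (totalDegree_sub _ _).trans (max_le hp hq)

lemma totalDegree_disc_le : (disc φ).totalDegree ≤ 6 * φ.totalDegree := by
  rw [disc, sq, mul_assoc]
  refine totalDegree_sub_le_of_le ?_ ((totalDegree_natCast_mul_le 4 _).trans ?_)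
  · exact (totalDegree_mul_le_of_le (totalDegree_qa1_le φ) (totalDegree_qa1_le φ)).trans (by omega)
  · exact (totalDegree_mul_le_of_le (totalDegree_qa2_le φ) (totalDegree_qa0_le φ)).trans (by omega)

lemma totalDegree_quot_le :
    (qa2 φ * cb2 φ - qa1 φ * cb3 φ).totalDegree ≤ 7 * φ.totalDegree :=
  totalDegree_sub_le_of_le
    ((totalDegree_mul_le_of_le (totalDegree_qa2_le φ) (totalDegree_cb2_le φ)).trans (by omega))
    ((totalDegree_mul_le_of_le (totalDegree_qa1_le φ) (totalDegree_cb3_le φ)).trans (by omega))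

lemma totalDegree_rem1_le : (rem1 φ).totalDegree ≤ 10 * φ.totalDegree := by
  rw [rem1, sq]
  refine totalDegree_sub_le_of_le (totalDegree_sub_le_of_le ?_ ?_) ?_
  · exact (totalDegree_mul_le_of_le (totalDegree_mul_le_of_le (totalDegree_qa2_le φ)
      (totalDegree_qa2_le φ)) (totalDegree_cb1_le φ)).trans (by omega)
  · exact (totalDegree_mul_le_of_le (totalDegree_mul_le_of_le (totalDegree_qa2_le φ)
      (totalDegree_qa0_le φ)) (totalDegree_cb3_le φ)).trans (by omega)
  · exact (totalDegree_mul_le_of_le (totalDegree_qa1_le φ) (totalDegree_quot_le φ)).trans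
      (by omega)

lemma totalDegree_rem0_le : (rem0 φ).totalDegree ≤ 10 * φ.totalDegree := by
  rw [rem0, sq]
  refine totalDegree_sub_le_of_le ?_ ?_
  · exact (totalDegree_mul_le_of_le (totalDegree_mul_le_of_le (totalDegree_qa2_le φ)
      (totalDegree_qa2_le φ)) (totalDegree_cb0_le φ)).trans (by omega)
  · exact (totalDegree_mul_le_of_le (totalDegree_qa0_le φ) (totalDegree_quot_le φ)).trans
      (by omega)

lemma totalDegree_flec_le : (flec φ).totalDegree ≤ 23 * φ.totalDegree := by
  rw [flec, sq, sq]
  refine (totalDegree_add _ _).trans (max_le (totalDegree_sub_le_of_le ?_ ?_) ?_)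
  · exact (totalDegree_mul_le_of_le (totalDegree_qa2_le φ) (totalDegree_mul_le_of_le
      (totalDegree_rem0_le φ) (totalDegree_rem0_le φ))).trans (by omega)
  · exact (totalDegree_mul_le_of_le (totalDegree_mul_le_of_le (totalDegree_qa1_le φ)
      (totalDegree_rem0_le φ)) (totalDegree_rem1_le φ)).trans (by omega)
  · exact (totalDegree_mul_le_of_le (totalDegree_qa0_le φ) (totalDegree_mul_le_of_le
      (totalDegree_rem1_le φ) (totalDegree_rem1_le φ))).trans (by omega)

variable {φ} {x v : Fin 3 → ℝ}

lemma eval_hessP (a b : Fin 3 → MvPolynomial (Fin 3) ℝ) :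
    eval x (hessP φ a b) = hess φ x (fun i => eval x (a i)) (fun i => eval x (b i)) := by
  simp [hessP, hess]

lemma eval_thirdP (a b c : Fin 3 → MvPolynomial (Fin 3) ℝ) :
    eval x (thirdP φ a b c) =
      third φ x (fun i => eval x (a i)) (fun i => eval x (b i)) (fun i => eval x (c i)) := by
  simp [thirdP, third]

lemma eval_tau1 : (fun i => eval x (tau1 φ i)) =
    ![0, eval x (pderiv 2 φ), - eval x (pderiv 1 φ)] := by
  ext i
  fin_cases i <;> simp [tau1]

lemma eval_qa2 : eval x (qa2 φ) = hess φ x ![0, eval x (pderiv 2 φ), - eval x (pderiv 1 φ)]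
    ![0, eval x (pderiv 2 φ), - eval x (pderiv 1 φ)] := by
  rw [qa2, eval_hessP, eval_tau1]

lemma hess_add_smul_left (a b c : Fin 3 → ℝ) (s t : ℝ) :
    hess φ x (s • a + t • b) c = s * hess φ x a c + t * hess φ x b c := by
  rw [hess_expand, hess_expand φ x a, hess_expand φ x b]
  simp only [Pi.add_apply, Pi.smul_apply, smul_eq_mul]
  ring

lemma hess_smul_left (a c : Fin 3 → ℝ) (s : ℝ) : hess φ x (s • a) c = s * hess φ x a c := by
  simpa using hess_add_smul_left (φ := φ) (x := x) a 0 c s 0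

lemma third_add_smul_left (a b c d : Fin 3 → ℝ) (s t : ℝ) :
    third φ x (s • a + t • b) c d = s * third φ x a c d + t * third φ x b c d := by
  rw [third_expand, third_expand φ x a, third_expand φ x b]
  simp only [Pi.add_apply, Pi.smul_apply, smul_eq_mul]
  ring

lemma third_smul_left (a c d : Fin 3 → ℝ) (s : ℝ) :
    third φ x (s • a) c d = s * third φ x a c d := by
  simpa using third_add_smul_left (φ := φ) (x := x) a 0 c d s 0

lemma smul_tangent (hv : dAlong φ x v = 0) : eval x (pderiv 2 φ) • v =
    v 0 • (fun i => eval x (tau0 φ i)) + v 1 • (fun i => eval x (tau1 φ i)) := by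
  rw [dAlong_expand] at hv
  ext i
  fin_cases i
  · simp [tau0, tau1, mul_comm]
  · simp [tau0, tau1, mul_comm]
  · simp [tau0, tau1]
    linear_combination hv

lemma sq_mul_hess (hv : dAlong φ x v = 0) : eval x (pderiv 2 φ) ^ 2 * hess φ x v v =
    eval x (qa2 φ) * v 1 ^ 2 + eval x (qa1 φ) * (v 0 * v 1) + eval x (qa0 φ) * v 0 ^ 2 := by
  have h1 : eval x (pderiv 2 φ) ^ 2 * hess φ x v v =
      hess φ x (eval x (pderiv 2 φ) • v) (eval x (pderiv 2 φ) • v) := by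
    rw [hess_smul_left, hess_symm φ x v (_ • v), hess_smul_left]
    ring
  rw [h1, smul_tangent hv, hess_add_smul_left, hess_symm φ x _ (_ + _), hess_add_smul_left,
    hess_symm φ x _ (_ + _), hess_add_smul_left, qa2, qa1, qa0, map_mul, eval_hessP, eval_hessP,
    eval_hessP, hess_symm φ x (fun i => eval x (tau1 φ i)) (fun i => eval x (tau0 φ i))]
  simp only [map_ofNat]
  ring

lemma cube_mul_third (hv : dAlong φ x v = 0) : eval x (pderiv 2 φ) ^ 3 * third φ x v v v =
    eval x (cb3 φ) * v 1 ^ 3 + eval x (cb2 φ) * (v 0 * v 1 ^ 2) +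
      eval x (cb1 φ) * (v 0 ^ 2 * v 1) + eval x (cb0 φ) * v 0 ^ 3 := by
  set f2 := eval x (pderiv 2 φ) with hf2
  have h1 : f2 ^ 3 * third φ x v v v = third φ x (f2 • v) (f2 • v) (f2 • v) := by
    rw [third_smul_left, third_swap_left φ x v (f2 • v) (f2 • v), third_smul_left,
      third_swap_right φ x v v (f2 • v), third_swap_left φ x v (f2 • v) v, third_smul_left]
    ring
  have hlin : ∀ a b : Fin 3 → ℝ, third φ x a b (f2 • v) =
      v 0 * third φ x (fun i => eval x (tau0 φ i)) a b +
      v 1 * third φ x (fun i => eval x (tau1 φ i)) a b := by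
    intro a b
    rw [third_swap_right, third_swap_left, smul_tangent hv, third_add_smul_left]
  rw [h1, hlin, hlin, hlin]
  simp only [hlin]
  rw [cb3, cb2, cb1, cb0]
  simp only [map_mul, map_ofNat, eval_thirdP]
  generalize (fun i => eval x (tau0 φ i)) = t0 at *
  generalize (fun i => eval x (tau1 φ i)) = t1 at *
  rw [third_swap_left φ x t1 t0 t0, third_swap_right φ x t0 t1 t0, third_swap_right φ x t1 t1 t0,
    third_swap_left φ x t1 t0 t1]
  ring

lemma two_mul_mixed (hv : dAlong φ x v = 0) : 2 * eval x (qa2 φ) * v 1 + eval x (qa1 φ) * v 0 =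
    - 2 * eval x (pderiv 2 φ) * mixed φ x v := by
  have h1 : mixed φ x v = - hess φ x (fun i => eval x (tau1 φ i)) v := by
    rw [eval_tau1, hess_expand, mixed]
    simp
    try ring
  have h2 : eval x (pderiv 2 φ) * mixed φ x v =
      - hess φ x (eval x (pderiv 2 φ) • v) (fun i => eval x (tau1 φ i)) := by
    rw [h1, hess_smul_left, hess_symm]
    ring
  rw [mul_assoc (-2), h2, smul_tangent hv, hess_add_smul_left, qa2, qa1, map_mul, eval_hessP,
    eval_hessP]
  simp only [map_ofNat]
  ring

/-- Division with remainder of the third order equation by the second order equation. -/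
lemma sq_mul_cubic (u : ℝ) : eval x (qa2 φ) ^ 2 * (eval x (cb3 φ) * u ^ 3 + eval x (cb2 φ) * u ^ 2 +
      eval x (cb1 φ) * u + eval x (cb0 φ)) =
    (eval x (qa2 φ) * u ^ 2 + eval x (qa1 φ) * u + eval x (qa0 φ)) *
      (eval x (qa2 φ) * eval x (cb3 φ) * u + (eval x (qa2 φ) * eval x (cb2 φ) -
        eval x (qa1 φ) * eval x (cb3 φ))) + (eval x (rem1 φ) * u + eval x (rem0 φ)) := by
  simp only [rem1, rem0, map_sub, map_mul, map_pow]
  ring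

end Forms

/-! ### Local sheets of lines -/

/-- `l` belongs to a continuous one-parameter family of distinct lines on the zero set of `φ`. -/
def Sheet (φ : MvPolynomial (Fin 3) ℝ) (l : Set (Fin 3 → ℝ)) : Prop :=
  ∃ ε > 0, ∃ q v : ℝ → Fin 3 → ℝ, ContinuousOn q (Set.Ioo (-ε) ε) ∧
    ContinuousOn v (Set.Ioo (-ε) ε) ∧ (∀ t ∈ Set.Ioo (-ε) ε, v t ≠ 0) ∧
    Set.InjOn (fun t => ln (q t) (v t)) (Set.Ioo (-ε) ε) ∧
    (∀ t ∈ Set.Ioo (-ε) ε, ln (q t) (v t) ⊆ zset φ) ∧ ln (q 0) (v 0) = l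

lemma continuousOn_mfield {φ : MvPolynomial (Fin 3) ℝ} {V : Set (Fin 3 → ℝ)}
    {U : (Fin 3 → ℝ) → ℝ} (h2 : ∀ x ∈ V, eval x (pderiv 2 φ) ≠ 0) (hU : ContinuousOn U V) :
    ContinuousOn (mfield φ U) V := by
  have hc : ∀ p : MvPolynomial (Fin 3) ℝ, ContinuousOn (fun x => eval x p) V :=
    fun p => (continuous_eval p).continuousOn
  refine continuousOn_pi.2 fun i => ?_
  fin_cases i
  · simpa [mfield] using continuousOn_const
  · simpa [mfield] using hU
  · simp only [mfield, Fin.reduceFinMk, Matrix.cons_val]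
    exact (((hc _).add (hU.mul (hc _))).neg).div (hc _) h2

lemma sheet_of_field {φ : MvPolynomial (Fin 3) ℝ} {V : Set (Fin 3 → ℝ)} {U : (Fin 3 → ℝ) → ℝ}
    (hV : IsOpen V) (h2 : ∀ x ∈ V, eval x (pderiv 2 φ) ≠ 0) (hU : ContinuousOn U V)
    (hr : ∀ x ∈ V, x ∈ zset φ → ln x (mfield φ U x) ⊆ zset φ) {a : Fin 3 → ℝ} (ha : a ∈ V)
    (haφ : a ∈ zset φ) : Sheet φ (ln a (mfield φ U a)) := by
  set Ψ : (Fin 3 → ℝ) → (Fin 3 → ℝ) := fun x => ![x 0, x 1, eval x φ] with hΨ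
  obtain ⟨T, hT, hTinj⟩ : ∃ T : (Fin 3 → ℝ) →L[ℝ] (Fin 3 → ℝ), HasStrictFDerivAt Ψ T a ∧
      Function.Injective T := by
    refine ⟨ContinuousLinearMap.pi ![ContinuousLinearMap.proj 0, ContinuousLinearMap.proj 1,
      ∑ i, eval a (pderiv i φ) • ContinuousLinearMap.proj i], ?_, ?_⟩
    · rw [hasStrictFDerivAt_pi']
      intro i
      fin_cases i
      · exact (ContinuousLinearMap.proj (R := ℝ) (φ := fun _ : Fin 3 => ℝ) 0).hasStrictFDerivAt
      · exact (ContinuousLinearMap.proj (R := ℝ) (φ := fun _ : Fin 3 => ℝ) 1).hasStrictFDerivAt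
      · exact hasStrictFDerivAt_eval φ a
    · rw [injective_iff_map_eq_zero]
      intro τ hτ
      have e0 : τ 0 = 0 := congrFun hτ 0
      have e1 : τ 1 = 0 := congrFun hτ 1
      have e2 := congrFun hτ 2
      simp [Fin.sum_univ_three, e0, e1, h2 a ha] at e2
      ext i
      fin_cases i <;> assumption
  set T' : (Fin 3 → ℝ) ≃L[ℝ] (Fin 3 → ℝ) :=
    (LinearEquiv.ofInjectiveEndo (T : (Fin 3 → ℝ) →ₗ[ℝ] (Fin 3 → ℝ)) hTinj).toContinuousLinearEquiv
  have hT' : HasStrictFDerivAt Ψ (T' : (Fin 3 → ℝ) →L[ℝ] (Fin 3 → ℝ)) a := by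
    convert hT using 1
    exact ContinuousLinearMap.ext fun x => rfl
  set e := hT'.toOpenPartialHomeomorph Ψ with he
  have hecoe : (e : (Fin 3 → ℝ) → (Fin 3 → ℝ)) = Ψ := hT'.toOpenPartialHomeomorph_coe
  have hae : a ∈ e.source := hT'.mem_toOpenPartialHomeomorph_source
  set c : ℝ → Fin 3 → ℝ := fun t => ![a 0, a 1 + t, 0] with hc
  have hcc : Continuous c := by
    refine continuous_pi fun i => ?_
    fin_cases i
    · exact continuous_const
    · exact continuous_const.add continuous_id
    · exact continuous_const
  have hc0 : c 0 = e a := by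
    rw [hecoe]
    ext i
    fin_cases i
    · rfl
    · simp [hc, hΨ]
    · simpa [hc, hΨ] using (mem_zset.1 haφ).symm
  have hop : IsOpen (c ⁻¹' (e.target ∩ e.symm ⁻¹' V)) :=
    (e.symm.continuousOn.isOpen_inter_preimage e.open_target hV).preimage hcc
  have h0 : (0 : ℝ) ∈ c ⁻¹' (e.target ∩ e.symm ⁻¹' V) := by
    refine ⟨?_, ?_⟩
    · rw [hc0]
      exact e.map_source hae
    · simp only [Set.mem_preimage]
      rw [hc0, e.left_inv hae]
      exact ha
  obtain ⟨ε, hε, hball⟩ := Metric.isOpen_iff.1 hop 0 h0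
  rw [Real.ball_eq_Ioo, zero_sub, zero_add] at hball
  have hq : ∀ t ∈ Set.Ioo (-ε) ε, Ψ (e.symm (c t)) = c t := by
    intro t ht
    rw [← hecoe]
    exact e.right_inv (hball ht).1
  have hq0 : e.symm (c 0) = a := by rw [hc0, e.left_inv hae]
  have hqc : ContinuousOn (fun t => e.symm (c t)) (Set.Ioo (-ε) ε) :=
    e.symm.continuousOn.comp hcc.continuousOn fun t ht => (hball ht).1
  have hm0 : ∀ x, mfield φ U x 0 = 1 := fun x => rfl
  refine ⟨ε, hε, fun t => e.symm (c t), fun t => mfield φ U (e.symm (c t)), hqc,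
    (continuousOn_mfield h2 hU).comp hqc fun t ht => (hball ht).2, ?_, ?_, ?_, ?_⟩
  · intro t _ h
    simpa [hm0] using congrFun h 0
  · intro t ht t' ht' hl
    have h1 : e.symm (c t') ∈ ln (e.symm (c t)) (mfield φ U (e.symm (c t))) := by
      rw [show ln (e.symm (c t)) (mfield φ U (e.symm (c t))) = _ from hl]
      exact self_mem_ln _ _
    obtain ⟨r, hr'⟩ := mem_ln.1 h1
    have k0 := congrFun (hq t ht) 0
    have k0' := congrFun (hq t' ht') 0
    have k1 := congrFun (hq t ht) 1
    have k1' := congrFun (hq t' ht') 1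
    simp only [hΨ, hc, Matrix.cons_val_zero, Matrix.cons_val_one] at k0 k0' k1 k1'
    have h3 := congrFun hr' 0
    have h4 := congrFun hr' 1
    simp only [Pi.add_apply, Pi.smul_apply, hm0, smul_eq_mul, mul_one] at h3 h4
    have hr0 : r = 0 := by linarith
    rw [hr0] at h4
    linarith
  · intro t ht
    refine hr _ (hball ht).2 ?_
    exact congrFun (hq t ht) 2
  · simp only [hq0]

/-! ### Sheets through lines on ruled surfaces, in good coordinates -/

section Local

variable {φ : MvPolynomial (Fin 3) ℝ} {U : (Fin 3 → ℝ) → ℝ} {x a v : Fin 3 → ℝ}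

lemma eq_mfield (h2 : eval a (pderiv 2 φ) ≠ 0) (hv : dAlong φ a v = 0) (hv0 : v 0 = 1)
    (hU : U a = v 1) : mfield φ U a = v := by
  rw [dAlong_expand, hv0] at hv
  ext i
  fin_cases i
  · simp [mfield, hv0]
  · simp [mfield, hU]
  · simp only [mfield, Fin.reduceFinMk, Matrix.cons_val]
    rw [div_eq_iff h2, hU]
    linear_combination - hv

lemma hess_mfield_eq_zero (h2 : eval x (pderiv 2 φ) ≠ 0)
    (hE : eval x (qa2 φ) * U x ^ 2 + eval x (qa1 φ) * U x + eval x (qa0 φ) = 0) :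
    hess φ x (mfield φ U x) (mfield φ U x) = 0 := by
  have h := sq_mul_hess (dAlong_mfield U h2)
  have e0 : mfield φ U x 0 = 1 := rfl
  have e1 : mfield φ U x 1 = U x := rfl
  rw [e0, e1] at h
  have h' : eval x (pderiv 2 φ) ^ 2 * hess φ x (mfield φ U x) (mfield φ U x) = 0 := by
    rw [h]
    linear_combination hE
  exact (mul_eq_zero.1 h').resolve_left (pow_ne_zero 2 h2)

lemma third_mfield_eq_zero (h2 : eval x (pderiv 2 φ) ≠ 0)
    (hE : eval x (cb3 φ) * U x ^ 3 + eval x (cb2 φ) * U x ^ 2 + eval x (cb1 φ) * U x +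
      eval x (cb0 φ) = 0) :
    third φ x (mfield φ U x) (mfield φ U x) (mfield φ U x) = 0 := by
  have h := cube_mul_third (dAlong_mfield U h2)
  have e0 : mfield φ U x 0 = 1 := rfl
  have e1 : mfield φ U x 1 = U x := rfl
  rw [e0, e1] at h
  have h' : eval x (pderiv 2 φ) ^ 3 * third φ x (mfield φ U x) (mfield φ U x) (mfield φ U x) = 0 := by
    rw [h]
    linear_combination hE
  exact (mul_eq_zero.1 h').resolve_left (pow_ne_zero 3 h2)

lemma mixed_mfield (h2 : eval x (pderiv 2 φ) ≠ 0) :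
    2 * eval x (qa2 φ) * U x + eval x (qa1 φ) =
      - 2 * eval x (pderiv 2 φ) * mixed φ x (mfield φ U x) := by
  have h := two_mul_mixed (dAlong_mfield U h2)
  have e0 : mfield φ U x 0 = 1 := rfl
  have e1 : mfield φ U x 1 = U x := rfl
  rw [e0, e1, mul_one] at h
  exact h

/-- The equations satisfied by the slope of a line on the surface. -/
lemma line_equations (hv0 : v 0 = 1) (hl : ln a v ⊆ zset φ) :
    dAlong φ a v = 0 ∧
    eval a (qa2 φ) * v 1 ^ 2 + eval a (qa1 φ) * v 1 + eval a (qa0 φ) = 0 ∧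
    eval a (cb3 φ) * v 1 ^ 3 + eval a (cb2 φ) * v 1 ^ 2 + eval a (cb1 φ) * v 1 +
      eval a (cb0 φ) = 0 := by
  have h1 := dirDeriv_of_ln_subset hl 1
  have h2 := dirDeriv_of_ln_subset hl 2
  have h3 := dirDeriv_of_ln_subset hl 3
  rw [jeval_dirDeriv_one] at h1
  rw [jeval_dirDeriv_two] at h2
  rw [jeval_dirDeriv_three] at h3
  refine ⟨h1, ?_, ?_⟩
  · have h := sq_mul_hess h1
    rw [h2, hv0] at h
    linear_combination - h
  · have h := cube_mul_third h1
    rw [h3, hv0] at h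
    linear_combination - h

lemma disc_eq {u : ℝ} (hE : eval a (qa2 φ) * u ^ 2 + eval a (qa1 φ) * u + eval a (qa0 φ) = 0) :
    eval a (disc φ) = (2 * eval a (qa2 φ) * u + eval a (qa1 φ)) ^ 2 := by
  simp only [disc, map_sub, map_mul, map_pow, map_ofNat]
  linear_combination (- 4 * eval a (qa2 φ)) * hE

lemma flec_eq_zero_of_line (hv0 : v 0 = 1) (hl : ln a v ⊆ zset φ) : eval a (flec φ) = 0 := by
  obtain ⟨-, hE2, hE3⟩ := line_equations hv0 hl
  have h := sq_mul_cubic (φ := φ) (x := a) (v 1)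
  rw [hE2, hE3] at h
  have h0 : eval a (rem0 φ) = - eval a (rem1 φ) * v 1 := by linear_combination - h
  simp only [flec, map_sub, map_add, map_mul, map_pow]
  rw [h0]
  linear_combination (eval a (rem1 φ)) ^ 2 * hE2

lemma isOpen_ne_zero (p : MvPolynomial (Fin 3) ℝ) : IsOpen {x : Fin 3 → ℝ | eval x p ≠ 0} :=
  isOpen_ne.preimage (continuous_eval p)

lemma sheet_of_disc_eq_zero (h2 : eval a (pderiv 2 φ) ≠ 0) (ha2 : eval a (qa2 φ) ≠ 0)
    (hΔ : ∀ x ∈ zset φ, eval x (disc φ) = 0) (hv0 : v 0 = 1) (hl : ln a v ⊆ zset φ) :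
    Sheet φ (ln a v) := by
  obtain ⟨hd, hE2, -⟩ := line_equations hv0 hl
  have haφ : a ∈ zset φ := hl (self_mem_ln _ _)
  set U : (Fin 3 → ℝ) → ℝ := fun x => - eval x (qa1 φ) / (2 * eval x (qa2 φ)) with hUdef
  set V : Set (Fin 3 → ℝ) := {x | eval x (pderiv 2 φ) ≠ 0} ∩ {x | eval x (qa2 φ) ≠ 0} with hVdef
  have hV : IsOpen V := (isOpen_ne_zero _).inter (isOpen_ne_zero _)
  have hU : ∀ x ∈ V, ∃ T : (Fin 3 → ℝ) →L[ℝ] ℝ, HasStrictFDerivAt U T x := by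
    rintro x ⟨-, hx⟩
    have hx' : 2 * eval x (qa2 φ) ≠ 0 := mul_ne_zero two_ne_zero hx
    have := (hasStrictFDerivAt_eval (qa1 φ) x).neg.mul
      ((hasStrictDerivAt_inv hx').comp_hasStrictFDerivAt x
        ((hasStrictFDerivAt_eval (qa2 φ) x).const_mul 2))
    exact ⟨_, this⟩
  choose! U' hU' using hU
  have hUeq : ∀ x ∈ V, 2 * eval x (qa2 φ) * U x + eval x (qa1 φ) = 0 := by
    rintro x ⟨-, hx⟩
    have hx : eval x (qa2 φ) ≠ 0 := hx
    simp only [hUdef]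
    field_simp
    ring
  have hroot : ∀ x ∈ V, x ∈ zset φ →
      eval x (qa2 φ) * U x ^ 2 + eval x (qa1 φ) * U x + eval x (qa0 φ) = 0 := by
    intro x hx hxφ
    have h1 := hUeq x hx
    have h3 := hΔ x hxφ
    simp only [disc, map_sub, map_mul, map_pow, map_ofNat] at h3
    have h4 : 4 * eval x (qa2 φ) *
        (eval x (qa2 φ) * U x ^ 2 + eval x (qa1 φ) * U x + eval x (qa0 φ)) = 0 := by
      linear_combination (2 * eval x (qa2 φ) * U x + eval x (qa1 φ)) * h1 - h3
    exact (mul_eq_zero.1 h4).resolve_left (mul_ne_zero four_ne_zero hx.2)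
  have hUa : U a = v 1 := by
    have h1 := hUeq a ⟨h2, ha2⟩
    have h3 := hΔ a haφ
    rw [disc_eq hE2] at h3
    have h4 : 2 * eval a (qa2 φ) * v 1 + eval a (qa1 φ) = 0 := by simpa using h3
    have h5 : (2 * eval a (qa2 φ)) * (U a - v 1) = 0 := by linear_combination h1 - h4
    exact sub_eq_zero.1 ((mul_eq_zero.1 h5).resolve_left (mul_ne_zero two_ne_zero ha2))
  rw [← eq_mfield h2 hd hv0 hUa]
  refine sheet_of_field hV (fun x hx => hx.1)
    (fun x hx => (hU' x hx).hasFDerivAt.continuousAt.continuousWithinAt) ?_ ⟨h2, ha2⟩ haφ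
  refine ruled_of_double hV (fun x hx => hx.1) hU'
    (fun x hx hxφ => hess_mfield_eq_zero hx.1 (hroot x hx hxφ)) ?_ ?_
  · intro x hx hxφ
    have h1 := mixed_mfield (U := U) hx.1
    rw [hUeq x hx] at h1
    have h3 : (-2 * eval x (pderiv 2 φ)) * mixed φ x (mfield φ U x) = 0 := h1.symm
    exact (mul_eq_zero.1 h3).resolve_left (mul_ne_zero (by norm_num) hx.1)
  · intro x hx _
    rw [← eval_qa2]
    exact hx.2

lemma sheet_of_flec_eq_zero (h2 : eval a (pderiv 2 φ) ≠ 0) (ha2 : eval a (qa2 φ) ≠ 0)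
    (hΔ : eval a (disc φ) ≠ 0) (hF : ∀ x ∈ zset φ, eval x (flec φ) = 0)
    (hrem : (∀ x ∈ zset φ, eval x (rem1 φ) = 0 ∧ eval x (rem0 φ) = 0) ∨ eval a (rem1 φ) ≠ 0)
    (hv0 : v 0 = 1) (hl : ln a v ⊆ zset φ) : Sheet φ (ln a v) := by
  obtain ⟨hd, hE2, hE3⟩ := line_equations hv0 hl
  have haφ : a ∈ zset φ := hl (self_mem_ln _ _)
  have hdisc := disc_eq hE2
  set s : ℝ := 2 * eval a (qa2 φ) * v 1 + eval a (qa1 φ) with hs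
  have hs0 : s ≠ 0 := by
    intro h
    rw [hdisc, h] at hΔ
    simp at hΔ
  set ε : ℝ := (SignType.sign s : ℝ) with hε
  have hε2 : ε ^ 2 = 1 := by
    rcases lt_or_gt_of_ne hs0 with h | h <;> simp [hε, h]
  have hεs : ε * Real.sqrt (eval a (disc φ)) = s := by
    rw [hdisc, Real.sqrt_sq_eq_abs, hε, sign_mul_abs]
  set U : (Fin 3 → ℝ) → ℝ :=
    fun x => (- eval x (qa1 φ) + ε * Real.sqrt (eval x (disc φ))) / (2 * eval x (qa2 φ)) with hUdef
  set W : (Fin 3 → ℝ) → ℝ :=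
    fun x => (- eval x (qa1 φ) - ε * Real.sqrt (eval x (disc φ))) / (2 * eval x (qa2 φ)) with hWdef
  set V₀ : Set (Fin 3 → ℝ) :=
    {x | eval x (pderiv 2 φ) ≠ 0} ∩ {x | eval x (qa2 φ) ≠ 0} ∩ {x | 0 < eval x (disc φ)} with hV₀
  have hV₀o : IsOpen V₀ := ((isOpen_ne_zero _).inter (isOpen_ne_zero _)).inter
    (isOpen_lt continuous_const (continuous_eval _))
  have haV₀ : a ∈ V₀ := by
    refine ⟨⟨h2, ha2⟩, ?_⟩
    change 0 < eval a (disc φ)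
    rw [hdisc]
    positivity
  have hUeq : ∀ x ∈ V₀, 2 * eval x (qa2 φ) * U x + eval x (qa1 φ) =
      ε * Real.sqrt (eval x (disc φ)) := by
    rintro x ⟨⟨-, hx⟩, -⟩
    have hx : eval x (qa2 φ) ≠ 0 := hx
    simp only [hUdef]
    field_simp
    ring
  have hWeq : ∀ x ∈ V₀, eval x (qa2 φ) * (U x + W x) + eval x (qa1 φ) = 0 := by
    rintro x ⟨⟨-, hx⟩, -⟩
    have hx : eval x (qa2 φ) ≠ 0 := hx
    simp only [hUdef, hWdef]
    field_simp
    ring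
  have hroot : ∀ x ∈ V₀, eval x (qa2 φ) * U x ^ 2 + eval x (qa1 φ) * U x + eval x (qa0 φ) = 0 := by
    intro x hx
    have h1 := hUeq x hx
    have h3 : Real.sqrt (eval x (disc φ)) ^ 2 = eval x (disc φ) := Real.sq_sqrt (le_of_lt hx.2)
    have h5 : (2 * eval x (qa2 φ) * U x + eval x (qa1 φ)) ^ 2 = eval x (disc φ) := by
      rw [h1, mul_pow, hε2, h3, one_mul]
    simp only [disc, map_sub, map_mul, map_pow, map_ofNat] at h5
    have h4 : 4 * eval x (qa2 φ) *
        (eval x (qa2 φ) * U x ^ 2 + eval x (qa1 φ) * U x + eval x (qa0 φ)) = 0 := by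
      linear_combination h5
    exact (mul_eq_zero.1 h4).resolve_left (mul_ne_zero four_ne_zero hx.1.2)
  have hU : ∀ x ∈ V₀, ∃ T : (Fin 3 → ℝ) →L[ℝ] ℝ, HasStrictFDerivAt U T x := by
    rintro x ⟨⟨-, hx⟩, hx3⟩
    have hx' : 2 * eval x (qa2 φ) ≠ 0 := mul_ne_zero two_ne_zero hx
    have := ((hasStrictFDerivAt_eval (qa1 φ) x).neg.add
      (((hasStrictFDerivAt_eval (disc φ) x).sqrt (ne_of_gt hx3)).const_mul ε)).mul
      ((hasStrictDerivAt_inv hx').comp_hasStrictFDerivAt x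
        ((hasStrictFDerivAt_eval (qa2 φ) x).const_mul 2))
    exact ⟨_, this⟩
  have hWc : ContinuousOn W V₀ := by
    refine ContinuousOn.div ?_ ?_ fun x hx => mul_ne_zero two_ne_zero hx.1.2
    · exact ((continuous_eval _).neg.sub
        (continuous_const.mul (Real.continuous_sqrt.comp (continuous_eval _)))).continuousOn
    · exact (continuous_const.mul (continuous_eval _)).continuousOn
  have hUa : U a = v 1 := by
    have h1 := hUeq a haV₀
    rw [hεs, hs] at h1
    have h5 : (2 * eval a (qa2 φ)) * (U a - v 1) = 0 := by linear_combination h1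
    exact sub_eq_zero.1 ((mul_eq_zero.1 h5).resolve_left (mul_ne_zero two_ne_zero ha2))
  have hra : eval a (rem1 φ) * U a + eval a (rem0 φ) = 0 := by
    have h := sq_mul_cubic (φ := φ) (x := a) (v 1)
    rw [hE2, hE3] at h
    rw [hUa]
    linear_combination - h
  obtain ⟨V, hV, hVV₀, haV, hVr⟩ : ∃ V : Set (Fin 3 → ℝ), IsOpen V ∧ V ⊆ V₀ ∧ a ∈ V ∧
      ∀ x ∈ V, x ∈ zset φ → eval x (rem1 φ) * U x + eval x (rem0 φ) = 0 := by
    rcases hrem with hrem | hrem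
    · refine ⟨V₀, hV₀o, subset_rfl, haV₀, fun x _ hxφ => ?_⟩
      rw [(hrem x hxφ).1, (hrem x hxφ).2]
      ring
    · have hcont : ContinuousOn (fun x => eval x (rem1 φ) * W x + eval x (rem0 φ)) V₀ :=
        ((continuous_eval _).continuousOn.mul hWc).add (continuous_eval _).continuousOn
      refine ⟨_, hcont.isOpen_inter_preimage hV₀o (isOpen_ne (x := 0)), Set.inter_subset_left,
        ⟨haV₀, ?_⟩, ?_⟩
      · change eval a (rem1 φ) * W a + eval a (rem0 φ) ≠ 0
        have h6 := hWeq a haV₀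
        have h7 := hUeq a haV₀
        rw [hεs] at h7
        have h8 : eval a (qa2 φ) * (eval a (rem1 φ) * W a + eval a (rem0 φ)) =
            - s * eval a (rem1 φ) := by
          linear_combination eval a (rem1 φ) * h6 - eval a (rem1 φ) * h7 + eval a (qa2 φ) * hra
        intro h9
        rw [h9, mul_zero] at h8
        exact mul_ne_zero (neg_ne_zero.2 hs0) hrem h8.symm
      · rintro x ⟨hx, hx3⟩ hxφ
        have hx3 : eval x (rem1 φ) * W x + eval x (rem0 φ) ≠ 0 := hx3
        have h6 := hWeq x hx
        have h7 := hroot x hx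
        have h8 := hF x hxφ
        simp only [flec, map_sub, map_add, map_mul, map_pow] at h8
        have h9 : (eval x (qa2 φ) * (eval x (rem1 φ) * W x + eval x (rem0 φ))) *
            (eval x (rem1 φ) * U x + eval x (rem0 φ)) = 0 := by
          linear_combination (eval x (rem1 φ) * (eval x (rem1 φ) * U x + eval x (rem0 φ))) * h6
            + h8 - eval x (rem1 φ) ^ 2 * h7
        exact (mul_eq_zero.1 h9).resolve_left (mul_ne_zero hx.1.2 hx3)
  choose! U' hU' using hU
  rw [← eq_mfield h2 hd hv0 hUa]
  refine sheet_of_field hV (fun x hx => (hVV₀ hx).1.1)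
    (fun x hx => (hU' x (hVV₀ hx)).hasFDerivAt.continuousAt.continuousWithinAt) ?_ haV haφ
  refine ruled_of_simple hV (fun x hx => (hVV₀ hx).1.1) (fun x hx => hU' x (hVV₀ hx))
    (fun x hx hxφ => hess_mfield_eq_zero (hVV₀ hx).1.1 (hroot x (hVV₀ hx))) ?_ ?_
  · intro x hx hxφ
    refine third_mfield_eq_zero (hVV₀ hx).1.1 ?_
    have h := sq_mul_cubic (φ := φ) (x := x) (U x)
    rw [hroot x (hVV₀ hx), hVr x hx hxφ, zero_mul, zero_add] at h
    exact (mul_eq_zero.1 h).resolve_left (pow_ne_zero 2 (hVV₀ hx).1.2)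
  · intro x hx hxφ h0
    have h1 := mixed_mfield (U := U) (hVV₀ hx).1.1
    rw [hUeq x (hVV₀ hx), h0, mul_zero] at h1
    have h3 : 0 < Real.sqrt (eval x (disc φ)) := Real.sqrt_pos.2 (hVV₀ hx).2
    have h4 : ε ≠ 0 := by
      rintro h
      rw [h] at hε2
      norm_num at hε2
    exact mul_ne_zero h4 h3.ne' h1

end Local

/-- `p` lies on three distinct lines contained in the zero set of `φ`. -/
def TriplePoint (φ : MvPolynomial (Fin 3) ℝ) (p : Fin 3 → ℝ) : Prop :=
  ∃ l₁ l₂ l₃ : Set (Fin 3 → ℝ), IsLine l₁ ∧ IsLine l₂ ∧ IsLine l₃ ∧ l₁ ≠ l₂ ∧ l₁ ≠ l₃ ∧ l₂ ≠ l₃ ∧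
    p ∈ l₁ ∧ p ∈ l₂ ∧ p ∈ l₃ ∧ l₁ ⊆ zset φ ∧ l₂ ⊆ zset φ ∧ l₃ ⊆ zset φ

/-- `G` is a low degree polynomial outside of whose zero set the lines of `L` on the surface
`φ = 0` lie in sheets, and no three lines on the surface are concurrent. -/
structure LineControl (φ : MvPolynomial (Fin 3) ℝ) (L : Finset (Set (Fin 3 → ℝ)))
    (G : MvPolynomial (Fin 3) ℝ) : Prop where
  degree_le : G.totalDegree ≤ 27 * φ.totalDegree
  not_dvd : ¬ φ ∣ G
  sheet : ∀ l ∈ L, l ⊆ zset φ → ¬ l ⊆ zset G → Sheet φ l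
  triple : ∀ p, TriplePoint φ p → eval p G = 0

lemma TriplePoint.mem_zset {φ : MvPolynomial (Fin 3) ℝ} {p : Fin 3 → ℝ} (h : TriplePoint φ p) :
    p ∈ zset φ := by
  obtain ⟨l₁, -, -, -, -, -, -, -, -, h1, -, -, h2, -⟩ := h
  exact h2 h1

lemma TriplePoint.exists_three {φ : MvPolynomial (Fin 3) ℝ} {p : Fin 3 → ℝ}
    (h : TriplePoint φ p) : ∃ v₁ v₂ v₃ : Fin 3 → ℝ, v₁ ≠ 0 ∧ v₂ ≠ 0 ∧ v₃ ≠ 0 ∧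
      ln p v₁ ≠ ln p v₂ ∧ ln p v₁ ≠ ln p v₃ ∧ ln p v₂ ≠ ln p v₃ ∧
      ln p v₁ ⊆ zset φ ∧ ln p v₂ ⊆ zset φ ∧ ln p v₃ ⊆ zset φ := by
  obtain ⟨l₁, l₂, l₃, i1, i2, i3, n1, n2, n3, m1, m2, m3, s1, s2, s3⟩ := h
  obtain ⟨v₁, hv1, rfl⟩ := IsLine.exists_eq_ln i1 m1
  obtain ⟨v₂, hv2, rfl⟩ := IsLine.exists_eq_ln i2 m2
  obtain ⟨v₃, hv3, rfl⟩ := IsLine.exists_eq_ln i3 m3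
  exact ⟨v₁, v₂, v₃, hv1, hv2, hv3, n1, n2, n3, s1, s2, s3⟩

/-- Tangent vectors with proportional first coordinates span the same line. -/
lemma det_ne_zero_of_ln_ne {φ : MvPolynomial (Fin 3) ℝ} {p v w : Fin 3 → ℝ}
    (h2 : eval p (pderiv 2 φ) ≠ 0) (hv : dAlong φ p v = 0) (hw : dAlong φ p w = 0)
    (hv0 : v ≠ 0) (hw0 : w ≠ 0) (hne : ln p v ≠ ln p w) : v 0 * w 1 - w 0 * v 1 ≠ 0 := by
  intro hdet
  rw [dAlong_expand] at hv hw
  have key : ∀ i, (w 0 * v i = v 0 * w i) ∧ (w 1 * v i = v 1 * w i) := by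
    intro i
    fin_cases i
    · simp only [Fin.zero_eta]
      exact ⟨by ring, by linear_combination hdet⟩
    · simp only [Fin.mk_one]
      exact ⟨by linear_combination - hdet, by ring⟩
    · simp only [Fin.reduceFinMk]
      constructor
      · apply mul_left_cancel₀ h2
        linear_combination w 0 * hv - v 0 * hw + eval p (pderiv 1 φ) * hdet
      · apply mul_left_cancel₀ h2
        linear_combination w 1 * hv - v 1 * hw - eval p (pderiv 0 φ) * hdet
  have hcoord : ∀ u : Fin 3 → ℝ, u ≠ 0 → (eval p (pderiv 0 φ) * u 0 + eval p (pderiv 1 φ) * u 1 +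
      eval p (pderiv 2 φ) * u 2 = 0) → u 0 ≠ 0 ∨ u 1 ≠ 0 := by
    intro u hu h
    by_contra! hc
    rw [hc.1, hc.2] at h
    simp [h2] at h
    apply hu
    ext i
    fin_cases i
    exacts [hc.1, hc.2, h]
  rcases hcoord v hv0 hv with h | h
  · have hw' : w = (w 0 / v 0) • v := by
      ext i
      simp only [Pi.smul_apply, smul_eq_mul]
      rw [div_mul_eq_mul_div, eq_div_iff h]
      linear_combination - (key i).1
    have hc : w 0 / v 0 ≠ 0 := by
      intro h0
      rw [h0, zero_smul] at hw'
      exact hw0 hw'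
    apply hne
    rw [hw', ln_smul hc]
  · have hw' : w = (w 1 / v 1) • v := by
      ext i
      simp only [Pi.smul_apply, smul_eq_mul]
      rw [div_mul_eq_mul_div, eq_div_iff h]
      linear_combination - (key i).2
    have hc : w 1 / v 1 ≠ 0 := by
      intro h0
      rw [h0, zero_smul] at hw'
      exact hw0 hw'
    apply hne
    rw [hw', ln_smul hc]

lemma TriplePoint.eval_mul_qa2 {φ : MvPolynomial (Fin 3) ℝ} {p : Fin 3 → ℝ}
    (h : TriplePoint φ p) : eval p (pderiv 2 φ * qa2 φ) = 0 := by
  rw [map_mul, mul_eq_zero]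
  by_contra! hne
  obtain ⟨h2, ha2⟩ := hne
  obtain ⟨v₁, v₂, v₃, hv1, hv2, hv3, n12, n13, n23, s1, s2, s3⟩ := h.exists_three
  have key : ∀ v, ln p v ⊆ zset φ → dAlong φ p v = 0 ∧
      eval p (qa2 φ) * v 1 ^ 2 + eval p (qa1 φ) * (v 0 * v 1) + eval p (qa0 φ) * v 0 ^ 2 = 0 := by
    intro v hl
    have h1 := dirDeriv_of_ln_subset hl 1
    have h2 := dirDeriv_of_ln_subset hl 2
    rw [jeval_dirDeriv_one] at h1
    rw [jeval_dirDeriv_two] at h2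
    refine ⟨h1, ?_⟩
    rw [← sq_mul_hess h1, h2, mul_zero]
  obtain ⟨t1, q1⟩ := key v₁ s1
  obtain ⟨t2, q2⟩ := key v₂ s2
  obtain ⟨t3, q3⟩ := key v₃ s3
  have d12 := det_ne_zero_of_ln_ne h2 t1 t2 hv1 hv2 n12
  have d13 := det_ne_zero_of_ln_ne h2 t1 t3 hv1 hv3 n13
  have d23 := det_ne_zero_of_ln_ne h2 t2 t3 hv2 hv3 n23
  refine mul_ne_zero ha2 (mul_ne_zero (mul_ne_zero d12 d13) d23) ?_
  generalize v₁ 0 = a0 at *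
  generalize v₁ 1 = a1 at *
  generalize v₂ 0 = b0 at *
  generalize v₂ 1 = b1 at *
  generalize v₃ 0 = c0 at *
  generalize v₃ 1 = c1 at *
  linear_combination (- (b0 * b1 * c0 ^ 2 - c0 * c1 * b0 ^ 2)) * q1
    + (a0 * a1 * c0 ^ 2 - c0 * c1 * a0 ^ 2) * q2 - (a0 * a1 * b0 ^ 2 - b0 * b1 * a0 ^ 2) * q3

/-- A surface all of whose tangent directions are asymptotic is a plane. -/
lemma pderiv_eq_zero_of_flat {φ : MvPolynomial (Fin 3) ℝ} (hφ : Irreducible φ)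
    (hd : 2 ≤ φ.totalDegree)
    (hflat : ∀ x ∈ zset φ, eval x (qa2 φ) = 0 ∧ eval x (qa1 φ) = 0 ∧ eval x (qa0 φ) = 0)
    {p : Fin 3 → ℝ} (hp : p ∈ zset φ) : eval p (pderiv 2 φ) = 0 := by
  by_contra h2
  have hl : ∀ u : ℝ, ln p (mfield φ (fun _ => u) p) ⊆ zset φ := by
    intro u
    refine ruled_of_flat (U' := fun _ => 0) (isOpen_ne_zero (pderiv 2 φ)) (fun x hx => hx)
      (fun x _ => hasStrictFDerivAt_const _ _) ?_ ?_ p h2 hp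
    · intro x hx hxφ
      refine hess_mfield_eq_zero hx ?_
      obtain ⟨e1, e2, e3⟩ := hflat x hxφ
      rw [e1, e2, e3]
      ring
    · intro x _ _
      rfl
  have hn : (fun i => eval p (pderiv i φ)) ≠ 0 := fun h => h2 (congrFun h 2)
  have hfin := finite_lines_in_plane hφ hd hn (∑ i, eval p (pderiv i φ) * p i)
  have hm0 : ∀ u, mfield φ (fun _ => u) p 0 = 1 := fun u => rfl
  have hm1 : ∀ u, mfield φ (fun _ => u) p 1 = u := fun u => rfl
  have hinj : Function.Injective fun u : ℝ => ln p (mfield φ (fun _ => u) p) := by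
    intro u u' h
    by_contra hne
    refine det_ne_zero_of_ln_ne (φ := φ) (p := p) (v := mfield φ (fun _ => u) p)
      (w := mfield φ (fun _ => u') p) h2 (dAlong_mfield _ h2) (dAlong_mfield _ h2) ?_ ?_ ?_ ?_
    · intro h0
      simpa [hm0] using congrFun h0 0
    · intro h0
      simpa [hm0] using congrFun h0 0
    all_goals
      exfalso
      have h1 : p + (1 : ℝ) • mfield φ (fun _ => u') p ∈ ln p (mfield φ (fun _ => u) p) := by
        rw [show ln p (mfield φ (fun _ => u) p) = _ from h]
        exact add_smul_mem_ln _ _ _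
      obtain ⟨t, ht⟩ := mem_ln.1 h1
      have k0 := congrFun ht 0
      have k1 := congrFun ht 1
      simp only [Pi.add_apply, Pi.smul_apply, hm0, hm1, smul_eq_mul, mul_one, one_mul] at k0 k1
      have ht1 : t = 1 := by linarith
      rw [ht1] at k1
      apply hne
      linarith
  refine Set.infinite_range_of_injective hinj (hfin.subset ?_)
  rintro _ ⟨u, rfl⟩
  refine ⟨isLine_ln ?_, hl u, ?_⟩
  · intro h0
    simpa [hm0] using congrFun h0 0
  · rintro x ⟨t, rfl⟩
    have h1 := dAlong_mfield (φ := φ) (fun _ => u) h2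
    rw [dAlong] at h1
    simp only [Pi.add_apply, Pi.smul_apply, smul_eq_mul, mul_add, Finset.sum_add_distrib]
    have h3 : ∑ i, eval p (pderiv i φ) * (t * mfield φ (fun _ => u) p i) =
        t * ∑ i, eval p (pderiv i φ) * mfield φ (fun _ => u) p i := by
      rw [Finset.mul_sum]
      exact Finset.sum_congr rfl fun i _ => by ring
    rw [h3, h1]
    ring

lemma eval_eq_zero_of_dvd {φ g : MvPolynomial (Fin 3) ℝ} (h : φ ∣ g) {x : Fin 3 → ℝ}
    (hx : x ∈ zset φ) : eval x g = 0 := by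
  obtain ⟨k, rfl⟩ := h
  rw [map_mul, mem_zset.1 hx, zero_mul]

lemma exists_lineControl_of_coordinates {φ : MvPolynomial (Fin 3) ℝ} (hφ : Irreducible φ)
    (hd : 2 ≤ φ.totalDegree) (h2 : pderiv 2 φ ≠ 0)
    (hcase : ¬ φ ∣ qa2 φ ∨
      ∀ x ∈ zset φ, eval x (qa2 φ) = 0 ∧ eval x (qa1 φ) = 0 ∧ eval x (qa0 φ) = 0)
    (L : Finset (Set (Fin 3 → ℝ))) (hL : ∀ l ∈ L, ∃ p v : Fin 3 → ℝ, v 0 = 1 ∧ l = ln p v) :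
    ∃ G, LineControl φ L G := by
  have hp := hφ.prime
  have h2d : ¬ φ ∣ pderiv 2 φ := not_dvd_pderiv (by omega) h2
  have hdeg2 := totalDegree_pderiv_le 2 φ
  have hgood : ∀ G, ∀ l ∈ L, l ⊆ zset φ → ¬ l ⊆ zset G →
      ∃ a v, v 0 = 1 ∧ l = ln a v ∧ eval a G ≠ 0 := by
    intro G l hl _ hG
    obtain ⟨p, v, hv, rfl⟩ := hL l hl
    obtain ⟨a, ha, haG⟩ := Set.not_subset.1 hG
    exact ⟨a, v, hv, ln_eq_of_mem ha, haG⟩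
  rcases hcase with hcase | hflat
  · have h22 : ¬ φ ∣ pderiv 2 φ * qa2 φ := fun h => (hp.dvd_or_dvd h).elim h2d hcase
    have hd22 : (pderiv 2 φ * qa2 φ).totalDegree ≤ 4 * φ.totalDegree :=
      (totalDegree_mul_le_of_le hdeg2 (totalDegree_qa2_le φ)).trans (by omega)
    by_cases hΔ : φ ∣ disc φ
    · refine ⟨pderiv 2 φ * qa2 φ, hd22.trans (by omega), h22, ?_, fun p hp => hp.eval_mul_qa2⟩
      intro l hl hlφ hlG
      obtain ⟨a, v, hv, rfl, ha⟩ := hgood _ l hl hlφ hlG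
      rw [map_mul, mul_ne_zero_iff] at ha
      exact sheet_of_disc_eq_zero ha.1 ha.2 (fun x hx => eval_eq_zero_of_dvd hΔ hx) hv hlφ
    by_cases hF : φ ∣ flec φ
    · by_cases hr : φ ∣ rem1 φ
      · have hr0 : φ ∣ rem0 φ := by
          have h3 : φ ∣ qa2 φ * rem0 φ ^ 2 := by
            have h4 : qa2 φ * rem0 φ ^ 2 = flec φ + rem1 φ *
                (qa1 φ * rem0 φ - qa0 φ * rem1 φ) := by
              rw [flec]
              ring
            rw [h4]
            exact dvd_add hF (hr.mul_right _)
          exact hp.dvd_of_dvd_pow ((hp.dvd_or_dvd h3).resolve_left hcase)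
        refine ⟨pderiv 2 φ * qa2 φ * disc φ,
          (totalDegree_mul_le_of_le hd22 (totalDegree_disc_le φ)).trans (by omega),
          fun h => (hp.dvd_or_dvd h).elim h22 hΔ, ?_, fun p hp => ?_⟩
        · intro l hl hlφ hlG
          obtain ⟨a, v, hv, rfl, ha⟩ := hgood _ l hl hlφ hlG
          rw [map_mul, map_mul, mul_ne_zero_iff, mul_ne_zero_iff] at ha
          exact sheet_of_flec_eq_zero ha.1.1 ha.1.2 ha.2 (fun x hx => eval_eq_zero_of_dvd hF hx)
            (Or.inl fun x hx => ⟨eval_eq_zero_of_dvd hr hx, eval_eq_zero_of_dvd hr0 hx⟩) hv hlφ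
        · rw [map_mul, hp.eval_mul_qa2, zero_mul]
      · refine ⟨pderiv 2 φ * qa2 φ * (disc φ * rem1 φ),
          (totalDegree_mul_le_of_le hd22 (totalDegree_mul_le_of_le (totalDegree_disc_le φ)
            (totalDegree_rem1_le φ))).trans (by omega),
          fun h => (hp.dvd_or_dvd h).elim h22 fun h => (hp.dvd_or_dvd h).elim hΔ hr,
          ?_, fun p hp => ?_⟩
        · intro l hl hlφ hlG
          obtain ⟨a, v, hv, rfl, ha⟩ := hgood _ l hl hlφ hlG
          rw [map_mul, map_mul, map_mul, mul_ne_zero_iff, mul_ne_zero_iff, mul_ne_zero_iff] at ha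
          exact sheet_of_flec_eq_zero ha.1.1 ha.1.2 ha.2.1
            (fun x hx => eval_eq_zero_of_dvd hF hx) (Or.inr ha.2.2) hv hlφ
        · rw [map_mul, hp.eval_mul_qa2, zero_mul]
    · refine ⟨pderiv 2 φ * qa2 φ * flec φ,
        (totalDegree_mul_le_of_le hd22 (totalDegree_flec_le φ)).trans (by omega),
        fun h => (hp.dvd_or_dvd h).elim h22 hF, ?_, fun p hp => ?_⟩
      · intro l hl hlφ hlG
        obtain ⟨a, v, hv, rfl, ha⟩ := hgood _ l hl hlφ hlG
        rw [map_mul, flec_eq_zero_of_line hv hlφ, mul_zero] at ha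
        exact absurd rfl ha
      · rw [map_mul, hp.eval_mul_qa2, zero_mul]
  · refine ⟨pderiv 2 φ, hdeg2.trans (by omega), h2d, ?_, ?_⟩
    · intro l hl hlφ hlG
      exact absurd (fun x hx => pderiv_eq_zero_of_flat hφ hd hflat (hlφ hx)) hlG
    · exact fun p hp => pderiv_eq_zero_of_flat hφ hd hflat hp.mem_zset

/-! ### Linear changes of coordinates -/

lemma image_ln (e : (Fin 3 → ℝ) ≃ₗ[ℝ] (Fin 3 → ℝ)) (p v : Fin 3 → ℝ) :
    e '' ln p v = ln (e p) (e v) := by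
  ext x
  constructor
  · rintro ⟨_, ⟨t, rfl⟩, rfl⟩
    exact ⟨t, by simp⟩
  · rintro ⟨t, rfl⟩
    exact ⟨p + t • v, add_smul_mem_ln _ _ _, by simp⟩

lemma isLine_image (e : (Fin 3 → ℝ) ≃ₗ[ℝ] (Fin 3 → ℝ)) {l : Set (Fin 3 → ℝ)} (hl : IsLine l) :
    IsLine (e '' l) := by
  obtain ⟨p, v, hv, rfl⟩ := isLine_iff.1 hl
  rw [image_ln]
  exact isLine_ln (by simpa using hv)

section Transport

variable {e : (Fin 3 → ℝ) ≃ₗ[ℝ] (Fin 3 → ℝ)}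
  {Ψ : MvPolynomial (Fin 3) ℝ ≃ₐ[ℝ] MvPolynomial (Fin 3) ℝ}

lemma image_subset_zset_iff (hΨ : ∀ f x, eval x (Ψ f) = eval (e x) f)
    (f : MvPolynomial (Fin 3) ℝ) (l : Set (Fin 3 → ℝ)) :
    e.symm '' l ⊆ zset (Ψ f) ↔ l ⊆ zset f := by
  simp only [Set.image_subset_iff]
  constructor
  · intro h x hx
    have := h hx
    rw [Set.mem_preimage, mem_zset, hΨ, e.apply_symm_apply] at this
    exact this
  · intro h x hx
    rw [Set.mem_preimage, mem_zset, hΨ, e.apply_symm_apply]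
    exact h hx

lemma Sheet.transport (hΨ : ∀ f x, eval x (Ψ f) = eval (e x) f) {φ : MvPolynomial (Fin 3) ℝ}
    {l : Set (Fin 3 → ℝ)} (h : Sheet (Ψ φ) (e.symm '' l)) : Sheet φ l := by
  obtain ⟨ε, hε, q, v, hq, hv, hv0, hinj, hsub, h0⟩ := h
  have hec : Continuous e := e.toContinuousLinearEquiv.continuous
  have hback : ∀ t, e.symm '' ln (e (q t)) (e (v t)) = ln (q t) (v t) := by
    intro t
    rw [image_ln, e.symm_apply_apply, e.symm_apply_apply]
  refine ⟨ε, hε, fun t => e (q t), fun t => e (v t), hec.comp_continuousOn hq,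
    hec.comp_continuousOn hv, fun t ht => by simpa using hv0 t ht, ?_, ?_, ?_⟩
  · intro t ht t' ht' h
    apply hinj ht ht'
    simp only at h ⊢
    rw [← hback, ← hback, h]
  · intro t ht
    rw [← image_subset_zset_iff hΨ, hback]
    exact hsub t ht
  · rw [← image_ln, h0, ← Set.image_comp]
    simp

lemma LineControl.transport (hΨ : ∀ f x, eval x (Ψ f) = eval (e x) f)
    (hΨd : ∀ f, (Ψ f).totalDegree = f.totalDegree) {φ G : MvPolynomial (Fin 3) ℝ}
    {L : Finset (Set (Fin 3 → ℝ))}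
    (h : LineControl (Ψ φ) (L.image fun l => e.symm '' l) (Ψ G)) : LineControl φ L G := by
  refine ⟨?_, ?_, ?_, ?_⟩
  · rw [← hΨd, ← hΨd φ]
    exact h.degree_le
  · rw [← map_dvd_iff Ψ]
    exact h.not_dvd
  · intro l hl hlφ hlG
    refine Sheet.transport hΨ (h.sheet _ (Finset.mem_image_of_mem _ hl) ?_ ?_)
    · rwa [image_subset_zset_iff hΨ]
    · rwa [image_subset_zset_iff hΨ]
  · rintro p ⟨l₁, l₂, l₃, i1, i2, i3, n1, n2, n3, m1, m2, m3, s1, s2, s3⟩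
    have hi := Set.image_injective.2 e.symm.injective
    have := h.triple (e.symm p) ⟨e.symm '' l₁, e.symm '' l₂, e.symm '' l₃, isLine_image _ i1,
      isLine_image _ i2, isLine_image _ i3, hi.ne n1, hi.ne n2, hi.ne n3,
      Set.mem_image_of_mem _ m1, Set.mem_image_of_mem _ m2, Set.mem_image_of_mem _ m3,
      (image_subset_zset_iff hΨ _ _).2 s1, (image_subset_zset_iff hΨ _ _).2 s2,
      (image_subset_zset_iff hΨ _ _).2 s3⟩
    rwa [hΨ, e.apply_symm_apply] at this

lemma dAlong_transport (hΨ : ∀ f x, eval x (Ψ f) = eval (e x) f) (f : MvPolynomial (Fin 3) ℝ)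
    (x τ : Fin 3 → ℝ) : dAlong (Ψ f) x τ = dAlong f (e x) (e τ) := by
  have h1 := (hasStrictFDerivAt_eval (Ψ f) x).hasFDerivAt
  have h2 := (hasStrictFDerivAt_eval f (e x)).hasFDerivAt.comp x
    (e.toContinuousLinearEquiv : (Fin 3 → ℝ) →L[ℝ] (Fin 3 → ℝ)).hasFDerivAt
  have h3 : (fun y => eval y (Ψ f)) = (fun y => eval y f) ∘ fun y => e y := by
    ext y
    exact hΨ f y
  rw [h3] at h1
  have h4 := congrArg (fun T : (Fin 3 → ℝ) →L[ℝ] ℝ => T τ) (h1.unique h2)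
  simpa [dAlong] using h4

lemma eval_dirSum (f : MvPolynomial (Fin 3) ℝ) (x b : Fin 3 → ℝ) :
    eval x (∑ j, C (b j) * pderiv j f) = dAlong f x b := by
  simp [dAlong, mul_comm]

lemma hess_eq_dAlong (f : MvPolynomial (Fin 3) ℝ) (x a b : Fin 3 → ℝ) :
    hess f x a b = dAlong (∑ j, C (b j) * pderiv j f) x a := by
  rw [dAlong_expand]
  simp only [hess, Fin.sum_univ_three, map_add, pderiv_C_mul, map_mul, eval_C]
  ring

lemma hess_transport (hΨ : ∀ f x, eval x (Ψ f) = eval (e x) f) (f : MvPolynomial (Fin 3) ℝ)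
    (x a b : Fin 3 → ℝ) : hess (Ψ f) x a b = hess f (e x) (e a) (e b) := by
  rw [hess_eq_dAlong, hess_eq_dAlong, ← dAlong_transport hΨ]
  congr 1
  apply MvPolynomial.funext
  intro y
  rw [hΨ, eval_dirSum, eval_dirSum, dAlong_transport hΨ]

end Transport

/-- The shear used to put a surface and a finite set of lines in general position. -/
noncomputable def shear (s : ℝ) : (Fin 3 → ℝ) ≃ₗ[ℝ] (Fin 3 → ℝ) where
  toFun x := ![x 0 - s * x 1 - s ^ 3 * x 2, x 1, x 2]
  invFun x := ![x 0 + s * x 1 + s ^ 3 * x 2, x 1, x 2]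
  map_add' x y := by
    ext i
    fin_cases i <;> simp
    ring
  map_smul' c x := by
    ext i
    fin_cases i <;> simp
    ring
  left_inv x := by
    ext i
    fin_cases i <;> simp
    ring
  right_inv x := by
    ext i
    fin_cases i <;> simp
    ring

lemma shear_apply (s : ℝ) (x : Fin 3 → ℝ) :
    shear s x = ![x 0 - s * x 1 - s ^ 3 * x 2, x 1, x 2] := rfl

lemma shear_symm_apply (s : ℝ) (x : Fin 3 → ℝ) :
    (shear s).symm x = ![x 0 + s * x 1 + s ^ 3 * x 2, x 1, x 2] := rfl

section Shear

variable {s : ℝ} {Ψ : MvPolynomial (Fin 3) ℝ ≃ₐ[ℝ] MvPolynomial (Fin 3) ℝ}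
  {φ : MvPolynomial (Fin 3) ℝ}

lemma eval_pderiv_eq_dAlong (f : MvPolynomial (Fin 3) ℝ) (x : Fin 3 → ℝ) (i : Fin 3) :
    eval x (pderiv i f) = dAlong f x (Pi.single i 1) := by
  simp [dAlong, Pi.single_apply]

lemma eval_pderiv_shear (hΨ : ∀ f x, eval x (Ψ f) = eval (shear s x) f) (x : Fin 3 → ℝ) :
    eval x (pderiv 0 (Ψ φ)) = eval (shear s x) (pderiv 0 φ) ∧
    eval x (pderiv 1 (Ψ φ)) =
      eval (shear s x) (pderiv 1 φ) - s * eval (shear s x) (pderiv 0 φ) ∧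
    eval x (pderiv 2 (Ψ φ)) =
      eval (shear s x) (pderiv 2 φ) - s ^ 3 * eval (shear s x) (pderiv 0 φ) := by
  refine ⟨?_, ?_, ?_⟩
  all_goals
    rw [eval_pderiv_eq_dAlong, dAlong_transport hΨ, dAlong_expand, shear_apply s (Pi.single _ _)]
    simp
  all_goals ring

/-- The three tangent fields occurring as coefficients of the sheared tangent vector. -/
noncomputable def tan0 (φ : MvPolynomial (Fin 3) ℝ) (x : Fin 3 → ℝ) : Fin 3 → ℝ :=
  ![0, eval x (pderiv 2 φ), - eval x (pderiv 1 φ)]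
/-- See `tan0`. -/
noncomputable def tan1 (φ : MvPolynomial (Fin 3) ℝ) (x : Fin 3 → ℝ) : Fin 3 → ℝ :=
  ![- eval x (pderiv 2 φ), 0, eval x (pderiv 0 φ)]
/-- See `tan0`. -/
noncomputable def tan2 (φ : MvPolynomial (Fin 3) ℝ) (x : Fin 3 → ℝ) : Fin 3 → ℝ :=
  ![eval x (pderiv 1 φ), - eval x (pderiv 0 φ), 0]

lemma shear_tau1 (hΨ : ∀ f x, eval x (Ψ f) = eval (shear s x) f) (x : Fin 3 → ℝ) :
    shear s (fun i => eval x (tau1 (Ψ φ) i)) = (1 : ℝ) • tan0 φ (shear s x) +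
      (1 : ℝ) • (s • tan1 φ (shear s x) + s ^ 3 • tan2 φ (shear s x)) := by
  obtain ⟨h0, h1, h2⟩ := eval_pderiv_shear (φ := φ) hΨ x
  rw [shear_apply]
  ext i
  fin_cases i
  all_goals
    simp [tau1, h1, h2, tan0, tan1, tan2]
    try ring

lemma shear_tau0 (hΨ : ∀ f x, eval x (Ψ f) = eval (shear s x) f) (x : Fin 3 → ℝ) :
    shear s (fun i => eval x (tau0 (Ψ φ) i)) = (-1 : ℝ) • tan1 φ (shear s x) := by
  obtain ⟨h0, h1, h2⟩ := eval_pderiv_shear (φ := φ) hΨ x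
  rw [shear_apply]
  ext i
  fin_cases i
  all_goals
    simp [tau0, h0, h2, tan1]

lemma hess_combination (x a b c w : Fin 3 → ℝ) (s t : ℝ) :
    hess φ x ((1 : ℝ) • a + (1 : ℝ) • (s • b + t • c)) w =
      hess φ x a w + s * hess φ x b w + t * hess φ x c w := by
  rw [hess_add_smul_left, hess_add_smul_left]
  ring

lemma eval_qa_shear (hΨ : ∀ f x, eval x (Ψ f) = eval (shear s x) f) (x : Fin 3 → ℝ) :
    eval x (qa2 (Ψ φ)) = hess φ (shear s x) (tan0 φ (shear s x)) (tan0 φ (shear s x)) +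
      2 * s * hess φ (shear s x) (tan0 φ (shear s x)) (tan1 φ (shear s x)) +
      s ^ 2 * hess φ (shear s x) (tan1 φ (shear s x)) (tan1 φ (shear s x)) +
      2 * s ^ 3 * hess φ (shear s x) (tan0 φ (shear s x)) (tan2 φ (shear s x)) +
      2 * s ^ 4 * hess φ (shear s x) (tan1 φ (shear s x)) (tan2 φ (shear s x)) +
      s ^ 6 * hess φ (shear s x) (tan2 φ (shear s x)) (tan2 φ (shear s x)) ∧
    eval x (qa1 (Ψ φ)) = - 2 * (hess φ (shear s x) (tan0 φ (shear s x)) (tan1 φ (shear s x)) +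
      s * hess φ (shear s x) (tan1 φ (shear s x)) (tan1 φ (shear s x)) +
      s ^ 3 * hess φ (shear s x) (tan1 φ (shear s x)) (tan2 φ (shear s x))) ∧
    eval x (qa0 (Ψ φ)) = hess φ (shear s x) (tan1 φ (shear s x)) (tan1 φ (shear s x)) := by
  have e0 := shear_tau0 (φ := φ) hΨ x
  have e1 := shear_tau1 (φ := φ) hΨ x
  set y := shear s x
  have s10 := hess_symm φ y (tan1 φ y) (tan0 φ y)
  have s20 := hess_symm φ y (tan2 φ y) (tan0 φ y)
  have s21 := hess_symm φ y (tan2 φ y) (tan1 φ y)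
  refine ⟨?_, ?_, ?_⟩
  · rw [qa2, eval_hessP, hess_transport hΨ, e1, hess_combination, hess_symm φ y (tan0 φ y) (_ + _),
      hess_symm φ y (tan1 φ y) (_ + _), hess_symm φ y (tan2 φ y) (_ + _), hess_combination,
      hess_combination, hess_combination, s10, s20, s21]
    ring
  · rw [qa1, map_mul, eval_hessP, hess_transport hΨ, e1, e0, hess_smul_left,
      hess_symm φ y (tan1 φ y) (_ + _), hess_combination, s21, map_ofNat]
    ring
  · rw [qa0, eval_hessP, hess_transport hΨ, e0, hess_smul_left, hess_symm φ y (tan1 φ y) (_ • _),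
      hess_smul_left]
    ring

end Shear

lemma ln_subset_zset_of_dAlong {φ : MvPolynomial (Fin 3) ℝ} {τ : Fin 3 → ℝ}
    (h : ∀ x, dAlong φ x τ = 0) {x : Fin 3 → ℝ} (hx : x ∈ zset φ) : ln x τ ⊆ zset φ := by
  have hder : ∀ t : ℝ, HasDerivAt (fun t : ℝ => eval (x + t • τ) φ) 0 t := by
    intro t
    have h1 : HasDerivAt (fun t : ℝ => x + t • τ) τ t := by
      simpa using ((hasDerivAt_id t).smul_const τ).const_add x
    have h2 := (hasStrictFDerivAt_eval φ (x + t • τ)).hasFDerivAt.comp_hasDerivAt t h1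
    have h3 := h (x + t • τ)
    rw [dAlong] at h3
    have h4 : (∑ i, eval (x + t • τ) (pderiv i φ) •
        (ContinuousLinearMap.proj i : (Fin 3 → ℝ) →L[ℝ] ℝ)) τ = 0 := by simpa using h3
    rw [h4] at h2
    exact h2
  have hc := is_const_of_deriv_eq_zero (fun t => (hder t).differentiableAt) fun t => (hder t).deriv
  rintro _ ⟨t, rfl⟩
  have h4 := hc t 0
  rw [zero_smul, add_zero, mem_zset.1 hx] at h4
  exact h4

/-- An irreducible nonlinear polynomial depending on a single coordinate has no zeros. -/
lemma pderiv_ne_zero_of_mem {φ : MvPolynomial (Fin 3) ℝ} (hφ : Irreducible φ)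
    (hd : 2 ≤ φ.totalDegree) {p : Fin 3 → ℝ} (hp : p ∈ zset φ) :
    pderiv 0 φ ≠ 0 ∨ pderiv 2 φ ≠ 0 := by
  by_contra! hz
  obtain ⟨h0, h2⟩ := hz
  have hl : ∀ u : ℝ, ln p ![1, 0, u] ⊆ zset φ := by
    intro u
    refine ln_subset_zset_of_dAlong (fun x => ?_) hp
    rw [dAlong_expand, h0, h2]
    simp
  have hn : (Pi.single 1 1 : Fin 3 → ℝ) ≠ 0 := by
    intro h
    simpa using congrFun h 1
  have hfin := finite_lines_in_plane hφ hd hn (p 1)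
  have hinj : Function.Injective fun u : ℝ => ln p ![1, 0, u] := by
    intro u u' h
    have h1 : p + (1 : ℝ) • ![1, 0, u'] ∈ ln p ![1, 0, u] := by
      rw [show ln p ![1, 0, u] = _ from h]
      exact add_smul_mem_ln _ _ _
    obtain ⟨t, ht⟩ := mem_ln.1 h1
    have k0 := congrFun ht 0
    have k2 := congrFun ht 2
    simp at k0 k2
    rw [← k0] at k2
    linarith
  refine Set.infinite_range_of_injective hinj (hfin.subset ?_)
  rintro _ ⟨u, rfl⟩
  refine ⟨isLine_ln ?_, hl u, ?_⟩
  · intro h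
    simpa using congrFun h 0
  · rintro x ⟨t, rfl⟩
    simp [Fin.sum_univ_three]

open Polynomial in
lemma finite_zeros_shear {v : Fin 3 → ℝ} (hv : v ≠ 0) :
    {s : ℝ | v 0 + s * v 1 + s ^ 3 * v 2 = 0}.Finite := by
  set P : ℝ[X] := Polynomial.C (v 0) + Polynomial.C (v 1) * Polynomial.X +
    Polynomial.C (v 2) * Polynomial.X ^ 3 with hP
  have hP0 : P ≠ 0 := by
    intro h
    apply hv
    have c0 := congrArg (fun p => Polynomial.coeff p 0) h
    have c1 := congrArg (fun p => Polynomial.coeff p 1) h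
    have c3 := congrArg (fun p => Polynomial.coeff p 3) h
    simp [hP, Polynomial.coeff_X, Polynomial.coeff_C] at c0 c1 c3
    ext i
    fin_cases i
    exacts [c0, c1, c3]
  refine (P.rootSet_finite ℝ).subset ?_
  intro s hs
  rw [Polynomial.mem_rootSet]
  refine ⟨hP0, ?_⟩
  have hs : v 0 + s * v 1 + s ^ 3 * v 2 = 0 := hs
  simp [hP]
  linarith

open Polynomial in
lemma coefficients_eq_zero {S : Set ℝ} (hS : S.Infinite) {a b c d e f : ℝ}
    (h : ∀ s ∈ S, a + 2 * s * b + s ^ 2 * c + 2 * s ^ 3 * d + 2 * s ^ 4 * e + s ^ 6 * f = 0) :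
    a = 0 ∧ b = 0 ∧ c = 0 ∧ d = 0 ∧ e = 0 ∧ f = 0 := by
  set P : ℝ[X] := Polynomial.C a + Polynomial.C (2 * b) * Polynomial.X +
    Polynomial.C c * Polynomial.X ^ 2 + Polynomial.C (2 * d) * Polynomial.X ^ 3 +
    Polynomial.C (2 * e) * Polynomial.X ^ 4 + Polynomial.C f * Polynomial.X ^ 6 with hP
  have hP0 : P = 0 := by
    refine Polynomial.eq_zero_of_infinite_isRoot P (hS.mono ?_)
    intro s hs
    have h1 := h s hs
    change Polynomial.IsRoot P s
    rw [Polynomial.IsRoot.def, hP]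
    simp only [Polynomial.eval_add, Polynomial.eval_mul, Polynomial.eval_C, Polynomial.eval_pow,
      Polynomial.eval_X]
    linarith
  have key : ∀ n, Polynomial.coeff P n = 0 := fun n => by rw [hP0, Polynomial.coeff_zero]
  have c0 := key 0
  have c1 := key 1
  have c2 := key 2
  have c3 := key 3
  have c4 := key 4
  have c6 := key 6
  simp only [hP, Polynomial.coeff_add, Polynomial.coeff_C_mul, Polynomial.coeff_C,
    Polynomial.coeff_X_pow, Polynomial.coeff_X] at c0 c1 c2 c3 c4 c6
  norm_num at c0 c1 c2 c3 c4 c6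
  exact ⟨c0, c1, c2, c3, c4, c6⟩

theorem exists_lineControl {φ : MvPolynomial (Fin 3) ℝ} (hφ : Irreducible φ)
    (hd : 2 ≤ φ.totalDegree) (L : Finset (Set (Fin 3 → ℝ))) (hL : ∀ l ∈ L, IsLine l) :
    ∃ G, LineControl φ L G := by
  by_cases hne : ∃ p, p ∈ zset φ
  swap
  · push Not at hne
    refine ⟨1, by simp, fun h => hφ.not_isUnit (isUnit_of_dvd_one h), ?_,
      fun p hp => absurd hp.mem_zset (hne p)⟩
    intro l hl hlφ _
    obtain ⟨p, v, -, rfl⟩ := isLine_iff.1 (hL l hl)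
    exact absurd (hlφ (self_mem_ln _ _)) (hne p)
  obtain ⟨p₀, hp₀⟩ := hne
  have h02 := pderiv_ne_zero_of_mem hφ hd hp₀
  choose Ψ hΨ hΨd using fun s => exists_algEquiv_of_linearEquiv (shear s)
  have hF1 : {s : ℝ | pderiv 2 (Ψ s φ) = 0}.Subsingleton := by
    intro s hs s' hs'
    have key : ∀ s, pderiv 2 (Ψ s φ) = 0 → pderiv 2 φ = C (s ^ 3) * pderiv 0 φ := by
      intro s hs
      apply MvPolynomial.funext
      intro x
      have h := (eval_pderiv_shear (φ := φ) (hΨ s) ((shear s).symm x)).2.2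
      rw [hs, LinearEquiv.apply_symm_apply, map_zero] at h
      rw [map_mul, eval_C]
      linarith
    have k1 := key s hs
    have k2 := key s' hs'
    have h0 : pderiv 0 φ ≠ 0 := by
      intro h0
      rw [h0, mul_zero] at k1
      exact h02.elim (fun h => h h0) fun h => h k1
    rw [k1] at k2
    have h3 : s ^ 3 = s' ^ 3 := C_injective _ _ (mul_right_cancel₀ h0 k2)
    exact (Odd.strictMono_pow (by decide : Odd 3)).injective h3
  have hF2 : (⋃ l ∈ L, {s : ℝ | ∃ p v, v ≠ 0 ∧ l = ln p v ∧ v 0 + s * v 1 + s ^ 3 * v 2 = 0}).Finite := by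
    refine Set.Finite.biUnion L.finite_toSet fun l hl => ?_
    obtain ⟨p, v, hv, rfl⟩ := isLine_iff.1 (hL l hl)
    refine (finite_zeros_shear hv).subset ?_
    rintro s ⟨q, w, hw, hlw, hs⟩
    have h1 : p + (1 : ℝ) • v ∈ ln q w := by
      rw [← hlw]
      exact add_smul_mem_ln _ _ _
    have h2 : p ∈ ln q w := by
      rw [← hlw]
      exact self_mem_ln _ _
    obtain ⟨t, ht⟩ := mem_ln.1 h1
    obtain ⟨t', ht'⟩ := mem_ln.1 h2
    have hvw : v = (t - t') • w := by
      have : v = (p + (1 : ℝ) • v) - p := by simp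
      rw [this, ht]
      nth_rewrite 1 [ht']
      module
    change v 0 + s * v 1 + s ^ 3 * v 2 = 0
    rw [hvw]
    simp only [Pi.smul_apply, smul_eq_mul]
    linear_combination (t - t') * hs
  obtain ⟨s, hs1, hs2, hs3⟩ : ∃ s : ℝ, pderiv 2 (Ψ s φ) ≠ 0 ∧
      (∀ l ∈ L, ∀ p v, v ≠ 0 → l = ln p v → v 0 + s * v 1 + s ^ 3 * v 2 ≠ 0) ∧
      (¬ Ψ s φ ∣ qa2 (Ψ s φ) ∨ ∀ x ∈ zset (Ψ s φ),
        eval x (qa2 (Ψ s φ)) = 0 ∧ eval x (qa1 (Ψ s φ)) = 0 ∧ eval x (qa0 (Ψ s φ)) = 0) := by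
    have hfin := hF1.finite.union hF2
    by_cases hbad : {s : ℝ | Ψ s φ ∣ qa2 (Ψ s φ)}.Finite
    · obtain ⟨s, hs⟩ := (hfin.union hbad).infinite_compl.nonempty
      simp only [Set.compl_union, Set.mem_inter_iff, Set.mem_compl_iff, Set.mem_iUnion] at hs
      refine ⟨s, hs.1.1, ?_, Or.inl hs.2⟩
      intro l hl p v hv hlv h0
      exact hs.1.2 ⟨l, hl, p, v, hv, hlv, h0⟩
    · obtain ⟨s, hs⟩ := hfin.infinite_compl.nonempty
      simp only [Set.compl_union, Set.mem_inter_iff, Set.mem_compl_iff, Set.mem_iUnion] at hs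
      refine ⟨s, hs.1, ?_, Or.inr ?_⟩
      · intro l hl p v hv hlv h0
        exact hs.2 ⟨l, hl, p, v, hv, hlv, h0⟩
      · intro x hx
        obtain ⟨e2, e1, e0⟩ := eval_qa_shear (φ := φ) (hΨ s) x
        rw [mem_zset, hΨ] at hx
        set y := shear s x with hy
        obtain ⟨k1, k2, k3, k4, k5, k6⟩ := coefficients_eq_zero hbad
          (a := hess φ y (tan0 φ y) (tan0 φ y)) (b := hess φ y (tan0 φ y) (tan1 φ y))
          (c := hess φ y (tan1 φ y) (tan1 φ y)) (d := hess φ y (tan0 φ y) (tan2 φ y))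
          (e := hess φ y (tan1 φ y) (tan2 φ y)) (f := hess φ y (tan2 φ y) (tan2 φ y)) (by
            intro r hr
            have h1 := (eval_qa_shear (φ := φ) (hΨ r) ((shear r).symm y)).1
            rw [LinearEquiv.apply_symm_apply] at h1
            rw [← h1]
            refine eval_eq_zero_of_dvd hr ?_
            rw [mem_zset, hΨ, LinearEquiv.apply_symm_apply]
            exact hx)
        rw [e2, e1, e0, k1, k2, k3, k4, k5, k6]
        simp
  obtain ⟨G', hG'⟩ := exists_lineControl_of_coordinates
    ((MulEquiv.irreducible_iff (Ψ s)).2 hφ) (by rw [hΨd]; exact hd) hs1 hs3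
    (L.image fun l => (shear s).symm '' l) (by
      intro l hl
      obtain ⟨l, hl', rfl⟩ := Finset.mem_image.1 hl
      obtain ⟨p, v, hv, rfl⟩ := isLine_iff.1 (hL l hl')
      have h1 := hs2 _ hl' p v hv rfl
      refine ⟨(shear s).symm p, (v 0 + s * v 1 + s ^ 3 * v 2)⁻¹ • (shear s).symm v, ?_, ?_⟩
      · rw [shear_symm_apply]
        simp [h1]
      · rw [image_ln, ln_smul (inv_ne_zero h1)])
  refine ⟨(Ψ s).symm G', LineControl.transport (hΨ s) (hΨd s) ?_⟩
  rw [AlgEquiv.apply_symm_apply]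
  exact hG'

/-! ### Reduction to a finite set of irreducible surfaces -/

/-- A finite set of pairwise non-associated irreducible polynomials. -/
def IrrFamily (Φ : Finset (MvPolynomial (Fin 3) ℝ)) : Prop :=
  (∀ φ ∈ Φ, Irreducible φ) ∧ ∀ φ ∈ Φ, ∀ ψ ∈ Φ, φ ∣ ψ → φ = ψ

lemma exists_irrFamily (f : MvPolynomial (Fin 3) ℝ) (hf : f ≠ 0) :
    ∃ Φ : Finset (MvPolynomial (Fin 3) ℝ), IrrFamily Φ ∧ (∀ φ ∈ Φ, φ ∣ f) ∧
      ∑ φ ∈ Φ, φ.totalDegree ≤ f.totalDegree ∧ zset f = zset (∏ φ ∈ Φ, φ) := by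
  induction f using WfDvdMonoid.induction_on_irreducible with
  | zero => exact absurd rfl hf
  | unit u hu =>
    refine ⟨∅, ⟨by simp, by simp⟩, by simp, by simp, ?_⟩
    ext x
    simp only [mem_zset, Finset.prod_empty, map_one, one_ne_zero, iff_false]
    exact (hu.map (eval x)).ne_zero
  | mul a p ha hp ih =>
    obtain ⟨Φ, ⟨h1, h2⟩, h3, h4, h5⟩ := ih ha
    have hz : ∀ x, eval x a = 0 ↔ eval x (∏ φ ∈ Φ, φ) = 0 := fun x => by
      rw [← mem_zset, ← mem_zset, h5]
    have hdeg : (p * a).totalDegree = p.totalDegree + a.totalDegree :=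
      totalDegree_mul_of_isDomain hp.ne_zero ha
    by_cases hex : ∃ φ ∈ Φ, p ∣ φ
    · obtain ⟨φ, hφ, hpφ⟩ := hex
      refine ⟨Φ, ⟨h1, h2⟩, fun ψ hψ => (h3 ψ hψ).mul_left _, by omega, ?_⟩
      rw [← h5]
      ext x
      simp only [mem_zset, map_mul, mul_eq_zero, or_iff_right_iff_imp]
      intro hx
      rw [hz, map_prod]
      exact Finset.prod_eq_zero hφ (eval_eq_zero_of_dvd hpφ hx)
    · push Not at hex
      have hpΦ : p ∉ Φ := fun h => hex p h dvd_rfl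
      refine ⟨insert p Φ, ⟨?_, ?_⟩, ?_, ?_, ?_⟩
      · intro φ hφ
        rcases Finset.mem_insert.1 hφ with rfl | h
        exacts [hp, h1 φ h]
      · intro φ hφ ψ hψ hd
        rcases Finset.mem_insert.1 hφ with rfl | h <;> rcases Finset.mem_insert.1 hψ with rfl | h'
        · rfl
        · exact absurd hd (hex ψ h')
        · exact absurd ((h1 φ h).associated_of_dvd hp hd).symm.dvd (hex φ h)
        · exact h2 φ h ψ h' hd
      · intro φ hφ
        rcases Finset.mem_insert.1 hφ with rfl | h
        exacts [dvd_mul_right _ _, (h3 φ h).mul_left _]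
      · rw [Finset.sum_insert hpΦ]
        omega
      · ext x
        rw [Finset.prod_insert hpΦ, mem_zset, mem_zset, map_mul, map_mul, mul_eq_zero, mul_eq_zero,
          hz]

lemma totalDegree_prod_le {ι : Type*} (s : Finset ι) (g : ι → MvPolynomial (Fin 3) ℝ) :
    (∏ i ∈ s, g i).totalDegree ≤ ∑ i ∈ s, (g i).totalDegree :=
  totalDegree_finsetProd s g

/-- A good system of control polynomials for a family of irreducible surfaces: they are the
control polynomials of the components, multiplied with the other components. -/
structure FamilyControl (Φ : Finset (MvPolynomial (Fin 3) ℝ)) (L : Finset (Set (Fin 3 → ℝ)))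
    (G : MvPolynomial (Fin 3) ℝ → MvPolynomial (Fin 3) ℝ) : Prop where
  degree_le : ∀ φ ∈ Φ, 2 ≤ φ.totalDegree → (G φ).totalDegree ≤ 27 * ∑ ψ ∈ Φ, ψ.totalDegree
  not_dvd : ∀ φ ∈ Φ, 2 ≤ φ.totalDegree → ¬ φ ∣ G φ
  sheet : ∀ φ ∈ Φ, 2 ≤ φ.totalDegree → ∀ l ∈ L, l ⊆ zset φ → ¬ l ⊆ zset (G φ) → Sheet φ l
  triple : ∀ φ ∈ Φ, 2 ≤ φ.totalDegree → ∀ p ∈ zset φ, TriplePoint (∏ ψ ∈ Φ, ψ) p →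
    eval p (G φ) = 0

lemma exists_subset_zset {Φ : Finset (MvPolynomial (Fin 3) ℝ)} {l : Set (Fin 3 → ℝ)}
    (hl : IsLine l) (h : l ⊆ zset (∏ ψ ∈ Φ, ψ)) : ∃ φ ∈ Φ, l ⊆ zset φ :=
  (subset_zset_prod hl).1 h

lemma exists_familyControl {Φ : Finset (MvPolynomial (Fin 3) ℝ)} (hΦ : IrrFamily Φ)
    (L : Finset (Set (Fin 3 → ℝ))) (hL : ∀ l ∈ L, IsLine l) : ∃ G, FamilyControl Φ L G := by
  have h : ∀ φ, φ ∈ Φ → 2 ≤ φ.totalDegree → ∃ G, LineControl φ L G :=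
    fun φ hφ hd => exists_lineControl (hΦ.1 φ hφ) hd L hL
  choose! G₀ hG₀ using h
  refine ⟨fun φ => G₀ φ * ∏ ψ ∈ Φ.erase φ, ψ, ?_, ?_, ?_, ?_⟩
  · intro φ hφ hd
    have h1 := (hG₀ φ hφ hd).degree_le
    have h2 := totalDegree_prod_le (Φ.erase φ) fun ψ => ψ
    have h3 := Finset.add_sum_erase Φ (fun ψ => ψ.totalDegree) hφ
    refine (totalDegree_mul _ _).trans ?_
    omega
  · intro φ hφ hd h
    rcases (hΦ.1 φ hφ).prime.dvd_or_dvd h with h | h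
    · exact (hG₀ φ hφ hd).not_dvd h
    · obtain ⟨ψ, hψ, hdvd⟩ := (hΦ.1 φ hφ).prime.exists_mem_finset_dvd h
      rw [Finset.mem_erase] at hψ
      exact hψ.1 (hΦ.2 φ hφ ψ hψ.2 hdvd).symm
  · intro φ hφ hd l hl hlφ hlG
    refine (hG₀ φ hφ hd).sheet l hl hlφ fun h => hlG fun x hx => ?_
    rw [mem_zset, map_mul, mem_zset.1 (h hx), zero_mul]
  · rintro φ hφ hd p hp ⟨l₁, l₂, l₃, i1, i2, i3, n1, n2, n3, m1, m2, m3, s1, s2, s3⟩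
    rw [map_mul]
    by_cases hother : ∃ ψ ∈ Φ.erase φ, p ∈ zset ψ
    · obtain ⟨ψ, hψ, hpψ⟩ := hother
      rw [map_prod, Finset.prod_eq_zero hψ hpψ, mul_zero]
    · have key : ∀ l, IsLine l → p ∈ l → l ⊆ zset (∏ ψ ∈ Φ, ψ) → l ⊆ zset φ := by
        intro l hl hpl hlΦ
        obtain ⟨ψ, hψ, hlψ⟩ := exists_subset_zset hl hlΦ
        by_cases hψφ : ψ = φ
        · rwa [← hψφ]
        · exact absurd ⟨ψ, Finset.mem_erase.2 ⟨hψφ, hψ⟩, hlψ hpl⟩ hother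
      rw [(hG₀ φ hφ hd).triple p ⟨l₁, l₂, l₃, i1, i2, i3, n1, n2, n3, m1, m2, m3,
        key _ i1 m1 s1, key _ i2 m2 s2, key _ i3 m3 s3⟩, zero_mul]

/-- Lines of `L` on a nonplanar component not avoiding its control polynomial. -/
noncomputable def badLines (Φ : Finset (MvPolynomial (Fin 3) ℝ)) (L : Finset (Set (Fin 3 → ℝ)))
    (G : MvPolynomial (Fin 3) ℝ → MvPolynomial (Fin 3) ℝ) : Finset (Set (Fin 3 → ℝ)) :=
  L.filter fun l => ∃ φ ∈ Φ, 2 ≤ φ.totalDegree ∧ l ⊆ zset φ ∧ l ⊆ zset (G φ)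

lemma card_badLines_le {Φ : Finset (MvPolynomial (Fin 3) ℝ)} (hΦ : IrrFamily Φ)
    {L : Finset (Set (Fin 3 → ℝ))} (hL : ∀ l ∈ L, IsLine l)
    {G : MvPolynomial (Fin 3) ℝ → MvPolynomial (Fin 3) ℝ} (hG : FamilyControl Φ L G) {d : ℕ}
    (hd : ∑ φ ∈ Φ, φ.totalDegree ≤ d) : (badLines Φ L G).card ≤ d * (54 * d + 1) := by
  have hsub : badLines Φ L G ⊆ Φ.biUnion fun φ =>
      L.filter fun l => 2 ≤ φ.totalDegree ∧ l ⊆ zset φ ∧ l ⊆ zset (G φ) := by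
    intro l hl
    obtain ⟨hl, φ, hφ, h⟩ := Finset.mem_filter.1 hl
    exact Finset.mem_biUnion.2 ⟨φ, hφ, Finset.mem_filter.2 ⟨hl, h⟩⟩
  refine (Finset.card_le_card hsub).trans (Finset.card_biUnion_le.trans ?_)
  calc _ ≤ ∑ φ ∈ Φ, φ.totalDegree * (54 * d + 1) := ?_
    _ = (∑ φ ∈ Φ, φ.totalDegree) * (54 * d + 1) := by rw [Finset.sum_mul]
    _ ≤ _ := Nat.mul_le_mul_right _ hd
  refine Finset.sum_le_sum fun φ hφ => ?_
  by_cases h2 : 2 ≤ φ.totalDegree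
  · refine (card_common_lines_le φ (G φ) (hΦ.1 φ hφ) (hG.not_dvd φ hφ h2) _ ?_).trans ?_
    · intro l hl
      obtain ⟨hl, -, h1, h3⟩ := Finset.mem_filter.1 hl
      exact ⟨hL l hl, h1, h3⟩
    · have := hG.degree_le φ hφ h2
      exact Nat.mul_le_mul_left _ (by omega)
  · simp [h2]

lemma card_triple_le {Φ : Finset (MvPolynomial (Fin 3) ℝ)}
    {L : Finset (Set (Fin 3 → ℝ))} (hL : ∀ l ∈ L, IsLine l)
    {G : MvPolynomial (Fin 3) ℝ → MvPolynomial (Fin 3) ℝ} (hG : FamilyControl Φ L G)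
    {φ : MvPolynomial (Fin 3) ℝ} (hφ : φ ∈ Φ) (h2 : 2 ≤ φ.totalDegree)
    {l : Set (Fin 3 → ℝ)} (hl : l ∈ L) (hlφ : l ⊆ zset φ) (hlG : ¬ l ⊆ zset (G φ))
    (S : Finset (Fin 3 → ℝ)) (hS : ∀ p ∈ S, p ∈ l ∧ TriplePoint (∏ ψ ∈ Φ, ψ) p) :
    S.card ≤ 27 * ∑ ψ ∈ Φ, ψ.totalDegree :=
  (card_points_on_line_le (hL l hl) hlG S fun p hp =>
    ⟨(hS p hp).1, hG.triple φ hφ h2 p (hlφ (hS p hp).1) (hS p hp).2⟩).trans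
    (hG.degree_le φ hφ h2)

/-! ### Sheets crossing a line -/

/-- A continuous function which is not locally constant at `0` covers one side of its value. -/
lemma exists_side {h : ℝ → ℝ} {δ : ℝ} (hh : ContinuousOn h (Set.Ioo (-δ) δ))
    (hne : ∃ t ∈ Set.Ioo (-δ) δ, h t ≠ h 0) :
    ∃ σ : ℝ, (σ = 1 ∨ σ = -1) ∧ ∃ η > 0, ∀ r, 0 < r → r < η →
      ∃ t ∈ Set.Ioo (-δ) δ, h t = h 0 + σ * r := by
  obtain ⟨t₀, ht₀, hne⟩ := hne
  have h0 : (0 : ℝ) ∈ Set.Ioo (-δ) δ := ⟨by linarith [ht₀.1, ht₀.2], by linarith [ht₀.1, ht₀.2]⟩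
  have hsub : Set.uIcc 0 t₀ ⊆ Set.Ioo (-δ) δ := by
    intro t ht
    rcases Set.mem_uIcc.1 ht with h | h
    · exact ⟨by linarith [h0.1, h.1], by linarith [ht₀.2, h.2]⟩
    · exact ⟨by linarith [ht₀.1, h.1], by linarith [h0.2, h.2]⟩
  have hivt := intermediate_value_uIcc (hh.mono hsub)
  rcases lt_or_gt_of_ne hne with hlt | hgt
  · refine ⟨-1, Or.inr rfl, h 0 - h t₀, by linarith, fun r hr hr' => ?_⟩
    obtain ⟨t, ht, hte⟩ := hivt (Set.mem_uIcc.2 (Or.inr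
      (⟨by linarith, by linarith⟩ : h t₀ ≤ h 0 + -1 * r ∧ h 0 + -1 * r ≤ h 0)))
    exact ⟨t, hsub ht, hte⟩
  · refine ⟨1, Or.inl rfl, h t₀ - h 0, by linarith, fun r hr hr' => ?_⟩
    obtain ⟨t, ht, hte⟩ := hivt (Set.mem_uIcc.2 (Or.inl
      (⟨by linarith, by linarith⟩ : h 0 ≤ h 0 + 1 * r ∧ h 0 + 1 * r ≤ h t₀)))
    exact ⟨t, hsub ht, hte⟩

lemma eq_smul_of_ln_eq {p q v v' : Fin 3 → ℝ} (h : ln p v = ln q v') : ∃ a : ℝ, v = a • v' := by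
  have h1 : p ∈ ln q v' := h ▸ self_mem_ln p v
  have h2 : p + (1 : ℝ) • v ∈ ln q v' := h ▸ add_smul_mem_ln p v 1
  obtain ⟨s, hs⟩ := h1
  obtain ⟨t, ht⟩ := h2
  refine ⟨t - s, ?_⟩
  rw [hs, one_smul, add_assoc] at ht
  have := add_left_cancel ht
  rw [sub_smul, ← this]
  simp

/-- A sheet parametrized by its intersection with a transversal plane. -/
structure NormalSheet (φ : MvPolynomial (Fin 3) ℝ) (κ : (Fin 3 → ℝ) →ₗ[ℝ] ℝ) (p : Fin 3 → ℝ)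
    (l : Set (Fin 3 → ℝ)) (ε : ℝ) (z v : ℝ → Fin 3 → ℝ) : Prop where
  pos : 0 < ε
  cont_z : ContinuousOn z (Set.Ioo (-ε) ε)
  cont_v : ContinuousOn v (Set.Ioo (-ε) ε)
  map_v : ∀ t ∈ Set.Ioo (-ε) ε, κ (v t) = 1
  map_z : ∀ t ∈ Set.Ioo (-ε) ε, κ (z t) = κ p
  inj : Set.InjOn (fun t => ln (z t) (v t)) (Set.Ioo (-ε) ε)
  subset : ∀ t ∈ Set.Ioo (-ε) ε, ln (z t) (v t) ⊆ zset φ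
  z_zero : z 0 = p
  line : ln p (v 0) = l

lemma Sheet.exists_normalSheet {φ : MvPolynomial (Fin 3) ℝ} {l : Set (Fin 3 → ℝ)} (h : Sheet φ l)
    (κ : (Fin 3 → ℝ) →ₗ[ℝ] ℝ) {p v₀ : Fin 3 → ℝ} (hl : l = ln p v₀) (hκ : κ v₀ ≠ 0) :
    ∃ ε z v, NormalSheet φ κ p l ε z v := by
  obtain ⟨ε, hε, q, v, hq, hv, hv0, hinj, hsub, h0⟩ := h
  have hκc : Continuous κ := κ.continuous_of_finiteDimensional
  have m0 : (0 : ℝ) ∈ Set.Ioo (-ε) ε := ⟨by linarith, hε⟩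
  have hκ0 : κ (v 0) ≠ 0 := by
    obtain ⟨a, ha⟩ := eq_smul_of_ln_eq (h0.trans hl)
    rw [ha, map_smul, smul_eq_mul]
    refine mul_ne_zero (fun h => hv0 0 m0 ?_) hκ
    rw [ha, h, zero_smul]
  have hev : ∀ᶠ t in nhds (0 : ℝ), t ∈ Set.Ioo (-ε) ε ∧ κ (v t) ≠ 0 := by
    have hc : ContinuousAt (fun t => κ (v t)) 0 :=
      hκc.continuousAt.comp (hv.continuousAt (isOpen_Ioo.mem_nhds m0))
    exact (isOpen_Ioo.mem_nhds m0 |> Filter.Eventually.and <| hc.eventually_ne hκ0)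
  obtain ⟨δ, hδ, hδ'⟩ := Metric.eventually_nhds_iff.1 hev
  have hmem : ∀ t ∈ Set.Ioo (-δ) δ, t ∈ Set.Ioo (-ε) ε ∧ κ (v t) ≠ 0 := fun t ht =>
    hδ' (by rw [Real.dist_eq, sub_zero]; exact abs_lt.2 ht)
  have hsubI : Set.Ioo (-δ) δ ⊆ Set.Ioo (-ε) ε := fun t ht => (hmem t ht).1
  have hline : ∀ t ∈ Set.Ioo (-δ) δ,
      ln (q t + (κ p - κ (q t)) • (κ (v t))⁻¹ • v t) ((κ (v t))⁻¹ • v t) = ln (q t) (v t) := by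
    intro t ht
    rw [ln_smul (inv_ne_zero (hmem t ht).2), smul_smul]
    exact (ln_eq_of_mem (add_smul_mem_ln _ _ _)).symm
  have hcv : ContinuousOn (fun t => (κ (v t))⁻¹ • v t) (Set.Ioo (-δ) δ) :=
    ((hκc.comp_continuousOn (hv.mono hsubI)).inv₀ fun t ht => (hmem t ht).2).smul (hv.mono hsubI)
  have mδ : (0 : ℝ) ∈ Set.Ioo (-δ) δ := ⟨by linarith, hδ⟩
  have hz0 : q 0 + (κ p - κ (q 0)) • (κ (v 0))⁻¹ • v 0 = p := by
    have : p ∈ ln (q 0) (v 0) := by rw [h0, hl]; exact self_mem_ln _ _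
    obtain ⟨s, hs⟩ := this
    rw [hs, map_add, map_smul, add_sub_cancel_left, smul_smul, smul_eq_mul, mul_assoc,
      mul_inv_cancel₀ hκ0, mul_one]
  refine ⟨δ, fun t => q t + (κ p - κ (q t)) • (κ (v t))⁻¹ • v t, fun t => (κ (v t))⁻¹ • v t,
    hδ, ?_, hcv, ?_, ?_, ?_, ?_, hz0, ?_⟩
  · exact (hq.mono hsubI).add
      ((continuousOn_const.sub (hκc.comp_continuousOn (hq.mono hsubI))).smul hcv)
  · intro t ht
    simp [(hmem t ht).2]
  · intro t ht
    simp [(hmem t ht).2]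
  · intro t ht t' ht' h
    simp only [hline t ht, hline t' ht'] at h
    exact hinj (hsubI ht) (hsubI ht') h
  · intro t ht
    rw [hline t ht]
    exact hsub t (hsubI ht)
  · have := hline 0 mδ
    rw [hz0] at this
    rw [this, h0]

/-- Finitely many curves with distinct starting points stay disjoint for a short time. -/
lemma exists_separation {ι X : Type*} [TopologicalSpace X] [T2Space X] (J : Finset ι)
    (F : ι → ℝ → X) (hF : ∀ j ∈ J, ContinuousAt (F j) 0)
    (hinj : ∀ j ∈ J, ∀ k ∈ J, F j 0 = F k 0 → j = k) (A : ι → ℝ → Prop)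
    (hA : ∀ j ∈ J, ∀ᶠ t in nhds 0, A j t) :
    ∃ δ > 0, (∀ j ∈ J, ∀ t ∈ Set.Ioo (-δ) δ, A j t) ∧
      ∀ j ∈ J, ∀ k ∈ J, ∀ s ∈ Set.Ioo (-δ) δ, ∀ t ∈ Set.Ioo (-δ) δ, F j s = F k t → j = k := by
  obtain ⟨U, hU, hdis⟩ := (J.image fun j => F j 0).finite_toSet.t2_separation
  have hev : ∀ᶠ t in nhds (0 : ℝ), ∀ j ∈ J, A j t ∧ F j t ∈ U (F j 0) :=
    (Filter.eventually_all_finset J).2 fun j hj => (hA j hj).and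
      ((hF j hj).eventually ((hU _).2.mem_nhds (hU _).1))
  obtain ⟨δ, hδ, hδ'⟩ := Metric.eventually_nhds_iff.1 hev
  have hmem : ∀ t ∈ Set.Ioo (-δ) δ, ∀ j ∈ J, A j t ∧ F j t ∈ U (F j 0) := fun t ht =>
    hδ' (by rw [Real.dist_eq, sub_zero]; exact abs_lt.2 ht)
  refine ⟨δ, hδ, fun j hj t ht => (hmem t ht j hj).1, fun j hj k hk s hs t ht h => ?_⟩
  by_contra hne
  have hd := hdis (Finset.mem_coe.2 (Finset.mem_image_of_mem _ hj))
    (Finset.mem_coe.2 (Finset.mem_image_of_mem _ hk)) fun h => hne (hinj j hj k hk h)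
  exact Set.disjoint_left.1 hd (hmem s hs j hj).2 (h ▸ (hmem t ht k hk).2)

/-- The coefficient vector of a linear functional. -/
lemma functional_apply (f : (Fin 3 → ℝ) →ₗ[ℝ] ℝ) (x : Fin 3 → ℝ) :
    ∑ i, f (Pi.single i 1) * x i = f x := by
  rw [LinearMap.pi_apply_eq_sum_univ f x]
  refine Finset.sum_congr rfl fun i _ => ?_
  rw [smul_eq_mul, mul_comm]
  congr 2
  ext j
  simp [Pi.single_apply, eq_comm]

lemma functional_coeff_ne_zero {f : (Fin 3 → ℝ) →ₗ[ℝ] ℝ} (hf : f ≠ 0) :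
    (fun i => f (Pi.single i 1)) ≠ 0 := by
  intro h
  apply hf
  ext i
  simpa using congrFun h i

/-- A generic plane through a line. -/
lemma exists_transversal {ι : Type*} (J : Finset ι) (v : ι → Fin 3 → ℝ) {w : Fin 3 → ℝ}
    (hw : w ≠ 0) (hv : ∀ j ∈ J, ∀ a : ℝ, v j ≠ a • w) (x₀ : Fin 3 → ℝ)
    (Q : MvPolynomial (Fin 3) ℝ) (hQ : Q ≠ 0) :
    ∃ b : Module.Basis (Fin 3) ℝ (Fin 3 → ℝ), b 0 = w ∧ eval (x₀ + b 1) Q ≠ 0 ∧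
      ∀ j ∈ J, b.coord 2 (v j) ≠ 0 := by
  have hfun : ∀ a : Fin 3 → ℝ, ∃ f : (Fin 3 → ℝ) →ₗ[ℝ] ℝ, f ≠ 0 ∧ f w = 0 ∧ f a = 0 := by
    intro a
    obtain ⟨f, hf, hle⟩ := Submodule.exists_le_ker_of_lt_top _ (span_pair_ne_top w a).lt_top
    exact ⟨f, hf, hle (Submodule.subset_span (by simp)), hle (Submodule.subset_span (by simp))⟩
  choose f hf0 hfw hfa using hfun
  have hlin : ∀ (a x : Fin 3 → ℝ), eval x (linPoly (fun i => f a (Pi.single i 1)) (f a x₀)) =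
      f a (x - x₀) := by
    intro a x
    rw [eval_linPoly, functional_apply, map_sub]
  have hne : ∀ a, linPoly (fun i => f a (Pi.single i 1)) (f a x₀) ≠ 0 := by
    intro a h
    apply hf0 a
    ext i
    have := hlin a (x₀ + Pi.single i 1)
    rw [h, map_zero, add_sub_cancel_left] at this
    simpa using this.symm
  obtain ⟨y, hy⟩ := exists_eval_ne_zero (mul_ne_zero (mul_ne_zero hQ (hne w))
    (Finset.prod_ne_zero_iff.2 fun j (_ : j ∈ J) => hne (v j)))
  rw [map_mul, map_mul, map_prod, mul_ne_zero_iff, mul_ne_zero_iff, Finset.prod_ne_zero_iff] at hy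
  obtain ⟨⟨hyQ, hyw⟩, hyv⟩ := hy
  rw [hlin] at hyw
  simp only [hlin] at hyv
  set e := y - x₀ with he
  have hind : LinearIndependent ℝ ![w, e] := by
    rw [LinearIndependent.pair_iff]
    intro s t hst
    have ht : t = 0 := by
      have := congrArg (f w) hst
      rw [map_add, map_smul, map_smul, hfw, smul_zero, zero_add, map_zero, smul_eq_mul] at this
      exact (mul_eq_zero.1 this).resolve_right hyw
    rw [ht, zero_smul, add_zero] at hst
    exact ⟨(smul_eq_zero.1 hst).resolve_right hw, ht⟩
  obtain ⟨u, -, hu⟩ := SetLike.exists_of_lt (span_pair_ne_top w e).lt_top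
  have hind3 : LinearIndependent ℝ ![w, e, u] := by
    have : LinearIndependent ℝ (Fin.snoc ![w, e] u : Fin 3 → Fin 3 → ℝ) := by
      rw [linearIndependent_finSnoc]
      refine ⟨hind, ?_⟩
      rw [Set.pair_comm] at hu
      simpa [Matrix.range_cons, Matrix.range_empty] using hu
    convert this using 1
    ext i
    fin_cases i <;> rfl
  let b := basisOfLinearIndependentOfCardEqFinrank hind3 (by simp)
  have hb : ∀ i, b i = ![w, e, u] i := fun i => by
    simp only [b, coe_basisOfLinearIndependentOfCardEqFinrank]
  refine ⟨b, hb 0, ?_, ?_⟩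
  · rw [hb 1]
    have : x₀ + ![w, e, u] 1 = y := by simp [he]
    rwa [this]
  · intro j hj h
    have hrep := b.sum_repr (v j)
    rw [Module.Basis.coord_apply] at h
    rw [Fin.sum_univ_three, h, zero_smul, add_zero, hb 0, hb 1] at hrep
    simp only [Matrix.cons_val_zero, Matrix.cons_val_one] at hrep
    have h1 := congrArg (f (v j)) hrep
    rw [map_add, map_smul, map_smul, hfw, smul_zero, zero_add, hfa, smul_eq_mul] at h1
    have h2 := (mul_eq_zero.1 h1).resolve_right (hyv j hj)
    rw [h2, zero_smul, add_zero] at hrep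
    exact hv j hj _ hrep.symm

lemma finite_zeros_along {x₀ e : Fin 3 → ℝ} {Q : MvPolynomial (Fin 3) ℝ}
    (h : eval (x₀ + e) Q ≠ 0) : {c : ℝ | eval (x₀ + c • e) Q = 0}.Finite := by
  have hne : restr x₀ e Q ≠ 0 := by
    intro h0
    apply h
    have := eval_restr x₀ e Q 1
    rw [h0] at this
    simpa using this.symm
  refine (restr x₀ e Q).rootSet_finite ℝ |>.subset fun c hc => ?_
  rw [Polynomial.mem_rootSet]
  refine ⟨hne, ?_⟩
  rw [Polynomial.coe_aeval_eq_eval, eval_restr]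
  exact hc

lemma finite_parallel_lines {φ : MvPolynomial (Fin 3) ℝ} (hφ : Irreducible φ)
    (hd : 2 ≤ φ.totalDegree) (b : Module.Basis (Fin 3) ℝ (Fin 3 → ℝ)) (x₀ : Fin 3 → ℝ) :
    {c : ℝ | ln (x₀ + c • b 1) (b 0) ⊆ zset φ}.Finite := by
  have hk : b.coord 2 ≠ 0 := fun h => by
    have := congrArg (fun f => f (b 2)) h
    simp at this
  have hfin := finite_lines_in_plane hφ hd (functional_coeff_ne_zero hk) (b.coord 2 x₀)
  refine Set.Finite.of_finite_image (f := fun c : ℝ => ln (x₀ + c • b 1) (b 0))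
    (hfin.subset ?_) ?_
  · rintro _ ⟨c, hc, rfl⟩
    refine ⟨isLine_ln (b.ne_zero 0), hc, ?_⟩
    rintro x ⟨t, rfl⟩
    rw [functional_apply, map_add, map_add, map_smul, map_smul]
    simp
  · intro c _ c' _ h
    have : x₀ + c • b 1 ∈ ln (x₀ + c' • b 1) (b 0) := by
      rw [← show ln (x₀ + c • b 1) (b 0) = ln (x₀ + c' • b 1) (b 0) from h]
      exact self_mem_ln _ _
    obtain ⟨t, ht⟩ := this
    have := congrArg (b.coord 1) ht
    simpa using this

lemma zset_subset_zset_prod {Φ : Finset (MvPolynomial (Fin 3) ℝ)} {φ : MvPolynomial (Fin 3) ℝ}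
    (hφ : φ ∈ Φ) : zset φ ⊆ zset (∏ ψ ∈ Φ, ψ) := fun x hx => by
  rw [mem_zset, map_prod]
  exact Finset.prod_eq_zero hφ hx

lemma ln_ne_ln {κ : (Fin 3 → ℝ) →ₗ[ℝ] ℝ} {z v v' : Fin 3 → ℝ} (hv : κ v = 1) (hv' : κ v' = 1)
    (h : v ≠ v') : ln z v ≠ ln z v' := by
  intro he
  obtain ⟨a, ha⟩ := eq_smul_of_ln_eq he
  apply h
  have := congrArg κ ha
  rw [map_smul, hv, hv', smul_eq_mul, mul_one] at this
  rw [ha, ← this, one_smul]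

lemma ln_ne_ln_of_map_eq_zero {κ : (Fin 3 → ℝ) →ₗ[ℝ] ℝ} {z z' v w : Fin 3 → ℝ} (hv : κ v = 1)
    (hw : κ w = 0) : ln z v ≠ ln z' w := by
  intro he
  obtain ⟨a, ha⟩ := eq_smul_of_ln_eq he
  have := congrArg κ ha
  rw [map_smul, hv, hw, smul_zero] at this
  exact one_ne_zero this

lemma ne_zero_of_map_eq_one {κ : (Fin 3 → ℝ) →ₗ[ℝ] ℝ} {v : Fin 3 → ℝ} (hv : κ v = 1) : v ≠ 0 := by
  rintro rfl
  simp at hv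

/-- Two sheets cannot both sweep a segment of a line avoiding the control polynomial. -/
lemma no_double_cover {Φ : Finset (MvPolynomial (Fin 3) ℝ)} {L : Finset (Set (Fin 3 → ℝ))}
    {G : MvPolynomial (Fin 3) ℝ → MvPolynomial (Fin 3) ℝ} (hG : FamilyControl Φ L G)
    {φ : MvPolynomial (Fin 3) ℝ} (hφ : φ ∈ Φ) (h2 : 2 ≤ φ.totalDegree)
    {p w : Fin 3 → ℝ} (hw : w ≠ 0) (hlφ : ln p w ⊆ zset φ) (hlG : ¬ ln p w ⊆ zset (G φ))
    {κ : (Fin 3 → ℝ) →ₗ[ℝ] ℝ} (hκ : κ w = 0) {σ η : ℝ} (hσ : σ ≠ 0) (hη : 0 < η)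
    (h : ∀ r, 0 < r → r < η → ∃ v v', κ v = 1 ∧ κ v' = 1 ∧ v ≠ v' ∧
      ln (p + (σ * r) • w) v ⊆ zset (∏ ψ ∈ Φ, ψ) ∧ ln (p + (σ * r) • w) v' ⊆ zset (∏ ψ ∈ Φ, ψ)) :
    False := by
  obtain ⟨S, hS, hcard⟩ := (Set.Ioo_infinite hη).exists_subset_card_eq ((G φ).totalDegree + 1)
  have hinj : Function.Injective fun r : ℝ => p + (σ * r) • w := by
    intro r r' hr
    exact mul_left_cancel₀ hσ (smul_left_injective ℝ hw (add_left_cancel hr))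
  have := card_points_on_line_le (isLine_ln hw) hlG (S.image fun r => p + (σ * r) • w) ?_
  · rw [Finset.card_image_of_injective _ hinj, hcard] at this
    omega
  · intro x hx
    obtain ⟨r, hr, rfl⟩ := Finset.mem_image.1 hx
    obtain ⟨hr0, hr1⟩ := hS hr
    obtain ⟨v, v', hv, hv', hne, hs, hs'⟩ := h r hr0 hr1
    have hmem : p + (σ * r) • w ∈ ln p w := add_smul_mem_ln _ _ _
    refine ⟨hmem, hG.triple φ hφ h2 _ (hlφ hmem) ⟨ln p w, ln _ v, ln _ v', isLine_ln hw,
      isLine_ln (ne_zero_of_map_eq_one hv), isLine_ln (ne_zero_of_map_eq_one hv'),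
      (ln_ne_ln_of_map_eq_zero hv hκ).symm, (ln_ne_ln_of_map_eq_zero hv' hκ).symm,
      ln_ne_ln hv hv' hne, hmem, self_mem_ln _ _, self_mem_ln _ _,
      hlφ.trans (zset_subset_zset_prod hφ), hs, hs'⟩⟩

/-- A line avoiding the triple points of a surface of degree `d` meets at most `2 d` of the lines
on it. -/
lemma card_crossings_le {Φ : Finset (MvPolynomial (Fin 3) ℝ)} {L : Finset (Set (Fin 3 → ℝ))}
    {G : MvPolynomial (Fin 3) ℝ → MvPolynomial (Fin 3) ℝ} (hG : FamilyControl Φ L G)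
    (h2 : ∀ φ ∈ Φ, 2 ≤ φ.totalDegree) {y w : Fin 3 → ℝ} (hw : w ≠ 0)
    (hy : ¬ ln y w ⊆ zset (∏ ψ ∈ Φ, ψ))
    (hyG : ∀ φ ∈ Φ, ∀ x ∈ ln y w, eval x φ = 0 → eval x (G φ) ≠ 0)
    {κ : (Fin 3 → ℝ) →ₗ[ℝ] ℝ} {ι : Type*} (J : Finset ι) (ψ : ι → MvPolynomial (Fin 3) ℝ)
    (z v : ι → Fin 3 → ℝ) (hψ : ∀ j ∈ J, ψ j ∈ Φ) (hz : ∀ j ∈ J, z j ∈ ln y w)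
    (hv : ∀ j ∈ J, κ (v j) = 1) (hs : ∀ j ∈ J, ln (z j) (v j) ⊆ zset (ψ j))
    (hinj : ∀ j ∈ J, ∀ k ∈ J, z j = z k → v j = v k → j = k) :
    J.card ≤ 2 * ∑ φ ∈ Φ, φ.totalDegree := by
  have hle : J.card ≤ 2 * (J.image z).card := by
    refine Finset.card_le_mul_card_image J 2 fun x _ => ?_
    by_contra! hlt
    obtain ⟨i, j, k, hi, hj, hk, hij, hik, hjk⟩ := Finset.two_lt_card_iff.1 hlt
    rw [Finset.mem_filter] at hi hj hk
    have hne : ∀ a b, a ∈ J ∧ z a = x → b ∈ J ∧ z b = x → a ≠ b → ln x (v a) ≠ ln x (v b) :=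
      fun a b ha hb hab => ln_ne_ln (hv a ha.1) (hv b hb.1)
        fun h => hab (hinj a ha.1 b hb.1 (ha.2.trans hb.2.symm) h)
    have hl : ∀ a, a ∈ J ∧ z a = x → IsLine (ln x (v a)) := fun a ha =>
      isLine_ln (ne_zero_of_map_eq_one (hv a ha.1))
    have hsub : ∀ a, a ∈ J ∧ z a = x → ln x (v a) ⊆ zset (ψ a) := fun a ha =>
      ha.2 ▸ hs a ha.1
    have hx : x ∈ zset (ψ i) := hsub i hi (self_mem_ln _ _)
    have hF : ∀ a, a ∈ J ∧ z a = x → ln x (v a) ⊆ zset (∏ φ ∈ Φ, φ) := fun a ha =>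
      (hsub a ha).trans (zset_subset_zset_prod (hψ a ha.1))
    exact hyG _ (hψ i hi.1) x (hi.2 ▸ hz i hi.1) hx (hG.triple _ (hψ i hi.1) (h2 _ (hψ i hi.1)) x hx
      ⟨_, _, _, hl i hi, hl j hj, hl k hk, hne i j hi hj hij, hne i k hi hk hik,
        hne j k hj hk hjk, self_mem_ln _ _, self_mem_ln _ _, self_mem_ln _ _, hF i hi, hF j hj,
        hF k hk⟩)
  refine hle.trans (Nat.mul_le_mul_left _ ?_)
  refine (card_points_on_line_le (isLine_ln hw) hy _ ?_).trans (totalDegree_prod_le _ _)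
  intro x hx
  obtain ⟨j, hj, rfl⟩ := Finset.mem_image.1 hx
  exact ⟨hz j hj, zset_subset_zset_prod (hψ j hj) (hs j hj (self_mem_ln _ _))⟩

lemma exists_pos_le_forall {ι : Type*} (S : Finset ι) (η : ι → ℝ) (h : ∀ j ∈ S, 0 < η j) :
    ∃ r > 0, ∀ j ∈ S, r ≤ η j := by
  induction S using Finset.induction_on with
  | empty => exact ⟨1, one_pos, by simp⟩
  | insert a S _ ih =>
    obtain ⟨r, hr, hr'⟩ := ih fun j hj => h j (Finset.mem_insert_of_mem hj)
    refine ⟨min r (η a), lt_min hr (h a (Finset.mem_insert_self _ _)), fun j hj => ?_⟩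
    rcases Finset.mem_insert.1 hj with rfl | hj
    exacts [min_le_right _ _, (min_le_left _ _).trans (hr' j hj)]

lemma eq_add_of_coord_two {b : Module.Basis (Fin 3) ℝ (Fin 3 → ℝ)} {x x₀ : Fin 3 → ℝ}
    (h : b.coord 2 x = b.coord 2 x₀) :
    x = x₀ + b.coord 1 (x - x₀) • b 1 + b.coord 0 (x - x₀) • b 0 := by
  have h1 := b.sum_repr (x - x₀)
  have h2 : b.repr (x - x₀) 2 = 0 := by
    rw [← Module.Basis.coord_apply, map_sub, h, sub_self]
  rw [Fin.sum_univ_three, h2, zero_smul, add_zero] at h1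
  rw [Module.Basis.coord_apply, Module.Basis.coord_apply, add_assoc, add_comm (_ • b 1), h1]
  abel

/-- The lines with sheets crossing a fixed line: all but few of them touch the line, and only two
at each point. -/
lemma sheet_count {Φ : Finset (MvPolynomial (Fin 3) ℝ)} (hΦ : IrrFamily Φ)
    (h2 : ∀ φ ∈ Φ, 2 ≤ φ.totalDegree) {L : Finset (Set (Fin 3 → ℝ))}
    {G : MvPolynomial (Fin 3) ℝ → MvPolynomial (Fin 3) ℝ} (hG : FamilyControl Φ L G)
    {l : Set (Fin 3 → ℝ)} (hl : IsLine l) {φ₀ : MvPolynomial (Fin 3) ℝ} (hφ₀ : φ₀ ∈ Φ)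
    (hlφ : l ⊆ zset φ₀) (hlG : ¬ l ⊆ zset (G φ₀))
    (J : Finset ((Fin 3 → ℝ) × Set (Fin 3 → ℝ)))
    (ψ : Set (Fin 3 → ℝ) → MvPolynomial (Fin 3) ℝ)
    (hJ : ∀ j ∈ J, j.1 ∈ l ∧ j.1 ∈ j.2 ∧ IsLine j.2 ∧ j.2 ≠ l)
    (hψ : ∀ j ∈ J, ψ j.2 ∈ Φ) (hsh : ∀ j ∈ J, Sheet (ψ j.2) j.2)
    (hapex : ∀ j ∈ J, {m | IsLine m ∧ m ⊆ zset (ψ j.2) ∧ j.1 ∈ m}.Finite) :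
    ∃ D ⊆ J, (J \ D).card ≤ 4 * ∑ φ ∈ Φ, φ.totalDegree ∧
      ∀ p, (D.filter fun j => j.1 = p).card ≤ 2 := by
  obtain ⟨x₀, w, hw, rfl⟩ := isLine_iff.1 hl
  have hR : ∀ φ, φ ∈ Φ → ∃ R : MvPolynomial (Fin 3) ℝ, R ≠ 0 ∧
      (∀ x, ∀ s : ℝ, eval (x + s • w) R = eval x R) ∧
      ∀ x, eval x φ = 0 → eval x (G φ) = 0 → eval x R = 0 := by
    intro φ hφ
    obtain ⟨R, h0, -, h⟩ := exists_elimination_along φ (G φ) (hΦ.1 φ hφ)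
      (hG.not_dvd φ hφ (h2 φ hφ)) w hw
    exact ⟨R, h0, h⟩
  choose! R hR0 hRw hRz using hR
  have hdir : ∀ j, j ∈ J → ∃ v : Fin 3 → ℝ, j.2 = ln j.1 v := by
    intro j hj
    obtain ⟨v, -, hv⟩ := IsLine.exists_eq_ln (hJ j hj).2.2.1 (hJ j hj).2.1
    exact ⟨v, hv⟩
  choose! v₀ hv₀ using hdir
  have hnw : ∀ j ∈ J, ∀ a : ℝ, v₀ j ≠ a • w := by
    intro j hj a ha
    obtain ⟨h1, -, h3, h4⟩ := hJ j hj
    have ha0 : a ≠ 0 := by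
      rintro rfl
      obtain ⟨v, hv, he⟩ := IsLine.exists_eq_ln h3 (hJ j hj).2.1
      obtain ⟨c, hc⟩ := eq_smul_of_ln_eq (he.symm.trans (hv₀ j hj))
      rw [ha, zero_smul, smul_zero] at hc
      exact hv hc
    apply h4
    rw [hv₀ j hj, ha, ln_smul ha0, ← ln_eq_of_mem h1]
  obtain ⟨b, hb0, hbQ, hbv⟩ := exists_transversal J v₀ hw hnw x₀ (∏ φ ∈ Φ, R φ)
    (Finset.prod_ne_zero_iff.2 hR0)
  rw [map_prod, Finset.prod_ne_zero_iff] at hbQ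
  have hN : ∀ j, j ∈ J → ∃ ε z v, NormalSheet (ψ j.2) (b.coord 2) j.1 j.2 ε z v := fun j hj =>
    Sheet.exists_normalSheet (hsh j hj) (b.coord 2) (hv₀ j hj) (hbv j hj)
  choose! ε z v hN using hN
  have hκw : b.coord 2 w = 0 := by rw [← hb0]; simp
  have hκj : ∀ j ∈ J, b.coord 2 j.1 = b.coord 2 x₀ := by
    intro j hj
    obtain ⟨t, ht⟩ := (hJ j hj).1
    rw [ht, map_add, map_smul, hκw, smul_zero, add_zero]
  have hc0 : ∀ j ∈ J, b.coord 1 (z j 0 - x₀) = 0 := by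
    intro j hj
    obtain ⟨t, ht⟩ := (hJ j hj).1
    rw [(hN j hj).z_zero, ht, ← hb0]
    simp
  set D := J.filter fun j => ∀ᶠ t in nhds (0 : ℝ), b.coord 1 (z j t - x₀) = 0 with hD
  have m0 : ∀ j ∈ J, Set.Ioo (-ε j) (ε j) ∈ nhds (0 : ℝ) := fun j hj =>
    isOpen_Ioo.mem_nhds ⟨by linarith [(hN j hj).pos], (hN j hj).pos⟩
  obtain ⟨δ, hδ, hδA, hsep⟩ := exists_separation J (fun j t => (z j t, v j t))
    (fun j hj => ((hN j hj).cont_z.continuousAt (m0 j hj)).prodMk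
      ((hN j hj).cont_v.continuousAt (m0 j hj)))
    (by
      intro j hj k hk h
      obtain ⟨h1, h3⟩ := Prod.mk.inj h
      rw [(hN j hj).z_zero, (hN k hk).z_zero] at h1
      refine Prod.ext h1 ?_
      rw [← (hN j hj).line, ← (hN k hk).line, h1, h3])
    (fun j t => t ∈ Set.Ioo (-ε j) (ε j) ∧ (j ∈ D → b.coord 1 (z j t - x₀) = 0))
    (by
      intro j hj
      by_cases hjD : j ∈ D
      · filter_upwards [m0 j hj, (Finset.mem_filter.1 hjD).2] with t h1 h3 using ⟨h1, fun _ => h3⟩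
      · filter_upwards [m0 j hj] with t h1 using ⟨h1, fun h => absurd h hjD⟩)
  have hsub : ∀ j ∈ J, Set.Ioo (-δ) δ ⊆ Set.Ioo (-ε j) (ε j) := fun j hj t ht => (hδA j hj t ht).1
  have hI0 : (0 : ℝ) ∈ Set.Ioo (-δ) δ := ⟨by linarith, hδ⟩
  have hzeq : ∀ j ∈ J, ∀ t ∈ Set.Ioo (-δ) δ,
      z j t = x₀ + b.coord 1 (z j t - x₀) • b 1 + b.coord 0 (z j t - x₀) • w := by
    intro j hj t ht
    conv_lhs => rw [eq_add_of_coord_two (((hN j hj).map_z t (hsub j hj ht)).trans (hκj j hj)), hb0]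
  have hcont : ∀ j ∈ J, ∀ i, ContinuousOn (fun t => b.coord i (z j t - x₀)) (Set.Ioo (-δ) δ) := by
    intro j hj i
    exact (b.coord i).continuous_of_finiteDimensional.comp_continuousOn
      (((hN j hj).cont_z.mono (hsub j hj)).sub continuousOn_const)
  refine ⟨D, Finset.filter_subset _ _, ?_, ?_⟩
  · -- sheets crossing the line
    have hside : ∀ j, j ∈ J \ D → ∃ σ : ℝ, (σ = 1 ∨ σ = -1) ∧ ∃ η > 0, ∀ r, 0 < r → r < η →
        ∃ t ∈ Set.Ioo (-δ) δ, b.coord 1 (z j t - x₀) = σ * r := by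
      intro j hj
      obtain ⟨hjJ, hjD⟩ := Finset.mem_sdiff.1 hj
      have := exists_side (hcont j hjJ 1) (by
        by_contra! hall
        refine hjD (Finset.mem_filter.2 ⟨hjJ, ?_⟩)
        filter_upwards [isOpen_Ioo.mem_nhds hI0] with t ht
        rw [hall t ht, hc0 j hjJ])
      simpa only [hc0 j hjJ, zero_add] using this
    choose! σ hσ η hη hcov using hside
    have key : ∀ s : ℝ, s ≠ 0 →
        ((J \ D).filter fun j => σ j = s).card ≤ 2 * ∑ φ ∈ Φ, φ.totalDegree := by
      intro s hs
      obtain ⟨r₀, hr₀, hr₀'⟩ := exists_pos_le_forall ((J \ D).filter fun j => σ j = s) η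
        fun j hj => hη j (Finset.mem_filter.1 hj).1
      have hfin : (⋃ φ ∈ Φ, ({c : ℝ | eval (x₀ + c • b 1) (R φ) = 0} ∪
          {c : ℝ | ln (x₀ + c • b 1) (b 0) ⊆ zset φ})).Finite :=
        Φ.finite_toSet.biUnion fun φ hφ => (finite_zeros_along (hbQ φ hφ)).union
          (finite_parallel_lines (hΦ.1 φ hφ) (h2 φ hφ) b x₀)
      obtain ⟨r, hr, hrb⟩ := ((Set.Ioo_infinite hr₀).sdiff
        (hfin.preimage (mul_right_injective₀ hs).injOn)).nonempty
      simp only [Set.mem_preimage, Set.mem_iUnion, not_exists] at hrb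
      have hcov' : ∀ j, j ∈ (J \ D).filter (fun j => σ j = s) →
          ∃ t ∈ Set.Ioo (-δ) δ, b.coord 1 (z j t - x₀) = s * r := by
        intro j hj
        obtain ⟨hj1, rfl⟩ := Finset.mem_filter.1 hj
        exact hcov j hj1 r hr.1 (hr.2.trans_le (hr₀' j hj))
      choose! τ hτ hτc using hcov'
      have hmem : ∀ j ∈ (J \ D).filter (fun j => σ j = s), j ∈ J := fun j hj =>
        (Finset.mem_sdiff.1 (Finset.mem_filter.1 hj).1).1
      refine card_crossings_le hG h2 hw (y := x₀ + (s * r) • b 1) (κ := b.coord 2) ?_ ?_ _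
        (fun j => ψ j.2) (fun j => z j (τ j)) (fun j => v j (τ j)) (fun j hj => hψ j (hmem j hj))
        ?_ ?_ ?_ ?_
      · intro hF
        obtain ⟨φ, hφ, h⟩ := exists_subset_zset (isLine_ln hw) hF
        exact hrb φ hφ (Or.inr (by rw [← hb0] at h; exact h))
      · rintro φ hφ x ⟨t, rfl⟩ hx hxG
        have := hRz φ hφ _ hx hxG
        rw [hRw φ hφ] at this
        exact hrb φ hφ (Or.inl this)
      · intro j hj
        refine ⟨b.coord 0 (z j (τ j) - x₀), ?_⟩
        have := hzeq j (hmem j hj) _ (hτ j hj)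
        rwa [hτc j hj] at this
      · exact fun j hj => (hN j (hmem j hj)).map_v _ (hsub j (hmem j hj) (hτ j hj))
      · exact fun j hj => (hN j (hmem j hj)).subset _ (hsub j (hmem j hj) (hτ j hj))
      · exact fun j hj k hk h h' => hsep j (hmem j hj) k (hmem k hk) _ (hτ j hj) _ (hτ k hk)
          (Prod.ext h h')
    have hun : J \ D ⊆ ((J \ D).filter fun j => σ j = 1) ∪ (J \ D).filter fun j => σ j = -1 := by
      intro j hj
      rw [Finset.mem_union, Finset.mem_filter, Finset.mem_filter]
      exact (hσ j hj).imp (fun h => ⟨hj, h⟩) fun h => ⟨hj, h⟩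
    have h3 := (Finset.card_le_card hun).trans (Finset.card_union_le _ _)
    have h4 := key 1 one_ne_zero
    have h5 := key (-1) (by norm_num)
    omega
  · -- sheets sweeping the line
    have hside : ∀ j, j ∈ D → ∃ σ : ℝ, (σ = 1 ∨ σ = -1) ∧ ∃ η > 0, ∀ r, 0 < r → r < η →
        ∃ t ∈ Set.Ioo (-δ) δ, z j t = j.1 + (σ * r) • w := by
      intro j hj
      have hjJ := (Finset.mem_filter.1 hj).1
      have hz' : ∀ t ∈ Set.Ioo (-δ) δ, z j t = x₀ + b.coord 0 (z j t - x₀) • w := by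
        intro t ht
        have := hzeq j hjJ t ht
        rwa [(hδA j hjJ t ht).2 hj, zero_smul, add_zero] at this
      obtain ⟨σ, hσ, η, hη, hcov⟩ := exists_side (hcont j hjJ 0) (by
        by_contra! hall
        have hzp : ∀ t ∈ Set.Ioo (-δ) δ, z j t = j.1 := by
          intro t ht
          rw [hz' t ht, hall t ht, ← hz' 0 hI0, (hN j hjJ).z_zero]
        have hδ0 : -δ < δ := by linarith
        refine ((Set.Ioo_infinite hδ0).image ((hN j hjJ).inj.mono (hsub j hjJ))).mono ?_
          (hapex j hjJ)
        rintro _ ⟨t, ht, rfl⟩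
        refine ⟨isLine_ln (ne_zero_of_map_eq_one ((hN j hjJ).map_v t (hsub j hjJ ht))),
          (hN j hjJ).subset t (hsub j hjJ ht), ?_⟩
        rw [← hzp t ht]
        exact self_mem_ln _ _)
      refine ⟨σ, hσ, η, hη, fun r hr hr' => ?_⟩
      obtain ⟨t, ht, hte⟩ := hcov r hr hr'
      refine ⟨t, ht, ?_⟩
      rw [hz' t ht, hte, add_smul, ← add_assoc, ← hz' 0 hI0, (hN j hjJ).z_zero]
    choose! σ hσ η hη hcov using hside
    have key : ∀ j ∈ D, ∀ k ∈ D, j ≠ k → j.1 = k.1 → σ j = σ k → False := by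
      intro j hj k hk hjk hpk hσk
      have hjJ := (Finset.mem_filter.1 hj).1
      have hkJ := (Finset.mem_filter.1 hk).1
      have hlj := ln_eq_of_mem (hJ j hjJ).1
      refine no_double_cover hG hφ₀ (h2 _ hφ₀) hw (hlj ▸ hlφ) (hlj ▸ hlG) (κ := b.coord 2) hκw
        (σ := σ j) (η := min (η j) (η k)) (by rcases hσ j hj with h | h <;> rw [h] <;> norm_num)
        (lt_min (hη j hj) (hη k hk)) fun r hr hr' => ?_
      obtain ⟨t, ht, hte⟩ := hcov j hj r hr (hr'.trans_le (min_le_left _ _))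
      obtain ⟨t', ht', hte'⟩ := hcov k hk r hr (hr'.trans_le (min_le_right _ _))
      rw [← hpk, ← hσk] at hte'
      refine ⟨v j t, v k t', (hN j hjJ).map_v _ (hsub j hjJ ht), (hN k hkJ).map_v _ (hsub k hkJ ht'),
        fun h => hjk (hsep j hjJ k hkJ t ht t' ht' (Prod.ext (hte.trans hte'.symm) h)), ?_, ?_⟩
      · rw [← hte]
        exact ((hN j hjJ).subset _ (hsub j hjJ ht)).trans (zset_subset_zset_prod (hψ j hjJ))
      · rw [← hte']
        exact ((hN k hkJ).subset _ (hsub k hkJ ht')).trans (zset_subset_zset_prod (hψ k hkJ))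
    intro p
    by_contra! hlt
    obtain ⟨i, j, k, hi, hj, hk, hij, hik, hjk⟩ := Finset.two_lt_card_iff.1 hlt
    rw [Finset.mem_filter] at hi hj hk
    have e1 := key i hi.1 j hj.1 hij (hi.2.trans hj.2.symm)
    have e2 := key i hi.1 k hk.1 hik (hi.2.trans hk.2.symm)
    have e3 := key j hj.1 k hk.1 hjk (hj.2.trans hk.2.symm)
    rcases hσ i hi.1 with h | h <;> rcases hσ j hj.1 with h' | h' <;>
      rcases hσ k hk.1 with h'' | h'' <;>
      first
        | exact e1 (h.trans h'.symm)
        | exact e2 (h.trans h''.symm)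
        | exact e3 (h'.trans h''.symm)

/-! ### Incidences with the lines avoiding the control polynomials -/

lemma card_filter_fst {α β : Type*} (T : Finset (α × β)) (L : Finset β)
    (hL : ∀ j ∈ T, j.2 ∈ L) (p : α) :
    (T.filter fun j => j.1 = p).card = (L.filter fun l => (p, l) ∈ T).card := by
  refine Finset.card_bij (fun j _ => j.2) ?_ ?_ ?_
  · rintro ⟨q, l⟩ hj
    obtain ⟨h1, rfl⟩ := Finset.mem_filter.1 hj
    exact Finset.mem_filter.2 ⟨hL _ h1, h1⟩
  · rintro ⟨q, l⟩ hj ⟨q', l'⟩ hj' h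
    obtain ⟨-, rfl⟩ := Finset.mem_filter.1 hj
    obtain ⟨-, h2⟩ := Finset.mem_filter.1 hj'
    exact Prod.ext h2.symm h
  · intro l hl
    exact ⟨(p, l), Finset.mem_filter.2 ⟨(Finset.mem_filter.1 hl).2, rfl⟩, rfl⟩

/-- The Cauchy–Schwarz inequality for incidences. -/
lemma card_sq_le {α β : Type*} (P : Finset α) (T : Finset (α × β)) (hP : ∀ j ∈ T, j.1 ∈ P) :
    T.card ^ 2 ≤ P.card * ∑ p ∈ P, (T.filter fun j => j.1 = p).card ^ 2 := by
  rw [Finset.card_eq_sum_card_fiberwise (s := T) (f := Prod.fst) (t := P) fun j hj => hP j hj]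
  exact sq_sum_le_card_mul_sum_sq

lemma sum_card_sq_eq {α β : Type*} (P : Finset α) (L : Finset β) (T : Finset (α × β))
    (hP : ∀ j ∈ T, j.1 ∈ P) (hL : ∀ j ∈ T, j.2 ∈ L) :
    ∑ p ∈ P, (T.filter fun j => j.1 = p).card ^ 2 =
      ∑ l ∈ L, (T.filter fun j => (j.1, l) ∈ T).card := by
  simp only [Finset.card_filter (fun j : α × β => (j.1, _) ∈ T)]
  rw [Finset.sum_comm, ← Finset.sum_fiberwise_of_maps_to (s := T) (t := P) (g := fun j => j.1) hP]
  refine Finset.sum_congr rfl fun p _ => ?_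
  rw [sq, ← smul_eq_mul, ← Finset.sum_const]
  refine Finset.sum_congr rfl fun j hj => ?_
  rw [card_filter_fst T L hL, Finset.card_filter, (Finset.mem_filter.1 hj).2]

lemma card_sq_le_of_forall {α β : Type*} (P : Finset α) (L : Finset β) (T : Finset (α × β))
    (hP : ∀ j ∈ T, j.1 ∈ P) (hL : ∀ j ∈ T, j.2 ∈ L) {A B : ℕ}
    (h : ∀ l ∈ L, (T.filter fun j => (j.1, l) ∈ T).card ≤
      A + B * (T.filter fun j => j.2 = l).card) :
    T.card ^ 2 ≤ P.card * (L.card * A + B * T.card) := by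
  refine (card_sq_le P T hP).trans (Nat.mul_le_mul_left _ ?_)
  rw [sum_card_sq_eq P L T hP hL]
  refine (Finset.sum_le_sum h).trans ?_
  rw [Finset.sum_add_distrib, Finset.sum_const, smul_eq_mul, ← Finset.mul_sum,
    Finset.card_eq_sum_card_fiberwise (s := T) (f := Prod.snd) (t := L) fun j hj => hL j hj]

lemma le_of_sq_le {T m X B : ℝ} (hm : 0 ≤ m) (hX : 0 ≤ X) (hB : 0 ≤ B)
    (h : T ^ 2 ≤ m * (X + B * T)) : T ≤ B * m + √(m * X) := by
  by_contra! hlt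
  have h1 := Real.sq_sqrt (mul_nonneg hm hX)
  have h2 := Real.sqrt_nonneg (m * X)
  have h3 : 0 ≤ B * m := mul_nonneg hB hm
  nlinarith

/-- The apices of the surface of `φ`: the points on infinitely many of its lines. -/
def Apex (φ : MvPolynomial (Fin 3) ℝ) (p : Fin 3 → ℝ) : Prop :=
  {m | IsLine m ∧ m ⊆ zset φ ∧ p ∈ m}.Infinite

lemma apex_unique {φ : MvPolynomial (Fin 3) ℝ} (hφ : Irreducible φ) (hd : 2 ≤ φ.totalDegree)
    {p q : Fin 3 → ℝ} (hp : Apex φ p) (hq : Apex φ q) : p = q := by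
  by_contra hpq
  obtain ⟨m, ⟨hm, hmφ, hpm⟩, hne⟩ := hp.exists_notMem_finset {ln p (q - p)}
  rw [Finset.mem_singleton] at hne
  obtain ⟨v, hv, rfl⟩ := IsLine.exists_eq_ln hm hpm
  refine not_two_apexes hφ hd hpq (r := p + (1 : ℝ) • v) (hmφ (add_smul_mem_ln _ _ _)) ?_
    (fun x hx => cone_of_infinite hφ p hp hx) (fun x hx => cone_of_infinite hφ q hq hx)
  intro hr
  refine hne (IsLine.eq_of_mem hm (isLine_ln (sub_ne_zero.2 (Ne.symm hpq))) hpm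
    (add_smul_mem_ln p v 1) (self_mem_ln _ _) hr ?_)
  intro h
  exact hv (by simpa using h)

theorem incidences_good {Φ : Finset (MvPolynomial (Fin 3) ℝ)} (hΦ : IrrFamily Φ)
    (h2 : ∀ φ ∈ Φ, 2 ≤ φ.totalDegree) {L : Finset (Set (Fin 3 → ℝ))} (hL : ∀ l ∈ L, IsLine l)
    (hLΦ : ∀ l ∈ L, l ⊆ zset (∏ φ ∈ Φ, φ))
    {G : MvPolynomial (Fin 3) ℝ → MvPolynomial (Fin 3) ℝ} (hG : FamilyControl Φ L G)
    (P : Finset (Fin 3 → ℝ)) {d : ℕ} (hd : ∑ φ ∈ Φ, φ.totalDegree ≤ d) :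
    (((P ×ˢ (L \ badLines Φ L G)).filter fun pl => pl.1 ∈ pl.2).card : ℝ) ≤
      3 * P.card + L.card + √(P.card * (L.card * (4 * d))) := by
  have hψ : ∀ l, l ∈ L → ∃ φ ∈ Φ, l ⊆ zset φ := fun l hl => exists_subset_zset (hL l hl) (hLΦ l hl)
  choose! ψ hψΦ hψl using hψ
  set L' := L \ badLines Φ L G with hL'
  have hsubL : ∀ l ∈ L', l ∈ L := fun l hl => (Finset.mem_sdiff.1 hl).1
  have hgood : ∀ l ∈ L', ¬ l ⊆ zset (G (ψ l)) := fun l hl h =>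
    (Finset.mem_sdiff.1 hl).2 (Finset.mem_filter.2 ⟨hsubL l hl, ψ l, hψΦ l (hsubL l hl),
      h2 _ (hψΦ l (hsubL l hl)), hψl l (hsubL l hl), h⟩)
  set I := (P ×ˢ L').filter fun pl => pl.1 ∈ pl.2 with hI
  set T := I.filter fun pl => ¬ Apex (ψ pl.2) pl.1 with hT
  have hmemI : ∀ j ∈ I, j.1 ∈ P ∧ j.2 ∈ L' ∧ j.1 ∈ j.2 := by
    intro j hj
    obtain ⟨h1, h3⟩ := Finset.mem_filter.1 hj
    exact ⟨(Finset.mem_product.1 h1).1, (Finset.mem_product.1 h1).2, h3⟩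
  have hmemT : ∀ j ∈ T, j.1 ∈ P ∧ j.2 ∈ L' ∧ j.1 ∈ j.2 := fun j hj =>
    hmemI j (Finset.mem_filter.1 hj).1
  have hapexcard : (I.filter fun pl => ¬ ¬ Apex (ψ pl.2) pl.1).card ≤ L'.card := by
    refine Finset.card_le_card_of_injOn (fun j => j.2) (fun j hj => ?_) ?_
    · exact (hmemI j (Finset.mem_filter.1 hj).1).2.1
    · intro j hj k hk h
      obtain ⟨hj1, hj2⟩ := Finset.mem_filter.1 hj
      obtain ⟨hk1, hk2⟩ := Finset.mem_filter.1 hk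
      rw [not_not] at hj2 hk2
      have h' : j.2 = k.2 := h
      rw [← h'] at hk2
      have hjL := hsubL _ (hmemI j hj1).2.1
      exact Prod.ext (apex_unique (hΦ.1 _ (hψΦ _ hjL)) (h2 _ (hψΦ _ hjL)) hj2 hk2) h'
  have hline : ∀ l ∈ L', (T.filter fun j => (j.1, l) ∈ T).card ≤
      4 * d + 3 * (T.filter fun j => j.2 = l).card := by
    intro l hl
    have hlL := hsubL l hl
    set K := T.filter fun j => (j.1, l) ∈ T with hK
    obtain ⟨D, hDJ, hD1, hD2⟩ := sheet_count hΦ h2 hG (hL l hlL) (hψΦ l hlL) (hψl l hlL)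
      (hgood l hl) (K.filter fun j => ¬ j.2 = l) ψ
      (by
        intro j hj
        obtain ⟨hjK, hjl⟩ := Finset.mem_filter.1 hj
        obtain ⟨hjT, hjlT⟩ := Finset.mem_filter.1 hjK
        exact ⟨(hmemT _ hjlT).2.2, (hmemT _ hjT).2.2, hL _ (hsubL _ (hmemT _ hjT).2.1), hjl⟩)
      (by
        intro j hj
        exact hψΦ _ (hsubL _ (hmemT _ (Finset.mem_filter.1 (Finset.mem_filter.1 hj).1).1).2.1))
      (by
        intro j hj
        have hjL := (hmemT _ (Finset.mem_filter.1 (Finset.mem_filter.1 hj).1).1).2.1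
        exact hG.sheet _ (hψΦ _ (hsubL _ hjL)) (h2 _ (hψΦ _ (hsubL _ hjL))) _ (hsubL _ hjL)
          (hψl _ (hsubL _ hjL)) (hgood _ hjL))
      (by
        intro j hj
        exact Set.not_infinite.1
          (Finset.mem_filter.1 (Finset.mem_filter.1 (Finset.mem_filter.1 hj).1).1).2)
    have hle1 : (K.filter fun j => j.2 = l).card ≤ (T.filter fun j => j.2 = l).card :=
      Finset.card_le_card (Finset.filter_subset_filter _ (Finset.filter_subset _ _))
    have hDc : D.card ≤ 2 * (T.filter fun j => j.2 = l).card := by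
      have h3 : (D.image fun j => j.1).card ≤ (T.filter fun j => j.2 = l).card := by
        refine Finset.card_le_card_of_injOn (fun p => (p, l)) (fun p hp => ?_) ?_
        · obtain ⟨j, hj, rfl⟩ := Finset.mem_image.1 hp
          exact Finset.mem_filter.2
            ⟨(Finset.mem_filter.1 (Finset.mem_filter.1 (hDJ hj)).1).2, rfl⟩
        · exact fun p _ q _ h => (Prod.mk.inj h).1
      have h4 := Finset.card_le_mul_card_image (f := fun j => j.1) D 2 fun p _ => hD2 p
      omega
    have h5 := Finset.card_filter_add_card_filter_not (s := K) (fun j => j.2 = l)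
    have h6 := Finset.card_sdiff_add_card_eq_card hDJ
    omega
  have hfin := card_sq_le_of_forall P L' T (fun j hj => (hmemT j hj).1)
    (fun j hj => (hmemT j hj).2.1) (A := 4 * d) (B := 3) fun l hl => by convert hline l hl
  have hL'c : L'.card ≤ L.card := Finset.card_le_card Finset.sdiff_subset
  have hfin' : T.card ^ 2 ≤ P.card * (L.card * (4 * d) + 3 * T.card) :=
    hfin.trans (Nat.mul_le_mul_left _ (Nat.add_le_add_right (Nat.mul_le_mul_right _ hL'c) _))
  have hTle : (T.card : ℝ) ≤ 3 * P.card + √(P.card * (L.card * (4 * d))) := by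
    refine le_of_sq_le (by positivity) (by positivity) (by norm_num) ?_
    exact_mod_cast hfin'
  have hIc := Finset.card_filter_add_card_filter_not (s := I) (fun pl => ¬ Apex (ψ pl.2) pl.1)
  have hIle : I.card ≤ T.card + L.card := by
    rw [← hT] at hIc
    omega
  have : (I.card : ℝ) ≤ T.card + L.card := by exact_mod_cast hIle
  linarith

end SharirSolomon

namespace SharirSolomon

open Matrix

/-! ### Putting vectors into radial isotropic position -/

section Isotropic

variable {ι α : Type*} [Fintype ι]

/-- The squared Frobenius norm. -/
def frob (A : Matrix ι ι ℝ) : ℝ := ∑ i, ∑ j, A i j * A i j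

lemma dot_self_nonneg (v : ι → ℝ) : 0 ≤ v ⬝ᵥ v :=
  Finset.sum_nonneg fun i _ => mul_self_nonneg (v i)

lemma frob_nonneg (A : Matrix ι ι ℝ) : 0 ≤ frob A := 
  Finset.sum_nonneg fun i _ => Finset.sum_nonneg fun j _ => mul_self_nonneg (A i j)

lemma continuous_frob : Continuous (frob : Matrix ι ι ℝ → ℝ) := by
  unfold frob
  fun_prop

lemma frob_smul (c : ℝ) (A : Matrix ι ι ℝ) : frob (c • A) = c ^ 2 * frob A := by
  unfold frob
  rw [Finset.mul_sum]
  refine Finset.sum_congr rfl fun i _ => ?_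
  rw [Finset.mul_sum]
  refine Finset.sum_congr rfl fun j _ => ?_
  rw [Matrix.smul_apply, smul_eq_mul]
  ring

lemma frob_pos {A : Matrix ι ι ℝ} (hA : A ≠ 0) : 0 < frob A := by
  refine lt_of_le_of_ne (frob_nonneg A) fun h => hA ?_
  have h1 := (Finset.sum_eq_zero_iff_of_nonneg fun i _ => Finset.sum_nonneg
    fun j _ => mul_self_nonneg (A i j)).1 h.symm
  ext i j
  have h2 := (Finset.sum_eq_zero_iff_of_nonneg fun j _ => mul_self_nonneg (A i j)).1
    (h1 i (Finset.mem_univ i)) j (Finset.mem_univ j)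
  exact mul_self_eq_zero.1 h2

lemma isCompact_frob : IsCompact {A : Matrix ι ι ℝ | frob A = 1} := by
  have hK : IsCompact (Set.pi Set.univ fun _ : ι => Set.pi Set.univ fun _ : ι =>
      Set.Icc (-1 : ℝ) 1) := isCompact_univ_pi fun _ => isCompact_univ_pi fun _ => isCompact_Icc
  refine IsCompact.of_isClosed_subset hK (isClosed_eq continuous_frob continuous_const) ?_
  intro A hA i _ j _
  have h1 : A i j * A i j ≤ ∑ j, A i j * A i j :=
    Finset.single_le_sum (f := fun j => A i j * A i j) (fun j _ => mul_self_nonneg (A i j))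
      (Finset.mem_univ j)
  have h2 : ∑ j, A i j * A i j ≤ frob A :=
    Finset.single_le_sum (f := fun i => ∑ j, A i j * A i j)
      (fun i _ => Finset.sum_nonneg fun j _ => mul_self_nonneg (A i j)) (Finset.mem_univ i)
  rw [Set.mem_ofPred_eq] at hA
  exact ⟨by nlinarith, by nlinarith⟩

/-- The denominators of the functional maximized by an isotropic position. -/
noncomputable def isoDen (x : α → ι → ℝ) (δ : ℝ) (A : Matrix ι ι ℝ) (p : α) : ℝ :=
  (x p ᵥ* A) ⬝ᵥ (x p ᵥ* A) + δ * frob A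

lemma isoDen_smul (x : α → ι → ℝ) (δ c : ℝ) (A : Matrix ι ι ℝ) (p : α) :
    isoDen x δ (c • A) p = c ^ 2 * isoDen x δ A p := by
  rw [isoDen, isoDen, frob_smul, vecMul_smul, smul_dotProduct, dotProduct_smul, smul_eq_mul,
    smul_eq_mul]
  ring

lemma isoDen_nonneg (x : α → ι → ℝ) {δ : ℝ} (hδ : 0 ≤ δ) (A : Matrix ι ι ℝ) (p : α) :
    0 ≤ isoDen x δ A p := add_nonneg (dot_self_nonneg _) (mul_nonneg hδ (frob_nonneg A))

lemma continuous_isoDen (x : α → ι → ℝ) (δ : ℝ) (p : α) :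
    Continuous fun A : Matrix ι ι ℝ => isoDen x δ A p := by
  have h : Continuous fun A : Matrix ι ι ℝ => x p ᵥ* A :=
    Continuous.matrix_vecMul continuous_const continuous_id
  exact (h.dotProduct h).add (continuous_const.mul continuous_frob)

lemma exists_isoMax [Nonempty ι] (P : Finset α) (hP : P.Nonempty) (x : α → ι → ℝ) {δ : ℝ}
    (hδ : 0 < δ) : ∃ A : Matrix ι ι ℝ, frob A = 1 ∧ A.det ≠ 0 ∧ ∀ B : Matrix ι ι ℝ, B ≠ 0 →
      B.det ^ (2 * P.card) * ∏ p ∈ P, isoDen x δ A p ^ Fintype.card ι ≤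
        A.det ^ (2 * P.card) * ∏ p ∈ P, isoDen x δ B p ^ Fintype.card ι := by
  set N := Fintype.card ι with hN
  have hpos : ∀ A : Matrix ι ι ℝ, A ≠ 0 → 0 < ∏ p ∈ P, isoDen x δ A p ^ N := fun A hA =>
    Finset.prod_pos fun p _ => pow_pos
      (add_pos_of_nonneg_of_pos (dot_self_nonneg _) (mul_pos hδ (frob_pos hA))) _
  have hne : ∀ A : Matrix ι ι ℝ, frob A = 1 → A ≠ 0 := by
    rintro A hA rfl
    simp [frob] at hA
  have hnorm : ∀ B : Matrix ι ι ℝ, B ≠ 0 → frob ((√(frob B))⁻¹ • B) = 1 := by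
    intro B hB
    rw [frob_smul, inv_pow, Real.sq_sqrt (frob_nonneg B), inv_mul_cancel₀ (frob_pos hB).ne']
  have h1 : (1 : Matrix ι ι ℝ) ≠ 0 := one_ne_zero
  obtain ⟨A, hA, hmax⟩ := isCompact_frob.exists_isMaxOn (s := {A : Matrix ι ι ℝ | frob A = 1})
    ⟨_, hnorm 1 h1⟩ (f := fun A => A.det ^ (2 * P.card) / ∏ p ∈ P, isoDen x δ A p ^ N)
    (ContinuousOn.div (Continuous.continuousOn (by fun_prop))
      (continuous_finsetProd _ fun p _ => (continuous_isoDen x δ p).pow N).continuousOn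
      fun A hA => (hpos A (hne A hA)).ne')
  have hall : ∀ B : Matrix ι ι ℝ, B ≠ 0 → B.det ^ (2 * P.card) * ∏ p ∈ P, isoDen x δ A p ^ N ≤
      A.det ^ (2 * P.card) * ∏ p ∈ P, isoDen x δ B p ^ N := by
    intro B hB
    have h := hmax (hnorm B hB)
    have hc : 0 < (√(frob B))⁻¹ := inv_pos.2 (Real.sqrt_pos.2 (frob_pos hB))
    set c := (√(frob B))⁻¹
    simp only [Set.mem_ofPred_eq] at h
    rw [div_le_div_iff₀ (hpos _ (smul_ne_zero hc.ne' hB)) (hpos A (hne A hA)), det_smul] at h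
    simp only [isoDen_smul, mul_pow, Finset.prod_mul_distrib, Finset.prod_const] at h
    have e : ((c ^ 2) ^ N) ^ P.card = (c ^ N) ^ (2 * P.card) := by
      rw [← pow_mul, ← pow_mul, ← pow_mul]
      congr 1
      ring
    rw [← hN, e, mul_assoc, mul_left_comm (A.det ^ (2 * P.card))] at h
    exact le_of_mul_le_mul_left h (by positivity)
  refine ⟨A, hA, fun hdet => ?_, hall⟩
  have h := hall 1 h1
  rw [hdet, det_one, one_pow, one_mul] at h
  have h0 := hP.card_pos
  rw [zero_pow (by omega), zero_mul] at h
  exact absurd (hpos A (hne A hA)) (not_lt.2 h)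

lemma vecMul_stretch_dot (u e : ι → ℝ) (he : e ⬝ᵥ e = 1) (t : ℝ) :
    (u ᵥ* (1 + t • vecMulVec e e)) ⬝ᵥ (u ᵥ* (1 + t • vecMulVec e e)) =
      u ⬝ᵥ u + (2 * t + t ^ 2) * (u ⬝ᵥ e) ^ 2 := by
  rw [vecMul_add, vecMul_one, vecMul_smul, vecMul_vecMulVec]
  simp only [add_dotProduct, dotProduct_add, smul_dotProduct, dotProduct_smul, smul_eq_mul, he,
    dotProduct_comm e u]
  ring

lemma det_stretch (e : ι → ℝ) (he : e ⬝ᵥ e = 1) (t : ℝ) :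
    (1 + t • vecMulVec e e : Matrix ι ι ℝ).det = 1 + t := by
  rw [← smul_vecMulVec, vecMulVec_eq Unit, det_one_add_replicateCol_mul_replicateRow,
    dotProduct_smul, he, smul_eq_mul, mul_one]

lemma frob_stretch (A : Matrix ι ι ℝ) (e : ι → ℝ) (he : e ⬝ᵥ e = 1) (t : ℝ) :
    frob (A * (1 + t • vecMulVec e e)) = frob A + (2 * t + t ^ 2) * ∑ i, (A.row i ⬝ᵥ e) ^ 2 := by
  rw [frob, frob, Finset.mul_sum, ← Finset.sum_add_distrib]
  refine Finset.sum_congr rfl fun i _ => ?_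
  exact vecMul_stretch_dot (A.row i) e he t

lemma le_of_forall_exp {m V : ℝ} (hm : 0 ≤ m)
    (h : ∀ s, 0 < s → s < 1 → 1 - m * s ≤ Real.exp (-(s * V))) : V ≤ m := by
  by_contra! hlt
  have hV : 0 < V := hm.trans_lt hlt
  set s := min (1 / 2) (min (1 / V) ((V - m) / (2 * V ^ 2))) with hs
  have hs0 : 0 < s := by
    have : 0 < V - m := by linarith
    positivity
  have hs1 : s ≤ 1 / 2 := min_le_left _ _
  have hs2 : s * V ≤ 1 := by
    rw [← le_div_iff₀ hV]
    exact (min_le_right _ _).trans (min_le_left _ _)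
  have hs3 : s * (2 * V ^ 2) ≤ V - m := by
    rw [← le_div_iff₀ (by positivity)]
    exact (min_le_right _ _).trans (min_le_right _ _)
  have h1 := h s hs0 (by linarith)
  have hsV : 0 < s * V := mul_pos hs0 hV
  have h2 := (abs_le.1 (Real.abs_exp_sub_one_sub_id_le (x := -(s * V))
    (by rw [abs_neg, abs_of_pos hsV]; exact hs2))).2
  have h3 : s * (V - m) ≤ s * (s * V ^ 2) := by nlinarith
  have h4 := le_of_mul_le_mul_left h3 hs0
  nlinarith [mul_pos hs0 (pow_pos hV 2)]

/-- Approximate radial isotropic position. -/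
lemma exists_isotropic [Nonempty ι] (P : Finset α) (hP : P.Nonempty) (x : α → ι → ℝ) {δ : ℝ}
    (hδ : 0 < δ) : ∃ A : Matrix ι ι ℝ, frob A = 1 ∧ ∀ e : ι → ℝ, e ⬝ᵥ e = 1 →
      Fintype.card ι * ∑ p ∈ P, ((x p ᵥ* A) ⬝ᵥ e) ^ 2 / ((x p ᵥ* A) ⬝ᵥ (x p ᵥ* A) + δ) ≤
        P.card := by
  obtain ⟨A, hA, hdet, hmax⟩ := exists_isoMax P hP x hδ
  refine ⟨A, hA, fun e he => ?_⟩
  set D : α → ℝ := fun p => (x p ᵥ* A) ⬝ᵥ (x p ᵥ* A) + δ with hD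
  have hDpos : ∀ p, 0 < D p := fun p => add_pos_of_nonneg_of_pos (dot_self_nonneg _) hδ
  have hDA : ∀ p, isoDen x δ A p = D p := fun p => by rw [isoDen, hA, mul_one]
  set K : α → ℝ := fun p => ((x p ᵥ* A) ⬝ᵥ e) ^ 2 + δ * ∑ i, (A.row i ⬝ᵥ e) ^ 2 with hK
  have hle : Fintype.card ι * ∑ p ∈ P, K p / D p ≤ P.card := by
    refine le_of_forall_exp (Nat.cast_nonneg _) fun s hs0 hs1 => ?_
    set t := √(1 - s) - 1 with ht
    have h1t : 0 < 1 + t := by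
      rw [ht, add_sub_cancel]
      exact Real.sqrt_pos.2 (by linarith)
    have ht2 : (1 + t) ^ 2 = 1 - s := by
      rw [ht, add_sub_cancel, Real.sq_sqrt (by linarith)]
    have hτ : 2 * t + t ^ 2 = -s := by linarith [ht2, add_sq 1 t]
    have hBdet : (A * (1 + t • vecMulVec e e)).det = A.det * (1 + t) := by
      rw [det_mul, det_stretch e he]
    have hB0 : A * (1 + t • vecMulVec e e) ≠ 0 := by
      intro h
      rw [h, det_zero] at hBdet
      exact mul_ne_zero hdet h1t.ne' hBdet.symm
    have hDB : ∀ p, isoDen x δ (A * (1 + t • vecMulVec e e)) p = D p - s * K p := by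
      intro p
      rw [isoDen, frob_stretch A e he, ← vecMul_vecMul, vecMul_stretch_dot _ e he, hτ, hA]
      simp only [hD, hK]
      ring
    have h := hmax _ hB0
    rw [hBdet, mul_pow, mul_assoc] at h
    have h' := le_of_mul_le_mul_left h (by rw [pow_mul]; positivity)
    rw [pow_mul, ht2] at h'
    simp only [hDA, hDB] at h'
    have hprod : ∏ p ∈ P, (D p - s * K p) ^ Fintype.card ι ≤
        Real.exp (-(s * (Fintype.card ι * ∑ p ∈ P, K p / D p))) *
          ∏ p ∈ P, D p ^ Fintype.card ι := by
      calc _ ≤ ∏ p ∈ P, (Real.exp (-(s * (K p / D p))) * D p) ^ Fintype.card ι := by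
            refine Finset.prod_le_prod (fun p _ => pow_nonneg ?_ _) fun p _ =>
              pow_le_pow_left₀ ?_ ?_ _
            · rw [← hDB]
              exact isoDen_nonneg x hδ.le _ p
            · rw [← hDB]
              exact isoDen_nonneg x hδ.le _ p
            · have h1 := Real.add_one_le_exp (-(s * (K p / D p)))
              have h2 := mul_le_mul_of_nonneg_right h1 (hDpos p).le
              have h3 : (-(s * (K p / D p)) + 1) * D p = D p - s * K p := by
                have := (hDpos p).ne'
                field_simp
                ring
              rwa [h3] at h2
        _ = _ := by
            simp only [mul_pow, Finset.prod_mul_distrib]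
            rw [Finset.prod_pow, ← Real.exp_sum, ← Real.exp_nat_mul]
            congr 2
            rw [Finset.sum_neg_distrib, ← Finset.mul_sum]
            ring
    have hpos : 0 < ∏ p ∈ P, D p ^ Fintype.card ι :=
      Finset.prod_pos fun p _ => pow_pos (hDpos p) _
    have h3 := le_of_mul_le_mul_right (h'.trans hprod) hpos
    have h4 := one_add_mul_le_pow (a := -s) (by linarith) P.card
    have h5 : 1 + (P.card : ℝ) * -s = 1 - P.card * s := by ring
    rw [h5, ← sub_eq_add_neg] at h4
    exact h4.trans h3
  refine le_trans (mul_le_mul_of_nonneg_left (Finset.sum_le_sum fun p _ => ?_)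
    (Nat.cast_nonneg _)) hle
  refine div_le_div_of_nonneg_right ?_ (hDpos p).le
  exact le_add_of_nonneg_right (mul_nonneg hδ.le (Finset.sum_nonneg fun i _ => sq_nonneg _))

end Isotropic

end SharirSolomon

namespace SharirSolomon

open Matrix

section AlmostOrthogonal

variable {ι α : Type*} [Fintype ι]

lemma dot_self_pos {v : ι → ℝ} (hv : v ≠ 0) : 0 < v ⬝ᵥ v := by
  refine lt_of_le_of_ne (dot_self_nonneg v) fun h => hv ?_
  exact dotProduct_self_eq_zero.1 h.symm

/-- Two vectors at an angle of less than 60 degrees, up to sign. -/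
def Near (y y' : ι → ℝ) : Prop := (y ⬝ᵥ y) * (y' ⬝ᵥ y') < 4 * (y ⬝ᵥ y') ^ 2

lemma Near.ne_zero {y y' : ι → ℝ} (h : Near y y') : y ≠ 0 ∧ y' ≠ 0 := by
  constructor <;> rintro rfl <;> simp [Near] at h

lemma card_near_le_of_isotropic {P : Finset α} {x : α → ι → ℝ} {δ : ℝ} (hδ : 0 < δ)
    {A : Matrix ι ι ℝ}
    (h : ∀ e : ι → ℝ, e ⬝ᵥ e = 1 →
      Fintype.card ι * ∑ p ∈ P, ((x p ᵥ* A) ⬝ᵥ e) ^ 2 / ((x p ᵥ* A) ⬝ᵥ (x p ᵥ* A) + δ) ≤ P.card) :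
    (Fintype.card ι : ℝ) * ((P ×ˢ P).filter fun pq => Near (x pq.1 ᵥ* A) (x pq.2 ᵥ* A) ∧
      δ ≤ (x pq.1 ᵥ* A) ⬝ᵥ (x pq.1 ᵥ* A)).card ≤ 8 * P.card ^ 2 := by
  set y : α → ι → ℝ := fun p => x p ᵥ* A with hy
  change (Fintype.card ι : ℝ) * ((P ×ˢ P).filter fun pq => Near (y pq.1) (y pq.2) ∧
      δ ≤ (y pq.1) ⬝ᵥ (y pq.1)).card ≤ _
  have hq : ∀ q ∈ P, (Fintype.card ι : ℝ) *
      (P.filter fun p => Near (y p) (y q) ∧ δ ≤ y p ⬝ᵥ y p).card ≤ 8 * P.card := by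
    intro q _
    by_cases hq0 : y q = 0
    · have : (P.filter fun p => Near (y p) (y q) ∧ δ ≤ y p ⬝ᵥ y p) = ∅ :=
        Finset.filter_eq_empty_iff.2 fun p _ h => h.1.ne_zero.2 hq0
      rw [this]
      simp
    · have hpos := dot_self_pos hq0
      have hsq := Real.sq_sqrt hpos.le
      have hs0 : 0 < √(y q ⬝ᵥ y q) := Real.sqrt_pos.2 hpos
      have he := h ((√(y q ⬝ᵥ y q))⁻¹ • y q) (by
        rw [smul_dotProduct, dotProduct_smul, smul_eq_mul, smul_eq_mul, ← mul_assoc, ← sq, inv_pow,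
          hsq, inv_mul_cancel₀ hpos.ne'])
      refine le_trans ?_ (mul_le_mul_of_nonneg_left he (by norm_num : (0 : ℝ) ≤ 8))
      rw [← mul_assoc, mul_comm (8 : ℝ), mul_assoc]
      refine mul_le_mul_of_nonneg_left ?_ (Nat.cast_nonneg _)
      rw [Finset.card_filter, Nat.cast_sum, Finset.mul_sum]
      refine Finset.sum_le_sum fun p _ => ?_
      have hD : 0 < y p ⬝ᵥ y p + δ := add_pos_of_nonneg_of_pos (dot_self_nonneg _) hδ
      split_ifs with hp
      · change ((1 : ℕ) : ℝ) ≤ 8 * ((y p ⬝ᵥ _) ^ 2 / (y p ⬝ᵥ y p + δ))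
        rw [dotProduct_smul, smul_eq_mul, mul_pow, inv_pow, hsq, Nat.cast_one, mul_div_assoc',
          le_div_iff₀ hD, one_mul, ← mul_assoc, mul_comm (8 : ℝ), mul_assoc,
          ← div_eq_inv_mul, le_div_iff₀ hpos]
        have h1 := hp.1
        unfold Near at h1
        nlinarith [hp.2]
      · simpa using div_nonneg (sq_nonneg _) hD.le
  have hcard : ((P ×ˢ P).filter fun pq => Near (y pq.1) (y pq.2) ∧
      δ ≤ (y pq.1) ⬝ᵥ (y pq.1)).card =
      ∑ q ∈ P, (P.filter fun p => Near (y p) (y q) ∧ δ ≤ y p ⬝ᵥ y p).card := by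
    simp only [Finset.card_filter]
    rw [Finset.sum_product_right]
  rw [hcard, Nat.cast_sum, Finset.mul_sum]
  refine (Finset.sum_le_sum hq).trans ?_
  rw [Finset.sum_const, nsmul_eq_mul]
  exact le_of_eq (by ring)

/-- A linear image of finitely many vectors most pairs of which are far from parallel. -/
lemma exists_card_near_le [Nonempty ι] (P : Finset α) (hP : P.Nonempty) (x : α → ι → ℝ) :
    ∃ A : Matrix ι ι ℝ, A ≠ 0 ∧ (Fintype.card ι : ℝ) *
      ((P ×ˢ P).filter fun pq => Near (x pq.1 ᵥ* A) (x pq.2 ᵥ* A)).card ≤ 8 * P.card ^ 2 := by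
  have hseq : ∀ k : ℕ, ∃ A : Matrix ι ι ℝ, frob A = 1 ∧ (Fintype.card ι : ℝ) *
      ((P ×ˢ P).filter fun pq => Near (x pq.1 ᵥ* A) (x pq.2 ᵥ* A) ∧
        1 / ((k : ℝ) + 1) ≤ (x pq.1 ᵥ* A) ⬝ᵥ (x pq.1 ᵥ* A)).card ≤ 8 * P.card ^ 2 := by
    intro k
    have hk : 0 < 1 / ((k : ℝ) + 1) := Nat.one_div_pos_of_nat
    obtain ⟨A, hA, h⟩ := exists_isotropic P hP x hk
    exact ⟨A, hA, card_near_le_of_isotropic hk h⟩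
  choose A hA hcard using hseq
  have : FirstCountableTopology (Matrix ι ι ℝ) :=
    inferInstanceAs (FirstCountableTopology (ι → ι → ℝ))
  obtain ⟨B, hB, φ, hφ, hlim⟩ := (isCompact_frob (ι := ι)).tendsto_subseq hA
  refine ⟨B, ?_, ?_⟩
  · rintro rfl
    simp [frob] at hB
  have hy : ∀ p, Filter.Tendsto (fun k => x p ᵥ* A (φ k)) Filter.atTop (nhds (x p ᵥ* B)) :=
    fun p => (((Continuous.matrix_vecMul continuous_const continuous_id :
      Continuous fun A : Matrix ι ι ℝ => x p ᵥ* A)).tendsto B).comp hlim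
  have hdot : ∀ p q, Filter.Tendsto (fun k => (x p ᵥ* A (φ k)) ⬝ᵥ (x q ᵥ* A (φ k)))
      Filter.atTop (nhds ((x p ᵥ* B) ⬝ᵥ (x q ᵥ* B))) := fun p q =>
    ((continuous_fst.dotProduct continuous_snd :
      Continuous fun z : (ι → ℝ) × (ι → ℝ) => z.1 ⬝ᵥ z.2).tendsto _).comp
      ((hy p).prodMk_nhds (hy q))
  have hδ : Filter.Tendsto (fun k => 1 / ((φ k : ℝ) + 1)) Filter.atTop (nhds 0) :=
    (tendsto_one_div_add_atTop_nhds_zero_nat (𝕜 := ℝ)).comp hφ.tendsto_atTop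
  have hev : ∀ᶠ k in Filter.atTop,
      ∀ pq ∈ (P ×ˢ P).filter fun pq => Near (x pq.1 ᵥ* B) (x pq.2 ᵥ* B),
      Near (x pq.1 ᵥ* A (φ k)) (x pq.2 ᵥ* A (φ k)) ∧
        1 / ((φ k : ℝ) + 1) ≤ (x pq.1 ᵥ* A (φ k)) ⬝ᵥ (x pq.1 ᵥ* A (φ k)) := by
    refine (Filter.eventually_all_finset _).2 fun pq hpq => ?_
    have hn := (Finset.mem_filter.1 hpq).2
    refine Filter.Eventually.and ?_ ?_
    · exact ((hdot _ _).mul (hdot _ _)).eventually_lt (((hdot _ _).pow 2).const_mul 4) hn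
    · exact (hδ.eventually_lt (hdot _ _) (dot_self_pos hn.ne_zero.1)).mono fun k hk => hk.le
  obtain ⟨k, hk⟩ := hev.exists
  refine le_trans (mul_le_mul_of_nonneg_left ?_ (Nat.cast_nonneg _)) (hcard (φ k))
  exact_mod_cast Finset.card_le_card fun pq hpq =>
    Finset.mem_filter.2 ⟨(Finset.mem_filter.1 hpq).1, hk pq hpq⟩

end AlmostOrthogonal

end SharirSolomon

namespace SharirSolomon

open MeasureTheory InnerProductSpace

variable {E : Type*} [NormedAddCommGroup E] [InnerProductSpace ℝ E] [FiniteDimensional ℝ E]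
  [MeasurableSpace E] [BorelSpace E]

lemma measurableSet_sector (y w : E) : MeasurableSet
    {ξ : E | inner ℝ ξ y * inner ℝ ξ w ≤ 0 ∧ |inner ℝ ξ y| ≤ |inner ℝ ξ w|} := by
  have h : ∀ z : E, Continuous fun ξ : E => (inner ℝ ξ z : ℝ) := fun z => by fun_prop
  exact ((isClosed_le ((h y).mul (h w)) continuous_const).inter
    (isClosed_le (h y).abs (h w).abs)).measurableSet

/-- For two orthogonal vectors of equal length, the event that `ξ` lies in a prescribed eighth-turn
pair of sectors has probability at least a quarter under a rotation invariant law. -/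
theorem quarter_le_sector (μ : Measure E) [IsProbabilityMeasure μ]
    (hμ : ∀ g : E ≃ₗᵢ[ℝ] E, MeasurePreserving g μ μ) {y w : E} (hyw : inner ℝ y w = 0)
    (hn : ‖y‖ = ‖w‖) :
    1 / 4 ≤ μ.real {ξ | inner ℝ ξ y * inner ℝ ξ w ≤ 0 ∧ |inner ℝ ξ y| ≤ |inner ℝ ξ w|} := by
  set S : Set E := {ξ | inner ℝ ξ y * inner ℝ ξ w ≤ 0 ∧ |inner ℝ ξ y| ≤ |inner ℝ ξ w|} with hS
  have hSm : MeasurableSet S := by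
    exact measurableSet_sector y w
  let g₁ : E ≃ₗᵢ[ℝ] E := Submodule.reflection (Submodule.span ℝ {w})ᗮ
  let g₂ : E ≃ₗᵢ[ℝ] E := Submodule.reflection (Submodule.span ℝ {y - w})ᗮ
  have h1w : g₁ w = -w := Submodule.reflection_orthogonalComplement_singleton_eq_neg w
  have h1y : g₁ y = y := by
    apply Submodule.reflection_mem_subspace_eq_self
    rw [Submodule.mem_orthogonal_singleton_iff_inner_left]
    exact hyw
  have h2y : g₂ y = w := Submodule.reflection_sub hn
  have h2w : g₂ w = y := by
    rw [← h2y]; exact Submodule.reflection_reflection _ _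
  have e1w : ∀ ξ, inner ℝ (g₁ ξ) w = - inner ℝ ξ w := fun ξ => by
    rw [← g₁.inner_map_map ξ w, h1w, inner_neg_right, neg_neg]
  have e1y : ∀ ξ, inner ℝ (g₁ ξ) y = inner ℝ ξ y := fun ξ => by
    rw [← g₁.inner_map_map ξ y, h1y]
  have e2w : ∀ ξ, inner ℝ (g₂ ξ) w = inner ℝ ξ y := fun ξ => by
    rw [← g₂.inner_map_map ξ y, h2y]
  have e2y : ∀ ξ, inner ℝ (g₂ ξ) y = inner ℝ ξ w := fun ξ => by
    rw [← g₂.inner_map_map ξ w, h2w]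
  have hp : ∀ g : E ≃ₗᵢ[ℝ] E, μ.real (g ⁻¹' S) = μ.real S := fun g => by
    rw [measureReal_def, measureReal_def, (hμ g).measure_preimage hSm.nullMeasurableSet]
  have hcov : (Set.univ : Set E) ⊆ (S ∪ g₁ ⁻¹' S) ∪ (g₂ ⁻¹' S ∪ (g₂.trans g₁) ⁻¹' S) := by
    intro ξ _
    simp only [hS, Set.mem_union, Set.mem_preimage, Set.mem_ofPred_eq, e1w, e1y, e2w, e2y,
      LinearIsometryEquiv.coe_trans, Function.comp, abs_neg, mul_neg]
    rcases le_total (inner ℝ ξ y * inner ℝ ξ w) 0 with h | h <;>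
    rcases le_total |inner ℝ ξ y| |inner ℝ ξ w| with h' | h'
    · exact Or.inl (Or.inl ⟨h, h'⟩)
    · exact Or.inr (Or.inl ⟨by linarith, h'⟩)
    · exact Or.inl (Or.inr ⟨by linarith, h'⟩)
    · exact Or.inr (Or.inr ⟨by linarith, h'⟩)
  have h1 : μ.real (Set.univ : Set E) = 1 := by simp
  have h2 := measureReal_mono (μ := μ) hcov
  have h3 := measureReal_union_le (μ := μ) (S ∪ g₁ ⁻¹' S) (g₂ ⁻¹' S ∪ (g₂.trans g₁) ⁻¹' S)
  have h4 := measureReal_union_le (μ := μ) S (g₁ ⁻¹' S)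
  have h5 := measureReal_union_le (μ := μ) (g₂ ⁻¹' S) ((g₂.trans g₁) ⁻¹' S)
  rw [hp] at h4 h5
  rw [hp] at h5
  linarith

theorem measureReal_same_sign_le (μ : Measure E) [IsProbabilityMeasure μ]
    (hμ : ∀ g : E ≃ₗᵢ[ℝ] E, MeasurePreserving g μ μ) {y y' : E}
    (h : 4 * inner ℝ y y' ^ 2 ≤ ‖y‖ ^ 2 * ‖y'‖ ^ 2) :
    μ.real {ξ | 0 < inner ℝ ξ y * inner ℝ ξ y'} ≤ 3 / 4 := by
  by_cases hy : y = 0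
  · rw [hy]; simp; norm_num
  by_cases hy' : y' = 0
  · rw [hy']; simp; norm_num
  have hyp : 0 < ‖y‖ := norm_pos_iff.2 hy
  have hyp' : 0 < ‖y'‖ := norm_pos_iff.2 hy'
  set ρ : ℝ := inner ℝ y y' / ‖y‖ ^ 2 with hρ
  set w₀ : E := y' - ρ • y with hw₀
  have ho : inner ℝ y w₀ = 0 := by
    rw [hw₀, inner_sub_right, inner_smul_right, real_inner_self_eq_norm_sq, hρ]
    field_simp; ring
  have hnorm : ‖y'‖ ^ 2 = ρ ^ 2 * ‖y‖ ^ 2 + ‖w₀‖ ^ 2 := by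
    have : y' = ρ • y + w₀ := by rw [hw₀]; abel
    conv_lhs => rw [this]
    rw [norm_add_sq_real, inner_smul_left, ho, norm_smul, mul_pow, Real.norm_eq_abs, sq_abs]
    simp
  have hin : inner ℝ y y' = ρ * ‖y‖ ^ 2 := by rw [hρ]; field_simp
  have hle : 3 * ρ ^ 2 * ‖y‖ ^ 2 ≤ ‖w₀‖ ^ 2 := by
    rw [hin, hnorm] at h
    have h2 : ‖y‖ ^ 2 * (3 * ρ ^ 2 * ‖y‖ ^ 2) ≤ ‖y‖ ^ 2 * ‖w₀‖ ^ 2 := by nlinarith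
    exact le_of_mul_le_mul_left h2 (by positivity)
  have hw₀p : 0 < ‖w₀‖ := by
    rcases (norm_nonneg w₀).lt_or_eq with h0 | h0
    · exact h0
    · exfalso
      rw [← h0] at hle hnorm
      nlinarith [sq_nonneg (ρ * ‖y‖), sq_pos_of_pos hyp']
  set σ : ℝ := ‖w₀‖ / ‖y‖ with hσ
  set w : E := (‖y‖ / ‖w₀‖) • w₀ with hw
  have hyw : inner ℝ y w = 0 := by rw [hw, inner_smul_right, ho, mul_zero]
  have hnw : ‖y‖ = ‖w‖ := by
    rw [hw, norm_smul, Real.norm_eq_abs, abs_of_pos (by positivity)]; field_simp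
  have hy'e : y' = ρ • y + σ • w := by
    rw [hw, smul_smul, hσ]
    have : ‖w₀‖ / ‖y‖ * (‖y‖ / ‖w₀‖) = 1 := by field_simp
    rw [this, one_smul, hw₀]; abel
  have hσp : 0 < σ := by positivity
  have hρσ : |ρ| ≤ σ := by
    refine abs_le_of_sq_le_sq ?_ hσp.le
    rw [hσ, div_pow ‖w₀‖ ‖y‖, le_div_iff₀ (by positivity)]
    nlinarith [sq_nonneg (ρ * ‖y‖)]
  have hq := quarter_le_sector μ hμ hyw hnw
  set S : Set E := {ξ | inner ℝ ξ y * inner ℝ ξ w ≤ 0 ∧ |inner ℝ ξ y| ≤ |inner ℝ ξ w|} with hS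
  have hSm : MeasurableSet S := by
    exact measurableSet_sector y w
  have hsub : {ξ | 0 < inner ℝ ξ y * inner ℝ ξ y'} ⊆ Sᶜ := by
    intro ξ hξ hξS
    obtain ⟨h1, h2⟩ := hξS
    simp only [Set.mem_ofPred_eq] at hξ
    rw [hy'e, inner_add_right, inner_smul_right, inner_smul_right] at hξ
    set a := (inner ℝ ξ y : ℝ)
    set b := (inner ℝ ξ w : ℝ)
    have e1 : a * (ρ * a + σ * b) = ρ * (|a| * |a|) + σ * (a * b) := by
      rw [abs_mul_abs_self]; ring
    have e2 : a * b = - (|a| * |b|) := by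
      rw [← abs_mul, abs_of_nonpos h1]; ring
    rw [e1, e2] at hξ
    have h3 : ρ * (|a| * |a|) ≤ σ * (|a| * |b|) := by
      have : ρ ≤ σ := (le_abs_self ρ).trans hρσ
      calc ρ * (|a| * |a|) ≤ σ * (|a| * |a|) := by gcongr
        _ ≤ _ := by gcongr
    linarith
  have h2 := measureReal_mono (μ := μ) hsub
  rw [probReal_compl_eq_one_sub hSm] at h2
  linarith

end SharirSolomon

namespace SharirSolomon

open MeasureTheory Matrix

section Separating
variable {ι α : Type*} [Fintype ι]

lemma exists_invariant_probability (ι : Type*) [Fintype ι] :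
    ∃ μ : Measure (EuclideanSpace ℝ ι), IsProbabilityMeasure μ ∧
      (∀ g : EuclideanSpace ℝ ι ≃ₗᵢ[ℝ] EuclideanSpace ℝ ι, MeasurePreserving g μ μ) ∧
      μ ≪ volume := by
  set B : Set (EuclideanSpace ℝ ι) := Metric.closedBall 0 1 with hB
  have h0 : volume B ≠ 0 := (Metric.measure_closedBall_pos _ _ one_pos).ne'
  have h1 : volume B ≠ ⊤ := measure_closedBall_lt_top.ne
  refine ⟨ProbabilityTheory.cond volume B,
    ProbabilityTheory.cond_isProbabilityMeasure_of_finite h0 h1, fun g => ?_,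
    ProbabilityTheory.cond_absolutelyContinuous⟩
  have hpre : g ⁻¹' B = B := by
    rw [hB, LinearIsometryEquiv.preimage_closedBall]; simp
  have := (g.measurePreserving).restrict_preimage (s := B) Metric.isClosed_closedBall.measurableSet
  rw [hpre] at this
  refine ⟨this.measurable, ?_⟩
  rw [ProbabilityTheory.cond, Measure.map_smul, this.map_eq]

theorem exists_separating_vector [Nonempty ι] {P : Finset α} (hP : P.Nonempty) (x : α → ι → ℝ)
    {Q : Finset (α × α)} (hQP : Q ⊆ P ×ˢ P)
    (hQ : 16 * (P.card : ℝ) ^ 2 ≤ Fintype.card ι * Q.card) :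
    ∃ c : ι → ℝ, c ≠ 0 ∧
      8 * ((Q.filter fun pq => 0 < (c ⬝ᵥ x pq.1) * (c ⬝ᵥ x pq.2)).card : ℝ) ≤ 7 * Q.card := by
  obtain ⟨A, hA, hnear⟩ := exists_card_near_le P hP x
  obtain ⟨μ, hμ, hinv, hac⟩ := exists_invariant_probability ι
  set y : α → EuclideanSpace ℝ ι := fun p => WithLp.toLp 2 (x p ᵥ* A) with hy
  have hin : ∀ p q, inner ℝ (y p) (y q) = (x p ᵥ* A) ⬝ᵥ (x q ᵥ* A) := fun p q => by
    rw [hy, EuclideanSpace.inner_toLp_toLp, star_trivial, dotProduct_comm]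
  have hc : ∀ ξ : EuclideanSpace ℝ ι, ∀ p, inner ℝ ξ (y p) = (A *ᵥ ξ.ofLp) ⬝ᵥ x p := fun ξ p => by
    rw [dotProduct_comm, dotProduct_mulVec]
    have : ξ = WithLp.toLp 2 ξ.ofLp := rfl
    conv_lhs => rw [this]
    rw [hy, EuclideanSpace.inner_toLp_toLp, star_trivial]
  let S : α × α → Set (EuclideanSpace ℝ ι) := fun pq =>
    {ξ | 0 < inner ℝ ξ (y pq.1) * inner ℝ ξ (y pq.2)}
  have hSm : ∀ pq, MeasurableSet (S pq) := fun pq => by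
    have h : ∀ z : EuclideanSpace ℝ ι, Continuous fun ξ : EuclideanSpace ℝ ι =>
      (inner ℝ ξ z : ℝ) := fun z => by fun_prop
    exact (isOpen_lt continuous_const ((h _).mul (h _))).measurableSet
  let F : EuclideanSpace ℝ ι → ℝ := fun ξ => ∑ pq ∈ Q, (S pq).indicator 1 ξ
  have h_int : ∀ pq ∈ Q, Integrable ((S pq).indicator (1 : EuclideanSpace ℝ ι → ℝ)) μ :=
    fun pq _ => (integrable_const (1 : ℝ)).indicator (hSm pq)
  have hN : μ {ξ : EuclideanSpace ℝ ι | A *ᵥ ξ.ofLp = 0} = 0 := by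
    apply hac
    let W : Submodule ℝ (EuclideanSpace ℝ ι) :=
      LinearMap.ker (A.mulVecLin ∘ₗ (WithLp.linearEquiv 2 ℝ (ι → ℝ)).toLinearMap)
    have hW : W ≠ ⊤ := by
      intro h
      apply hA
      apply Matrix.ext_of_mulVec_single
      intro i
      have : WithLp.toLp 2 (Pi.single i (1 : ℝ)) ∈ W := by rw [h]; trivial
      have h' : A *ᵥ Pi.single i (1 : ℝ) = 0 := this
      rw [h', Matrix.zero_mulVec]
    have := Measure.addHaar_submodule volume W hW
    exact this
  obtain ⟨ξ, hξ, hle⟩ := exists_notMem_null_le_integral (μ := μ) (f := F)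
    (integrable_finsetSum _ h_int) hN
  refine ⟨A *ᵥ ξ.ofLp, hξ, ?_⟩
  have hF : F ξ = ((Q.filter fun pq =>
      0 < ((A *ᵥ ξ.ofLp) ⬝ᵥ x pq.1) * ((A *ᵥ ξ.ofLp) ⬝ᵥ x pq.2)).card : ℝ) := by
    simp only [F, Finset.card_filter, Nat.cast_sum]
    refine Finset.sum_congr rfl fun pq _ => ?_
    simp only [S, Set.indicator, Set.mem_ofPred_eq, hc, Pi.one_apply]
    split_ifs <;> simp
  rw [← hF]
  have hI : ∫ ξ, F ξ ∂μ = ∑ pq ∈ Q, μ.real (S pq) := by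
    simp only [F]
    rw [integral_finsetSum _ h_int]
    exact Finset.sum_congr rfl fun pq _ => integral_indicator_one (hSm pq)
  set R := Q.filter fun pq => Near (x pq.1 ᵥ* A) (x pq.2 ᵥ* A) with hR
  have hRc : 2 * (R.card : ℝ) ≤ Q.card := by
    have h1 : (R.card : ℝ) ≤
        ((P ×ˢ P).filter fun pq => Near (x pq.1 ᵥ* A) (x pq.2 ᵥ* A)).card := by
      exact_mod_cast Finset.card_le_card (Finset.filter_subset_filter _ hQP)
    have hpos : (0 : ℝ) < Fintype.card ι := by exact_mod_cast Fintype.card_pos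
    have h2 : (Fintype.card ι : ℝ) * (2 * R.card) ≤ Fintype.card ι * Q.card := by nlinarith
    exact le_of_mul_le_mul_left h2 hpos
  have hbd : ∀ pq ∈ Q, μ.real (S pq) ≤
      3 / 4 + (if Near (x pq.1 ᵥ* A) (x pq.2 ᵥ* A) then 1 / 4 else 0) := by
    intro pq _
    split_ifs with h
    · have := measureReal_le_one (μ := μ) (s := S pq)
      linarith
    · rw [add_zero]
      apply measureReal_same_sign_le μ hinv
      rw [← real_inner_self_eq_norm_sq, ← real_inner_self_eq_norm_sq, hin, hin, hin]
      exact not_lt.1 h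
  have hsum := Finset.sum_le_sum hbd
  rw [Finset.sum_add_distrib, ← Finset.sum_filter, Finset.sum_const, Finset.sum_const,
    nsmul_eq_mul, nsmul_eq_mul] at hsum
  linarith
end Separating

end SharirSolomon

namespace SharirSolomon

open MvPolynomial Matrix

/-- The polynomial with coefficient `c i` at the monomial with exponent vector `i`. -/
noncomputable def boxPoly {M : ℕ} (c : (Fin 3 → Fin M) → ℝ) : MvPolynomial (Fin 3) ℝ :=
  ∑ i, monomial (Finsupp.equivFunOnFinite.symm fun k => (i k : ℕ)) (c i)

lemma eval_boxPoly {M : ℕ} (c : (Fin 3 → Fin M) → ℝ) (p : Fin 3 → ℝ) :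
    eval p (boxPoly c) = c ⬝ᵥ fun i => ∏ k, p k ^ (i k : ℕ) := by
  simp only [boxPoly, map_sum, eval_monomial, dotProduct]
  refine Finset.sum_congr rfl fun i _ => ?_
  rw [Finsupp.prod_fintype _ _ (fun _ => pow_zero _)]
  rfl

lemma boxPoly_ne_zero {M : ℕ} {c : (Fin 3 → Fin M) → ℝ} (hc : c ≠ 0) : boxPoly c ≠ 0 := by
  obtain ⟨i, hi⟩ := Function.ne_iff.1 hc
  intro h
  apply hi
  have h2 := congrArg (coeff (Finsupp.equivFunOnFinite.symm fun k => (i k : ℕ))) h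
  rw [boxPoly, coeff_sum, Finset.sum_eq_single i] at h2
  · simpa using h2
  · intro j _ hj
    rw [coeff_monomial, if_neg]
    intro he
    apply hj
    have := Finsupp.equivFunOnFinite.symm.injective he
    funext k
    exact Fin.ext (congrFun this k)
  · simp

lemma totalDegree_boxPoly_le {M : ℕ} (c : (Fin 3 → Fin M) → ℝ) :
    (boxPoly c).totalDegree ≤ 3 * M := by
  apply totalDegree_finsetSum_le
  intro i _
  refine (totalDegree_monomial_le _ _).trans ?_
  rw [Finsupp.sum_fintype _ _ (fun _ => rfl), Fin.sum_univ_three]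
  simp only [Finsupp.equivFunOnFinite_symm_apply_apply, id]
  have := (i 0).2; have := (i 1).2; have := (i 2).2
  omega

/-- The pairs of points of `P` at which all polynomials of the list have equal nonzero sign. -/
noncomputable def samePairs (P : Finset (Fin 3 → ℝ)) (gs : List (MvPolynomial (Fin 3) ℝ)) :
    Finset ((Fin 3 → ℝ) × (Fin 3 → ℝ)) :=
  (P ×ˢ P).filter fun pq => ∀ g ∈ gs, 0 < eval pq.1 g * eval pq.2 g

lemma exists_separating_poly (P : Finset (Fin 3 → ℝ)) (gs : List (MvPolynomial (Fin 3) ℝ))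
    {M : ℕ} (hM : 0 < M) : ∃ g : MvPolynomial (Fin 3) ℝ, g ≠ 0 ∧ g.totalDegree ≤ 3 * M ∧
      ((samePairs P (g :: gs)).card : ℝ) ≤
        max (7 / 8 * (samePairs P gs).card : ℝ) (16 * P.card ^ 2 / M ^ 3 : ℝ) := by
  by_cases h : 16 * (P.card : ℝ) ^ 2 ≤ M ^ 3 * (samePairs P gs).card ∧ P.Nonempty
  · have : Nonempty (Fin M) := ⟨⟨0, hM⟩⟩
    obtain ⟨c, hc, hle⟩ := exists_separating_vector (ι := Fin 3 → Fin M) h.2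
      (fun p i => ∏ k, p k ^ (i k : ℕ)) (Q := samePairs P gs) (Finset.filter_subset _ _) (by
        simpa using h.1)
    refine ⟨boxPoly c, boxPoly_ne_zero hc, totalDegree_boxPoly_le c, le_max_of_le_left ?_⟩
    have : samePairs P (boxPoly c :: gs) = (samePairs P gs).filter fun pq =>
        0 < eval pq.1 (boxPoly c) * eval pq.2 (boxPoly c) := by
      ext pq
      simp only [samePairs, Finset.mem_filter, List.forall_mem_cons]
      tauto
    rw [this]
    simp only [eval_boxPoly]
    linarith
  · refine ⟨1, one_ne_zero, by simp, le_max_of_le_right ?_⟩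
    have h1 : ((samePairs P (1 :: gs)).card : ℝ) ≤ (samePairs P gs).card := by
      gcongr
      intro pq
      simp only [samePairs, Finset.mem_filter, List.forall_mem_cons]
      tauto
    refine h1.trans ?_
    rw [le_div_iff₀ (by positivity)]
    rcases P.eq_empty_or_nonempty with rfl | hP
    · simp [samePairs]
    · have : ¬ (16 * (P.card : ℝ) ^ 2 ≤ M ^ 3 * (samePairs P gs).card) := fun h' => h ⟨h', hP⟩
      linarith

lemma exists_separating_list (P : Finset (Fin 3 → ℝ)) (gs : List (MvPolynomial (Fin 3) ℝ))
    (hgs : ∀ g ∈ gs, g ≠ 0) {M : ℕ} (hM : 0 < M) (k : ℕ) :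
    ∃ gs' : List (MvPolynomial (Fin 3) ℝ), (∀ g ∈ gs', g ≠ 0) ∧
      (gs'.map totalDegree).sum ≤ k * (3 * M) + (gs.map totalDegree).sum ∧
      ((samePairs P gs').card : ℝ) ≤
        max ((7 / 8) ^ k * (samePairs P gs).card : ℝ) (16 * P.card ^ 2 / M ^ 3 : ℝ) := by
  induction k with
  | zero => exact ⟨gs, hgs, by simp, by simp⟩
  | succ k ih =>
    obtain ⟨gs', h0, h1, h2⟩ := ih
    obtain ⟨g, hg0, hg1, hg2⟩ := exists_separating_poly P gs' hM
    refine ⟨g :: gs', by simpa using ⟨hg0, h0⟩, ?_, hg2.trans ?_⟩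
    · simp only [List.map_cons, List.sum_cons]
      linarith
    · apply max_le _ (le_max_right _ _)
      rcases le_max_iff.1 h2 with h | h
      · apply le_max_of_le_left
        rw [pow_succ]; linarith
      · apply le_max_of_le_right
        have : (0 : ℝ) ≤ (samePairs P gs').card := by positivity
        linarith

lemma exists_dyadic_separating_list (P : Finset (Fin 3 → ℝ)) (J : ℕ) :
    ∃ gs : List (MvPolynomial (Fin 3) ℝ), (∀ g ∈ gs, g ≠ 0) ∧
      (gs.map totalDegree).sum ≤ 96 * 2 ^ J ∧
      ((samePairs P gs).card : ℝ) ≤ 16 * P.card ^ 2 / 8 ^ J := by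
  induction J with
  | zero =>
    refine ⟨[], by simp, by simp, ?_⟩
    have : (samePairs P []).card ≤ P.card * P.card := by
      rw [← Finset.card_product]; exact Finset.card_le_card (Finset.filter_subset _ _)
    have : ((samePairs P []).card : ℝ) ≤ P.card * P.card := by exact_mod_cast this
    rw [pow_zero, div_one]
    nlinarith [sq_nonneg (P.card : ℝ)]
  | succ J ih =>
    obtain ⟨gs, h0, h1, h2⟩ := ih
    obtain ⟨gs', h0', h1', h2'⟩ := exists_separating_list P gs h0
      (M := 2 ^ (J + 1)) (by positivity) 16
    refine ⟨gs', h0', ?_, h2'.trans (max_le ?_ ?_)⟩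
    · rw [pow_succ] at h1' ⊢
      omega
    · rw [pow_succ (8 : ℝ), ← div_div]
      have : (7 / 8 : ℝ) ^ 16 ≤ 1 / 8 := by norm_num
      calc (7 / 8 : ℝ) ^ 16 * (samePairs P gs).card ≤ 1 / 8 * (16 * P.card ^ 2 / 8 ^ J) := by
            gcongr
        _ = _ := by ring
    · apply le_of_eq
      congr 1
      push_cast
      rw [← pow_mul, mul_comm, pow_mul]
      norm_num

theorem exists_separating_family (P : Finset (Fin 3 → ℝ)) {E : ℕ} (hE : 0 < E) :
    ∃ gs : List (MvPolynomial (Fin 3) ℝ), (∀ g ∈ gs, g ≠ 0) ∧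
      (gs.map totalDegree).sum ≤ E ∧
      ((samePairs P gs).card : ℝ) ≤ 16 * 192 ^ 3 * P.card ^ 2 / E ^ 3 := by
  by_cases h : E < 96
  · refine ⟨[], by simp, by simp, ?_⟩
    have : (samePairs P []).card ≤ P.card * P.card := by
      rw [← Finset.card_product]; exact Finset.card_le_card (Finset.filter_subset _ _)
    have : ((samePairs P []).card : ℝ) ≤ P.card * P.card := by exact_mod_cast this
    rw [le_div_iff₀ (by positivity)]
    have hE' : (E : ℝ) ^ 3 ≤ 192 ^ 3 := by
      gcongr; exact_mod_cast (by omega : E ≤ 192)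
    calc ((samePairs P []).card : ℝ) * E ^ 3 ≤ (P.card * P.card) * 192 ^ 3 := by gcongr
      _ ≤ _ := by nlinarith [sq_nonneg (P.card : ℝ)]
  · set J := Nat.log 2 (E / 96) with hJ
    have h1 : 2 ^ J ≤ E / 96 := Nat.pow_log_le_self 2 (by omega)
    have h2 : E / 96 < 2 ^ (J + 1) := Nat.lt_pow_succ_log_self (by norm_num) _
    obtain ⟨gs, h0, hd, hc⟩ := exists_dyadic_separating_list P J
    refine ⟨gs, h0, by omega, hc.trans ?_⟩
    rw [div_le_div_iff₀ (by positivity) (by positivity)]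
    have h3 : (E : ℝ) ≤ 192 * 2 ^ J := by
      rw [pow_succ] at h2
      exact_mod_cast (by omega : E ≤ 192 * 2 ^ J)
    calc 16 * (P.card : ℝ) ^ 2 * E ^ 3 ≤ 16 * (P.card : ℝ) ^ 2 * (192 * 2 ^ J) ^ 3 := by gcongr
      _ = 16 * 192 ^ 3 * (P.card : ℝ) ^ 2 * (2 ^ J) ^ 3 := by ring
      _ = _ := by
        congr 1
        rw [← pow_mul, mul_comm, pow_mul]; norm_num

end SharirSolomon

namespace SharirSolomon

open MvPolynomial

lemma card_sq_le_same_class {α : Type*} (T : Finset α) (κ : α → ℕ) {E : ℕ}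
    (hκ : ∀ x ∈ T, κ x ≤ E) :
    T.card ^ 2 ≤ (E + 1) * ((T ×ˢ T).filter fun xy => κ xy.1 = κ xy.2).card := by
  have hm : ∀ x ∈ T, κ x ∈ Finset.range (E + 1) := fun x hx => by
    have := hκ x hx
    simp; omega
  have h1 : ((T ×ˢ T).filter fun xy => κ xy.1 = κ xy.2).card =
      ∑ j ∈ Finset.range (E + 1), (T.filter fun x => κ x = j).card ^ 2 := by
    rw [Finset.card_eq_sum_card_fiberwise (f := fun xy : α × α => κ xy.1)
      (t := Finset.range (E + 1)) fun xy hxy => hm _ (by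
        rw [Finset.mem_coe, Finset.mem_filter, Finset.mem_product] at hxy; exact hxy.1.1)]
    refine Finset.sum_congr rfl fun j _ => ?_
    rw [sq, ← Finset.card_product]
    congr 1
    ext ⟨x, y⟩
    simp only [Finset.mem_filter, Finset.mem_product]
    grind
  rw [h1, Finset.card_eq_sum_card_fiberwise (s := T) (f := κ) (t := Finset.range (E + 1))
    fun x hx => hm x hx]
  refine sq_sum_le_card_mul_sum_sq.trans ?_
  rw [Finset.card_range, Nat.cast_id]

lemma mul_pos_of_no_root {q : Polynomial ℝ} {a b : ℝ} (hab : a ≤ b)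
    (h : ∀ t ∈ Set.Icc a b, q.eval t ≠ 0) : 0 < q.eval a * q.eval b := by
  by_contra! hle
  have h0 : (0 : ℝ) ∈ Set.uIcc (q.eval a) (q.eval b) := by
    rw [Set.mem_uIcc]
    rcases mul_nonpos_iff.1 hle with h | h
    · exact Or.inr ⟨h.2, h.1⟩
    · exact Or.inl h
  obtain ⟨t, ht, ht0⟩ := intermediate_value_uIcc (f := fun t => q.eval t)
    q.continuous.continuousOn h0
  rw [Set.uIcc_of_le hab] at ht
  exact h t ht ht0

/-- Along a line, the points off the zero set of the product are split by the product's roots into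
few classes, in each of which all polynomials of the list have constant sign. -/
lemma card_sq_le_samePairs {gs : List (MvPolynomial (Fin 3) ℝ)} {l : Set (Fin 3 → ℝ)}
    (hl : IsLine l) {T : Finset (Fin 3 → ℝ)} (hT : ∀ p ∈ T, p ∈ l ∧ eval p gs.prod ≠ 0) :
    T.card ^ 2 ≤ (gs.prod.totalDegree + 1) * (samePairs T gs).card := by
  rcases T.eq_empty_or_nonempty with rfl | ⟨p₀, hp₀⟩
  · simp
  obtain ⟨v, hv, hle⟩ := IsLine.exists_eq_ln hl (hT p₀ hp₀).1
  have hpar : ∀ p ∈ T, ∃ t : ℝ, p = p₀ + t • v := fun p hp => by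
    have := (hT p hp).1
    rw [hle] at this
    exact mem_ln.1 this
  choose! t ht using hpar
  set h := restr p₀ v gs.prod with hh
  have hev : ∀ p ∈ T, h.eval (t p) ≠ 0 := fun p hp => by
    rw [hh, eval_restr, ← ht p hp]; exact (hT p hp).2
  have hne : h ≠ 0 := fun h0 => hev p₀ hp₀ (by rw [h0, Polynomial.eval_zero])
  let κ : (Fin 3 → ℝ) → ℕ := fun p => (h.roots.toFinset.filter fun r => r < t p).card
  refine (card_sq_le_same_class T κ (E := gs.prod.totalDegree) fun p _ => ?_).trans ?_
  · refine (Finset.card_filter_le _ _).trans ?_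
    exact (Multiset.toFinset_card_le _).trans
      ((Polynomial.card_roots' _).trans (natDegree_restr_le _ _ _))
  · apply Nat.mul_le_mul_left
    apply Finset.card_le_card
    rintro ⟨p, q⟩ hpq
    simp only [Finset.mem_filter, Finset.mem_product, samePairs] at hpq ⊢
    obtain ⟨⟨hp, hq⟩, hk⟩ := hpq
    refine ⟨⟨hp, hq⟩, fun g hg => ?_⟩
    have main : ∀ p ∈ T, ∀ q ∈ T, κ p = κ q → t p ≤ t q → 0 < eval p g * eval q g := by
      intro p hp q hq hk hle
      conv_rhs => rw [ht p hp, ht q hq]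
      rw [← eval_restr, ← eval_restr]
      refine mul_pos_of_no_root hle fun r hr h0 => ?_
      have hr0 : h.eval r = 0 := by
        obtain ⟨g', hg'⟩ := List.dvd_prod hg
        rw [hh, hg', map_mul, Polynomial.eval_mul, h0, zero_mul]
      have hrq : r < t q := lt_of_le_of_ne hr.2 fun h' => hev q hq (h' ▸ hr0)
      have hsub : (h.roots.toFinset.filter fun r => r < t p) ⊆
          h.roots.toFinset.filter fun r => r < t q :=
        Finset.monotone_filter_right _ fun r _ hr => lt_of_lt_of_le hr hle
      have heq := Finset.eq_of_subset_of_card_le hsub hk.ge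
      have hrm : r ∈ h.roots.toFinset.filter fun r => r < t q := by
        rw [Finset.mem_filter, Multiset.mem_toFinset, Polynomial.mem_roots hne]
        exact ⟨hr0, hrq⟩
      rw [← heq, Finset.mem_filter] at hrm
      exact absurd hr.1 (not_le.2 hrm.2)
    rcases le_total (t p) (t q) with hle | hle
    · exact main p hp q hq hk hle
    · rw [mul_comm]; exact main q hq p hp hk.symm hle

/-- Polynomial partitioning for incidences with lines: off the zero set of a suitable polynomial of
degree at most `E`, points and lines have few incidences. -/
theorem exists_partition (P : Finset (Fin 3 → ℝ)) (L : Finset (Set (Fin 3 → ℝ)))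
    (hL : ∀ l ∈ L, IsLine l) {E : ℕ} (hE : 0 < E) :
    ∃ g : MvPolynomial (Fin 3) ℝ, g ≠ 0 ∧ g.totalDegree ≤ E ∧
      ((((P.filter fun p => eval p g ≠ 0) ×ˢ L).filter fun pl => pl.1 ∈ pl.2).card : ℝ) ≤
        2 * L.card * E + √(32 * 192 ^ 3 * L.card) * P.card / E := by
  obtain ⟨gs, h0, hd, hc⟩ := exists_separating_family P hE
  set g := gs.prod with hg
  have hgd : g.totalDegree ≤ E := (totalDegree_list_prod gs).trans hd
  refine ⟨g, List.prod_ne_zero fun h => h0 0 h rfl, hgd, ?_⟩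
  set P₁ := P.filter fun p => eval p g ≠ 0 with hP₁
  set T := (P₁ ×ˢ L).filter fun pl => pl.1 ∈ pl.2 with hT
  let S : Set (Fin 3 → ℝ) → Finset (Fin 3 → ℝ) := fun l => P₁.filter fun p => p ∈ l
  have hTS : T.card = ∑ l ∈ L, (S l).card := by
    rw [hT, Finset.card_filter, Finset.sum_product_right]
    simp only [S, Finset.card_filter]
  have hsum : ∑ l ∈ L, (samePairs (S l) gs).card ≤ T.card + (samePairs P gs).card := by
    have e1 : ∀ l ∈ L, (samePairs (S l) gs).card ≤
        (S l).card + ((samePairs P gs).filter fun pq => pq.1 ≠ pq.2 ∧ pq.1 ∈ l ∧ pq.2 ∈ l).card := by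
      intro l _
      have : samePairs (S l) gs ⊆ (S l).image (fun p => (p, p)) ∪
          (samePairs P gs).filter fun pq => pq.1 ≠ pq.2 ∧ pq.1 ∈ l ∧ pq.2 ∈ l := by
        rintro ⟨p, q⟩ hpq
        simp only [samePairs, Finset.mem_filter, Finset.mem_product, S, hP₁, Finset.mem_union,
          Finset.mem_image, Prod.mk.injEq] at hpq ⊢
        by_cases hpq' : p = q
        · exact Or.inl ⟨p, hpq.1.1, rfl, hpq'⟩
        · exact Or.inr ⟨⟨⟨hpq.1.1.1.1, hpq.1.2.1.1⟩, hpq.2⟩, hpq', hpq.1.1.2, hpq.1.2.2⟩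
      refine (Finset.card_le_card this).trans ((Finset.card_union_le _ _).trans ?_)
      exact Nat.add_le_add_right Finset.card_image_le _
    refine (Finset.sum_le_sum e1).trans ?_
    rw [Finset.sum_add_distrib, ← hTS]
    apply Nat.add_le_add_left
    simp only [Finset.card_filter _ (samePairs P gs)]
    rw [Finset.sum_comm, Finset.card_eq_sum_ones]
    refine Finset.sum_le_sum fun pq _ => ?_
    rw [← Finset.card_filter, Finset.card_le_one]
    intro l hl l' hl'
    rw [Finset.mem_filter] at hl hl'
    exact IsLine.eq_of_mem (hL l hl.1) (hL l' hl'.1) hl.2.2.1 hl.2.2.2 hl'.2.2.1 hl'.2.2.2 hl.2.1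
  have hsq : T.card ^ 2 ≤ L.card * ((E + 1) * (T.card + (samePairs P gs).card)) := by
    rw [hTS]
    refine sq_sum_le_card_mul_sum_sq.trans (Nat.mul_le_mul_left _ ?_)
    refine le_trans ?_ (Nat.mul_le_mul_left _ (hTS ▸ hsum))
    rw [Finset.mul_sum]
    refine Finset.sum_le_sum fun l hl => ?_
    refine (card_sq_le_samePairs (hL l hl) fun p hp => ?_).trans
      (Nat.mul_le_mul_right _ (Nat.add_le_add_right hgd 1))
    simp only [S, hP₁, Finset.mem_filter] at hp
    exact ⟨hp.2, hp.1.2⟩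
  have hsqR : (T.card : ℝ) ^ 2 ≤ L.card * ((E + 1) * (T.card + (samePairs P gs).card)) := by
    exact_mod_cast hsq
  have hE1 : (1 : ℝ) ≤ E := by exact_mod_cast hE
  have hfin := le_of_sq_le (T := T.card) (m := L.card * (2 * E))
    (X := 16 * 192 ^ 3 * P.card ^ 2 / E ^ 3) (B := 1) (by positivity) (by positivity) zero_le_one
    (hsqR.trans (by
      rw [one_mul, mul_assoc, add_comm (T.card : ℝ)]
      gcongr
      linarith))
  refine hfin.trans (le_of_eq ?_)
  congr 1
  · ring
  · have : (L.card * (2 * E) * (16 * 192 ^ 3 * P.card ^ 2 / E ^ 3) : ℝ) =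
        32 * 192 ^ 3 * L.card * (P.card / E) ^ 2 := by field_simp; ring
    rw [this, Real.sqrt_mul (by positivity), Real.sqrt_sq (by positivity), mul_div_assoc]

/-- The number of incidences between `P` and `L`. -/
noncomputable def inc (P : Finset (Fin 3 → ℝ)) (L : Finset (Set (Fin 3 → ℝ))) : ℕ :=
  ((P ×ˢ L).filter fun pl => pl.1 ∈ pl.2).card

lemma inc_eq_sum_lines (P : Finset (Fin 3 → ℝ)) (L : Finset (Set (Fin 3 → ℝ))) :
    inc P L = ∑ l ∈ L, (P.filter fun p => p ∈ l).card := by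
  rw [inc, Finset.card_filter, Finset.sum_product_right]
  simp only [Finset.card_filter]

lemma inc_eq_sum_points (P : Finset (Fin 3 → ℝ)) (L : Finset (Set (Fin 3 → ℝ))) :
    inc P L = ∑ p ∈ P, (L.filter fun l => p ∈ l).card := by
  rw [inc, Finset.card_filter, Finset.sum_product]
  simp only [Finset.card_filter]

lemma sum_offDiag_le {L : Finset (Set (Fin 3 → ℝ))} (hL : ∀ l ∈ L, IsLine l)
    (P : Finset (Fin 3 → ℝ)) :
    ∑ p ∈ P, (L.filter fun l => p ∈ l).offDiag.card ≤ L.card ^ 2 := by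
  rw [← Finset.card_biUnion]
  · rw [sq, ← Finset.card_product]
    refine Finset.card_le_card fun lm h => ?_
    obtain ⟨p, _, h⟩ := Finset.mem_biUnion.1 h
    rw [Finset.mem_offDiag] at h
    exact Finset.mem_product.2 ⟨Finset.filter_subset _ _ h.1, Finset.filter_subset _ _ h.2.1⟩
  · intro p _ q _ hpq
    refine Finset.disjoint_left.2 fun lm h h' => ?_
    rw [Finset.mem_offDiag, Finset.mem_filter, Finset.mem_filter] at h h'
    exact h.2.2 (IsLine.eq_of_mem (hL _ h.1.1) (hL _ h.2.1.1) h.1.2 h'.1.2 h.2.1.2 h'.2.1.2 hpq)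

/-- The total number of lines in the planes of a family, with multiplicity. -/
lemma sum_card_planes_le {Φ : Finset (MvPolynomial (Fin 3) ℝ)} (hΦ : IrrFamily Φ)
    (h1 : ∀ φ ∈ Φ, φ.totalDegree = 1) {L : Finset (Set (Fin 3 → ℝ))} (hL : ∀ l ∈ L, IsLine l) :
    ∑ φ ∈ Φ, (L.filter fun l => l ⊆ zset φ).card ≤ L.card + 3 * Φ.card ^ 2 := by
  have e1 : ∑ φ ∈ Φ, (L.filter fun l => l ⊆ zset φ).card =
      ∑ l ∈ L, (Φ.filter fun φ => l ⊆ zset φ).card := by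
    simp only [Finset.card_filter]; exact Finset.sum_comm
  have e2 : ∑ l ∈ L, (Φ.filter fun φ => l ⊆ zset φ).offDiag.card ≤ 3 * Φ.card ^ 2 := by
    have : ∀ l, (Φ.filter fun φ => l ⊆ zset φ).offDiag =
        Φ.offDiag.filter fun q => l ⊆ zset q.1 ∧ l ⊆ zset q.2 := by
      intro l; ext q
      simp only [Finset.mem_offDiag, Finset.mem_filter]; tauto
    simp only [this, Finset.card_filter]
    rw [Finset.sum_comm]
    simp only [← Finset.card_filter]
    have h3 : ∀ q ∈ Φ.offDiag, (L.filter fun l => l ⊆ zset q.1 ∧ l ⊆ zset q.2).card ≤ 3 := by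
      intro q hq
      rw [Finset.mem_offDiag] at hq
      have := card_common_lines_le q.1 q.2 (hΦ.1 _ hq.1)
        (fun h => hq.2.2 (hΦ.2 _ hq.1 _ hq.2.1 h))
        (L.filter fun l => l ⊆ zset q.1 ∧ l ⊆ zset q.2) (fun l hl => by
          rw [Finset.mem_filter] at hl
          exact ⟨hL l hl.1, hl.2⟩)
      rw [h1 _ hq.1, h1 _ hq.2.1] at this
      exact this
    refine (Finset.sum_le_sum h3).trans ?_
    rw [Finset.sum_const, smul_eq_mul, mul_comm, Finset.offDiag_card, sq]
    omega
  rw [e1]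
  have e3 : ∀ l ∈ L, (Φ.filter fun φ => l ⊆ zset φ).card ≤
      1 + (Φ.filter fun φ => l ⊆ zset φ).offDiag.card := by
    intro l _
    rw [Finset.offDiag_card]
    set r := (Φ.filter fun φ => l ⊆ zset φ).card
    rcases r with _ | _ | r
    · simp
    · simp
    · have : (r + 1 + 1) * (r + 1 + 1) = r * r + 4 * r + 4 := by ring
      rw [this]
      have := Nat.zero_le (r * r)
      omega
  refine (Finset.sum_le_sum e3).trans ?_
  rw [Finset.sum_add_distrib, Finset.sum_const, smul_eq_mul, mul_one]
  omega

/-- Points lying on a union of planes, each on at least two lines, have few incidences. -/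
theorem inc_planes_le {Φ : Finset (MvPolynomial (Fin 3) ℝ)} (hΦ : IrrFamily Φ)
    (h1 : ∀ φ ∈ Φ, φ.totalDegree = 1) {L : Finset (Set (Fin 3 → ℝ))} (hL : ∀ l ∈ L, IsLine l)
    {s : ℕ} (hs : ∀ π, IsPlane π → (L.filter fun l => l ⊆ π).card ≤ s)
    {P : Finset (Fin 3 → ℝ)} (hP : ∀ p ∈ P, ∃ φ ∈ Φ, p ∈ zset φ)
    (hk : ∀ p ∈ P, 2 ≤ (L.filter fun l => p ∈ l).card) :
    (inc P L : ℝ) ≤ 2 * L.card * Φ.card + √(2 * P.card * (s * (L.card + 3 * Φ.card ^ 2))) := by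
  choose! π hπΦ hπ using hP
  let u : (Fin 3 → ℝ) → ℕ := fun p => (L.filter fun l => p ∈ l ∧ ¬ l ⊆ zset (π p)).card
  let t : (Fin 3 → ℝ) → ℕ := fun p => (L.filter fun l => p ∈ l ∧ l ⊆ zset (π p)).card
  have hkt : ∀ p, (L.filter fun l => p ∈ l).card = t p + u p := fun p => by
    rw [← Finset.card_filter_add_card_filter_not (s := L.filter fun l => p ∈ l)
      (fun l => l ⊆ zset (π p)), Finset.filter_filter, Finset.filter_filter]
  have hu : ∑ p ∈ P, u p ≤ L.card * Φ.card := by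
    simp only [u, Finset.card_filter]
    rw [Finset.sum_comm]
    simp only [← Finset.card_filter]
    rw [← smul_eq_mul]
    refine Finset.sum_le_card_nsmul _ _ _ fun l hl => ?_
    refine Finset.card_le_card_of_injOn π ?_ ?_
    · intro p hp
      rw [Finset.mem_coe, Finset.mem_filter] at hp
      exact hπΦ p hp.1
    · intro p hp q hq hpq
      rw [Finset.mem_coe, Finset.mem_filter] at hp hq
      by_contra hne
      have := card_points_on_line_le (hL l hl) hp.2.2 {p, q} (fun x hx => by
        rw [Finset.mem_insert, Finset.mem_singleton] at hx
        rcases hx with rfl | rfl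
        · exact ⟨hp.2.1, hπ _ hp.1⟩
        · exact ⟨hq.2.1, hpq ▸ hπ _ hq.1⟩)
      rw [Finset.card_pair hne, h1 _ (hπΦ p hp.1)] at this
      omega
  have ht : ∑ p ∈ P, t p * (t p - 1) ≤ s * (L.card + 3 * Φ.card ^ 2) := by
    rw [← Finset.sum_fiberwise_of_maps_to (s := P) (t := Φ) (g := π) hπΦ]
    have e : ∀ φ ∈ Φ, ∑ p ∈ P.filter (fun p => π p = φ), t p * (t p - 1) ≤
        s * (L.filter fun l => l ⊆ zset φ).card := by
      intro φ hφ
      have h := sum_offDiag_le (L := L.filter fun l => l ⊆ zset φ)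
        (fun l hl => hL l (Finset.filter_subset _ _ hl)) (P.filter fun p => π p = φ)
      refine le_trans (le_of_eq ?_) (h.trans ?_)
      · refine Finset.sum_congr rfl fun p hp => ?_
        rw [Finset.mem_filter] at hp
        have : (L.filter fun l => l ⊆ zset φ).filter (fun l => p ∈ l) =
            L.filter fun l => p ∈ l ∧ l ⊆ zset (π p) := by
          rw [Finset.filter_filter, hp.2]; simp only [and_comm]
        rw [this, Finset.offDiag_card, Nat.mul_sub_one]
      · rw [sq]
        exact Nat.mul_le_mul_right _ (hs _ (isPlane_zset (h1 φ hφ)))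
    refine (Finset.sum_le_sum e).trans ?_
    rw [← Finset.mul_sum]
    exact Nat.mul_le_mul_left _ (sum_card_planes_le hΦ h1 hL)
  set P₂ := P.filter fun p => 2 ≤ t p with hP₂
  have hT : (∑ p ∈ P₂, t p) ^ 2 ≤ 2 * P.card * (s * (L.card + 3 * Φ.card ^ 2)) := by
    refine sq_sum_le_card_mul_sum_sq.trans ?_
    rw [mul_comm 2, mul_assoc]
    refine Nat.mul_le_mul (Finset.card_filter_le _ _) ?_
    refine le_trans ?_ (Nat.mul_le_mul_left 2 ht)
    rw [Finset.mul_sum]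
    refine le_trans (Finset.sum_le_sum fun p hp => ?_)
      (Finset.sum_le_sum_of_subset (Finset.filter_subset _ _))
    rw [Finset.mem_filter] at hp
    obtain ⟨r, hr⟩ := Nat.exists_eq_add_of_le hp.2
    rw [hr]
    have : 2 + r - 1 = r + 1 := by omega
    rw [this]
    nlinarith
  have hI : inc P L ≤ 2 * (L.card * Φ.card) + ∑ p ∈ P₂, t p := by
    rw [inc_eq_sum_points]
    refine le_trans ?_ (Nat.add_le_add_right (Nat.mul_le_mul_left 2 hu) _)
    rw [hP₂, Finset.sum_filter, Finset.mul_sum, ← Finset.sum_add_distrib]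
    refine Finset.sum_le_sum fun p hp => ?_
    have := hk p hp
    rw [hkt p] at this ⊢
    split_ifs <;> omega
  have hT' : ((∑ p ∈ P₂, t p : ℕ) : ℝ) ≤ √(2 * P.card * (s * (L.card + 3 * Φ.card ^ 2))) := by
    apply Real.le_sqrt_of_sq_le
    exact_mod_cast hT
  have hI' : (inc P L : ℝ) ≤ 2 * (L.card * Φ.card) + ((∑ p ∈ P₂, t p : ℕ) : ℝ) := by
    exact_mod_cast hI
  linarith

lemma half_le_floor {x : ℝ} (hx : 1 ≤ x) : x / 2 ≤ ⌊x⌋₊ := by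
  have h1 : (1 : ℝ) ≤ ⌊x⌋₊ := by exact_mod_cast Nat.le_floor (by simpa using hx)
  have h2 := Nat.lt_floor_add_one x
  linarith

/-- Partitioning with a real degree bound. -/
lemma exists_partition_real : ∃ C : ℝ, 1 ≤ C ∧ ∀ (P : Finset (Fin 3 → ℝ))
    (L : Finset (Set (Fin 3 → ℝ))), (∀ l ∈ L, IsLine l) → ∀ x : ℝ, 1 ≤ x →
    ∃ g : MvPolynomial (Fin 3) ℝ, g ≠ 0 ∧ (g.totalDegree : ℝ) ≤ x ∧
      (inc (P.filter fun p => eval p g ≠ 0) L : ℝ) ≤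
        2 * L.card * x + 2 * C * (√L.card * P.card / x) := by
  refine ⟨√(32 * 192 ^ 3), by rw [Real.one_le_sqrt]; norm_num, fun P L hL x hx => ?_⟩
  have hE : 0 < ⌊x⌋₊ := Nat.floor_pos.2 hx
  obtain ⟨g, hg, hd, hI⟩ := exists_partition P L hL hE
  have hfl : (⌊x⌋₊ : ℝ) ≤ x := Nat.floor_le (by linarith)
  have hhalf := half_le_floor hx
  have hx0 : 0 < x := by linarith
  refine ⟨g, hg, le_trans (by exact_mod_cast hd) hfl, ?_⟩
  refine le_trans hI ?_
  refine add_le_add (by gcongr) ?_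
  rw [Real.sqrt_mul (by positivity)]
  calc √(32 * 192 ^ 3) * √L.card * P.card / (⌊x⌋₊ : ℝ)
      ≤ √(32 * 192 ^ 3) * √L.card * P.card / (x / 2) := by gcongr
    _ = _ := by field_simp

set_option maxHeartbeats 1000000 in
theorem exists_small_partition {ε : ℝ} (hε : 0 < ε) (hε1 : ε ≤ 1) :
    ∃ A K : ℝ, 1 ≤ A ∧ 1 ≤ K ∧ ∀ (P : Finset (Fin 3 → ℝ)) (L : Finset (Set (Fin 3 → ℝ)))
      (s : ℕ) (h : ℝ), (∀ l ∈ L, IsLine l) → L.card ≤ s ^ 2 → P.Nonempty →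
      (∀ p ∈ P, K ≤ (L.filter fun l => p ∈ l).card) → P.card ≤ 3 * L.card * h →
      A ^ 2 * P.card * s ≤ h ^ 2 * L.card → A ≤ h →
      ∃ g : MvPolynomial (Fin 3) ℝ, g ≠ 0 ∧ (g.totalDegree : ℝ) ≤ ε * h ∧
        (g.totalDegree : ℝ) ^ 2 ≤ ε * L.card ∧
        (inc (P.filter fun p => eval p g ≠ 0) L : ℝ) ≤ ε * L.card * h := by
  set a : ℝ := ε / 8 with ha
  have ha0 : 0 < a := by positivity
  obtain ⟨C, hC1, hpart⟩ := exists_partition_real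
  refine ⟨C / a, C / a * (2 * a + 6 * C / a) / a + 1 / a ^ 2, ?_, ?_, ?_⟩
  · rw [le_div_iff₀ ha0]; linarith
  · have : 1 ≤ 1 / a ^ 2 := by
      rw [le_div_iff₀ (by positivity), one_mul, sq_le_one_iff₀ ha0.le]; linarith
    have : 0 ≤ C / a * (2 * a + 6 * C / a) / a := by positivity
    linarith
  intro P L s h hL hns hPn hK hm hh hAh
  set m : ℝ := (P.card : ℝ) with hm'
  set n : ℝ := (L.card : ℝ) with hn'
  have hn0 : 0 ≤ n := by positivity
  have hm0 : 0 ≤ m := by positivity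
  have hAa : 1 / a ≤ C / a := by gcongr
  have hh0 : 0 < h := lt_of_lt_of_le (by positivity) (hAa.trans hAh)
  have hah : 1 ≤ a * h := by
    have := hAa.trans hAh
    rw [div_le_iff₀ ha0] at this; linarith
  have hsn : √n ≤ s := by
    apply Real.sqrt_le_iff.2 ⟨by positivity, ?_⟩
    rw [hn']; exact_mod_cast hns
  have hsq : √n ^ 2 = n := Real.sq_sqrt hn0
  have hs0 : 0 ≤ √n := Real.sqrt_nonneg n
  rcases le_or_gt h √n with hcase | hcase
  · obtain ⟨g, hg, hd, hI⟩ := hpart P L hL _ hah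
    refine ⟨g, hg, hd.trans (by nlinarith), ?_, hI.trans ?_⟩
    · calc (g.totalDegree : ℝ) ^ 2 ≤ (a * √n) ^ 2 := by
            gcongr; exact hd.trans (by gcongr)
        _ = a ^ 2 * n := by rw [mul_pow, hsq]
        _ ≤ ε * n := by gcongr; nlinarith
    · have h1 : (C / a) ^ 2 * m * √n ≤ h ^ 2 * n :=
        le_trans (by gcongr) hh
      have h2 : C * (√n * m / (a * h)) ≤ a * (n * h) := by
        rw [mul_div_assoc', div_le_iff₀ (by positivity)]
        rw [div_pow, div_mul_eq_mul_div, div_mul_eq_mul_div, div_le_iff₀ (by positivity)] at h1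
        calc C * (√n * m) ≤ C ^ 2 * m * √n := by
              have : C ≤ C ^ 2 := by nlinarith
              calc C * (√n * m) ≤ C ^ 2 * (√n * m) := by gcongr
                _ = _ := by ring
          _ ≤ _ := h1
          _ = _ := by ring
      have h3 : 0 ≤ n * h := by positivity
      calc 2 * n * (a * h) + 2 * C * (√n * m / (a * h))
          = 2 * a * (n * h) + 2 * (C * (√n * m / (a * h))) := by ring
        _ ≤ 2 * a * (n * h) + 2 * (a * (n * h)) := by gcongr
        _ ≤ ε * n * h := by rw [ha]; nlinarith
  · set K : ℝ := C / a * (2 * a + 6 * C / a) / a + 1 / a ^ 2 with hKdef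
    have hK0 : 0 < K := by positivity
    have hx : 1 ≤ a * √n := by
      obtain ⟨p, hp⟩ := hPn
      have h1 := hK p hp
      have h2 : ((L.filter fun l => p ∈ l).card : ℝ) ≤ n := by
        rw [hn']; exact_mod_cast Finset.card_filter_le _ _
      have h3 : 1 / a ^ 2 ≤ n := by
        have : 0 ≤ C / a * (2 * a + 6 * C / a) / a := by positivity
        linarith
      rw [div_le_iff₀ (by positivity)] at h3
      have h4 : 1 ^ 2 ≤ (a * √n) ^ 2 := by rw [mul_pow, hsq]; linarith
      exact (sq_le_sq₀ zero_le_one (by positivity)).1 h4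
    have hn1 : 0 < √n := by
      by_contra! h0
      have : a * √n ≤ 0 := mul_nonpos_of_nonneg_of_nonpos ha0.le h0
      linarith
    obtain ⟨g₁, hg₁, hd₁, hI₁⟩ := hpart P L hL _ hx
    set P₁ := P.filter fun p => eval p g₁ ≠ 0 with hP₁
    obtain ⟨g₂, hg₂, hd₂, hI₂⟩ := hpart P₁ L hL _ hx
    have hdiv : ∀ y : ℝ, √n * y / (a * √n) = y / a := fun y => by field_simp
    rw [← hn', hdiv] at hI₁ hI₂
    have hm₁ : K * P₁.card ≤ inc P₁ L := by
      rw [inc_eq_sum_points, Nat.cast_sum, mul_comm, ← nsmul_eq_mul]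
      exact Finset.card_nsmul_le_sum _ _ _ fun p hp => hK p (Finset.filter_subset _ _ hp)
    have hdeg : ((g₁ * g₂).totalDegree : ℝ) ≤ 2 * (a * √n) := by
      have : ((g₁ * g₂).totalDegree : ℝ) ≤ g₁.totalDegree + g₂.totalDegree := by
        exact_mod_cast totalDegree_mul _ _
      linarith
    have hlt : a * √n ≤ a * h := by gcongr
    have hfil : (P.filter fun p => eval p (g₁ * g₂) ≠ 0) = P₁.filter fun p => eval p g₂ ≠ 0 := by
      rw [hP₁, Finset.filter_filter]
      refine Finset.filter_congr fun p _ => ?_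
      rw [map_mul, mul_ne_zero_iff]
    refine ⟨g₁ * g₂, mul_ne_zero hg₁ hg₂, hdeg.trans (by nlinarith), ?_, ?_⟩
    · calc ((g₁ * g₂).totalDegree : ℝ) ^ 2 ≤ (2 * (a * √n)) ^ 2 := by gcongr
        _ = 4 * a ^ 2 * n := by rw [mul_pow, mul_pow, hsq]; ring
        _ ≤ ε * n := by gcongr; nlinarith
    · rw [hfil]
      have hnh : 0 ≤ n * h := by positivity
      have b1 : (inc P₁ L : ℝ) ≤ 2 * (a + 3 * C / a) * (n * h) * 1 := by
        refine hI₁.trans ?_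
        have e1 : 2 * n * (a * √n) ≤ 2 * a * (n * h) := by nlinarith
        have e2 : 2 * C * (m / a) ≤ 2 * C * (3 * n * h / a) := by gcongr
        calc _ ≤ 2 * a * (n * h) + 2 * C * (3 * n * h / a) := add_le_add e1 e2
          _ = _ := by ring
      have b2 : C / a * P₁.card ≤ a * (n * h) := by
        have e1 : C / a * (2 * a + 6 * C / a) / a * P₁.card ≤ 2 * (a + 3 * C / a) * (n * h) := by
          have : C / a * (2 * a + 6 * C / a) / a * P₁.card ≤ K * P₁.card := by
            gcongr
            rw [hKdef]
            have : 0 ≤ 1 / a ^ 2 := by positivity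
            linarith
          linarith
        have hq : 0 < 2 * (a + 3 * C / a) := by positivity
        have e2 : 2 * (a + 3 * C / a) * (C / a * P₁.card) ≤
            2 * (a + 3 * C / a) * (a * (n * h)) := by
          have : C / a * (2 * a + 6 * C / a) / a * P₁.card * a =
            2 * (a + 3 * C / a) * (C / a * P₁.card) := by field_simp; ring
          nlinarith
        exact le_of_mul_le_mul_left e2 hq
      refine hI₂.trans ?_
      have e1 : 2 * n * (a * √n) ≤ 2 * a * (n * h) := by nlinarith
      have e2 : 2 * C * ((P₁.card : ℝ) / a) = 2 * (C / a * P₁.card) := by ring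
      rw [e2, mul_assoc ε, ← mul_div_cancel₀ ε (by norm_num : (8 : ℝ) ≠ 0)]
      nlinarith

lemma one_le_totalDegree_of_irreducible {φ : MvPolynomial (Fin 3) ℝ} (hφ : Irreducible φ) :
    1 ≤ φ.totalDegree := by
  by_contra! h
  have h0 : φ.totalDegree = 0 := by omega
  rw [totalDegree_eq_zero_iff_eq_C] at h0
  have hne : φ.coeff 0 ≠ 0 := fun h => hφ.ne_zero (by rw [h0, h, C_0])
  exact hφ.not_isUnit (by rw [h0]; exact (isUnit_iff_ne_zero.2 hne).map C)

lemma card_lines_le_two {f : MvPolynomial (Fin 3) ℝ} {p : Fin 3 → ℝ} (hp : ¬ TriplePoint f p)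
    {L : Finset (Set (Fin 3 → ℝ))} (hL : ∀ l ∈ L, IsLine l ∧ l ⊆ zset f) :
    (L.filter fun l => p ∈ l).card ≤ 2 := by
  by_contra! h
  obtain ⟨a, ha, b, hb, c, hc, hab, hac, hbc⟩ := Finset.two_lt_card.1 h
  rw [Finset.mem_filter] at ha hb hc
  exact hp ⟨a, b, c, (hL a ha.1).1, (hL b hb.1).1, (hL c hc.1).1, hab, hac, hbc, ha.2, hb.2, hc.2,
    (hL a ha.1).2, (hL b hb.1).2, (hL c hc.1).2⟩

/-- The lines not contained in the zero set of `g` and their incidences are few. -/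
lemma lines_off_zset_le {P : Finset (Fin 3 → ℝ)} {L : Finset (Set (Fin 3 → ℝ))}
    (hL : ∀ l ∈ L, IsLine l) {g : MvPolynomial (Fin 3) ℝ} {h ε : ℝ} (hh : 0 < h)
    (hε1 : ε ≤ 1 / 400) (hD : (g.totalDegree : ℝ) ≤ ε * h)
    (hI : (inc (P.filter fun p => eval p g ≠ 0) L : ℝ) ≤ ε * L.card * h)
    (hl : ∀ l ∈ L, h ≤ (P.filter fun p => p ∈ l).card) :
    ((L.filter fun l => ¬ l ⊆ zset g).card : ℝ) ≤ 2 * ε * L.card ∧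
      (inc P (L.filter fun l => ¬ l ⊆ zset g) : ℝ) ≤ 2 * ε * L.card * h := by
  set L₁ := L.filter fun l => ¬ l ⊆ zset g with hL₁
  set P₀ := P.filter fun p => eval p g ≠ 0 with hP₀
  have hε : 0 ≤ ε := by
    by_contra! h0
    have : ε * h < 0 := mul_neg_of_neg_of_pos h0 hh
    have : (0 : ℝ) ≤ g.totalDegree := by positivity
    linarith
  have hsplit : ∀ l ∈ L₁, ((P.filter fun p => p ∈ l).card : ℝ) ≤
      (P₀.filter fun p => p ∈ l).card + g.totalDegree := by
    intro l hlL
    rw [hL₁, Finset.mem_filter] at hlL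
    have := card_points_on_line_le (hL l hlL.1) hlL.2
      ((P.filter fun p => p ∈ l).filter fun p => eval p g = 0) (fun p hp => by
        rw [Finset.mem_filter, Finset.mem_filter] at hp; exact ⟨hp.1.2, hp.2⟩)
    have h2 := Finset.card_filter_add_card_filter_not (s := P.filter fun p => p ∈ l)
      (fun p => eval p g = 0)
    have h3 : (P.filter fun p => p ∈ l).filter (fun p => ¬ eval p g = 0) =
        P₀.filter fun p => p ∈ l := by
      rw [hP₀, Finset.filter_filter, Finset.filter_filter]; simp only [and_comm, ne_eq]
    rw [h3] at h2
    exact_mod_cast (by omega : (P.filter fun p => p ∈ l).card ≤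
      (P₀.filter fun p => p ∈ l).card + g.totalDegree)
  have hsub : ∑ l ∈ L₁, ((P₀.filter fun p => p ∈ l).card : ℝ) ≤ ε * L.card * h := by
    refine le_trans ?_ hI
    rw [inc_eq_sum_lines, Nat.cast_sum]
    exact Finset.sum_le_sum_of_subset_of_nonneg (Finset.filter_subset _ _)
      fun _ _ _ => by positivity
  have hn₁ : (L₁.card : ℝ) ≤ 2 * ε * L.card := by
    have e : (L₁.card : ℝ) * (h / 2) ≤ ∑ l ∈ L₁, ((P₀.filter fun p => p ∈ l).card : ℝ) := by
      rw [← nsmul_eq_mul]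
      refine Finset.card_nsmul_le_sum _ _ _ fun l hlL => ?_
      have h1 := hsplit l hlL
      have h2 := hl l (Finset.filter_subset _ _ hlL)
      have h3 : ε * h ≤ 1 / 400 * h := by gcongr
      linarith
    have : (L₁.card : ℝ) * h ≤ 2 * ε * L.card * h := by linarith
    exact le_of_mul_le_mul_right this hh
  refine ⟨hn₁, ?_⟩
  rw [inc_eq_sum_lines, Nat.cast_sum]
  refine (Finset.sum_le_sum hsplit).trans ?_
  rw [Finset.sum_add_distrib, Finset.sum_const, nsmul_eq_mul]
  have e1 : (L₁.card : ℝ) * g.totalDegree ≤ 2 * ε * L.card * (1 / 400 * h) := by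
    gcongr
    exact hD.trans (by gcongr)
  have e2 : 0 ≤ ε * L.card * h := by positivity
  linarith

/-- If `g` captures almost all incidences of lines rich in points, then at least half of the lines
lie on planes dividing `g`. -/
theorem exists_planes {P : Finset (Fin 3 → ℝ)} {L : Finset (Set (Fin 3 → ℝ))}
    (hL : ∀ l ∈ L, IsLine l) {g : MvPolynomial (Fin 3) ℝ} (hg : g ≠ 0) {h ε : ℝ} (hh : 0 < h)
    (hε1 : ε ≤ 1 / 400) (hD : (g.totalDegree : ℝ) ≤ ε * h)
    (hDn : (g.totalDegree : ℝ) ^ 2 ≤ ε * L.card)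
    (hI : (inc (P.filter fun p => eval p g ≠ 0) L : ℝ) ≤ ε * L.card * h)
    (hl : ∀ l ∈ L, h ≤ (P.filter fun p => p ∈ l).card)
    (hk : ∀ p ∈ P, 3 ≤ (L.filter fun l => p ∈ l).card) :
    ∃ Φ : Finset (MvPolynomial (Fin 3) ℝ), IrrFamily Φ ∧ (∀ φ ∈ Φ, φ.totalDegree = 1) ∧
      Φ.card ≤ g.totalDegree ∧
      (L.card : ℝ) / 2 ≤ (L.filter fun l => ∃ φ ∈ Φ, l ⊆ zset φ).card := by
  obtain ⟨hn₁, hI₁⟩ := lines_off_zset_le hL hh hε1 hD hI hl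
  set L₁ := L.filter fun l => ¬ l ⊆ zset g with hL₁
  obtain ⟨Φ, hΦ, -, hdeg, hz⟩ := exists_irrFamily g hg
  set Φ₁ := Φ.filter fun φ => φ.totalDegree = 1 with hΦ₁
  have hmem₁ : ∀ φ ∈ Φ₁, φ ∈ Φ ∧ φ.totalDegree = 1 := fun φ hφ => Finset.mem_filter.1 hφ
  refine ⟨Φ₁, ⟨fun φ hφ => hΦ.1 φ (hmem₁ φ hφ).1,
    fun φ hφ ψ hψ => hΦ.2 φ (hmem₁ φ hφ).1 ψ (hmem₁ ψ hψ).1⟩, fun φ hφ => (hmem₁ φ hφ).2, ?_, ?_⟩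
  · refine le_trans ?_ hdeg
    refine le_trans ?_ (Finset.sum_le_sum_of_subset (Finset.filter_subset
      (fun φ => φ.totalDegree = 1) Φ))
    rw [Finset.card_eq_sum_ones]
    exact Finset.sum_le_sum fun φ hφ => (hmem₁ φ hφ).2.ge
  set L' := L.filter fun l => l ⊆ zset g with hL'
  have hL'mem : ∀ l ∈ L', IsLine l ∧ l ⊆ zset (∏ φ ∈ Φ, φ) := fun l hlL => by
    rw [hL', Finset.mem_filter] at hlL
    exact ⟨hL l hlL.1, hz ▸ hlL.2⟩
  obtain ⟨G, hG⟩ := exists_familyControl hΦ L' fun l hlL => (hL'mem l hlL).1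
  have hB := card_badLines_le hΦ (fun l hlL => (hL'mem l hlL).1) hG hdeg
  set B := badLines Φ L' G with hBdef
  set Lp := L.filter fun l => ∃ φ ∈ Φ₁, l ⊆ zset φ with hLp
  set L₂ := L' \ (Lp ∪ B) with hL₂
  set Pn := P.filter fun p => p ∈ zset g ∧ ¬ TriplePoint (∏ φ ∈ Φ, φ) p with hPn
  have hrich : ∀ l ∈ L₂, h / 2 ≤ ((Pn.filter fun p => p ∈ l).card : ℝ) := by
    intro l hlL
    rw [hL₂, Finset.mem_sdiff, Finset.mem_union, not_or] at hlL
    obtain ⟨hl', hlp, hlB⟩ := hlL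
    have hlL : l ∈ L ∧ l ⊆ zset g := Finset.mem_filter.1 hl'
    obtain ⟨φ, hφ, hlφ⟩ := exists_subset_zset (hL'mem l hl').1 (hL'mem l hl').2
    have h2 : 2 ≤ φ.totalDegree := by
      have h1 := one_le_totalDegree_of_irreducible (hΦ.1 φ hφ)
      rcases Nat.lt_or_ge 1 φ.totalDegree with h | h
      · exact h
      · exact absurd (Finset.mem_filter.2 ⟨hlL.1, φ,
          Finset.mem_filter.2 ⟨hφ, le_antisymm h h1⟩, hlφ⟩) hlp
    have hlG : ¬ l ⊆ zset (G φ) := fun hG' => hlB (Finset.mem_filter.2 ⟨hl', φ, hφ, h2, hlφ, hG'⟩)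
    have hT := card_triple_le (fun l hlL => (hL'mem l hlL).1) hG hφ h2 hl' hlφ hlG
      ((P.filter fun p => p ∈ l).filter fun p => TriplePoint (∏ φ ∈ Φ, φ) p) (fun p hp => by
        rw [Finset.mem_filter, Finset.mem_filter] at hp; exact ⟨hp.1.2, hp.2⟩)
    have h3 := Finset.card_filter_add_card_filter_not (s := P.filter fun p => p ∈ l)
      (fun p => TriplePoint (∏ φ ∈ Φ, φ) p)
    have h4 : (P.filter fun p => p ∈ l).filter (fun p => ¬ TriplePoint (∏ φ ∈ Φ, φ) p) =
        Pn.filter fun p => p ∈ l := by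
      ext p
      simp only [hPn, Finset.mem_filter]
      constructor
      · rintro ⟨⟨a, b⟩, c⟩; exact ⟨⟨a, hlL.2 b, c⟩, b⟩
      · rintro ⟨⟨a, b, c⟩, d⟩; exact ⟨⟨a, d⟩, c⟩
    rw [h4] at h3
    have h5 : ((P.filter fun p => p ∈ l).card : ℝ) ≤
        27 * g.totalDegree + (Pn.filter fun p => p ∈ l).card := by
      exact_mod_cast (by omega : (P.filter fun p => p ∈ l).card ≤
        27 * g.totalDegree + (Pn.filter fun p => p ∈ l).card)
    have h6 := hl l hlL.1
    have h7 : ε * h ≤ 1 / 400 * h := by gcongr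
    linarith
  have hn₂ : (L₂.card : ℝ) ≤ 8 * ε * L.card := by
    have e1 : (L₂.card : ℝ) * (h / 2) ≤ inc Pn L' := by
      rw [inc_eq_sum_lines, Nat.cast_sum, ← nsmul_eq_mul]
      refine (Finset.card_nsmul_le_sum _ _ _ hrich).trans ?_
      exact Finset.sum_le_sum_of_subset_of_nonneg Finset.sdiff_subset fun _ _ _ => by positivity
    have e2 : inc Pn L' ≤ 2 * inc P L₁ := by
      rw [inc_eq_sum_points, inc_eq_sum_points, Finset.mul_sum]
      refine le_trans (Finset.sum_le_sum fun p hp => ?_)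
        (Finset.sum_le_sum_of_subset (Finset.filter_subset _ _))
      rw [hPn, Finset.mem_filter] at hp
      have c1 := card_lines_le_two hp.2.2 hL'mem
      have c2 := hk p hp.1
      have c3 := Finset.card_filter_add_card_filter_not (s := L.filter fun l => p ∈ l)
        (fun l => l ⊆ zset g)
      rw [Finset.filter_comm, Finset.filter_comm (s := L) (q := fun l => ¬ l ⊆ zset g)] at c3
      have : (L'.filter fun l => p ∈ l).card + (L₁.filter fun l => p ∈ l).card =
        (L.filter fun l => p ∈ l).card := c3
      omega
    have e3 : (inc Pn L' : ℝ) ≤ 2 * inc P L₁ := by exact_mod_cast e2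
    have : (L₂.card : ℝ) * h ≤ 8 * ε * L.card * h := by linarith
    exact le_of_mul_le_mul_right this hh
  have hBR : (B.card : ℝ) ≤ 55 * ε * L.card := by
    have e1 : g.totalDegree * (54 * g.totalDegree + 1) ≤ 55 * g.totalDegree ^ 2 := by
      rcases Nat.eq_zero_or_pos g.totalDegree with h0 | h0
      · simp [h0]
      · nlinarith
    have e2 : (B.card : ℝ) ≤ 55 * (g.totalDegree : ℝ) ^ 2 := by exact_mod_cast hB.trans e1
    linarith
  have hcov : L.card ≤ L₁.card + (L₂.card + (Lp.card + B.card)) := by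
    have hsub : L ⊆ L₁ ∪ (L₂ ∪ (Lp ∪ B)) := by
      intro l hlL
      by_cases hlg : l ⊆ zset g
      · have : l ∈ L' := Finset.mem_filter.2 ⟨hlL, hlg⟩
        rw [Finset.mem_union, Finset.mem_union, hL₂, Finset.mem_sdiff]
        tauto
      · exact Finset.mem_union_left _ (Finset.mem_filter.2 ⟨hlL, hlg⟩)
    refine (Finset.card_le_card hsub).trans ((Finset.card_union_le _ _).trans ?_)
    refine Nat.add_le_add_left ((Finset.card_union_le _ _).trans ?_) _
    exact Nat.add_le_add_left (Finset.card_union_le _ _) _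
  have hcovR : (L.card : ℝ) ≤ L₁.card + (L₂.card + (Lp.card + B.card)) := by exact_mod_cast hcov
  have hfin : ε * L.card ≤ 1 / 400 * L.card := by gcongr
  linarith

/-- Few lines, at most `s` per plane, cannot all be rich while every point lies on many of them. -/
theorem not_rich_configuration :
    ∃ A K : ℝ, 1 ≤ A ∧ 3 ≤ K ∧ ∀ (P : Finset (Fin 3 → ℝ)) (L : Finset (Set (Fin 3 → ℝ)))
      (s : ℕ) (h : ℝ), (∀ l ∈ L, IsLine l) →
      (∀ π, IsPlane π → (L.filter fun l => l ⊆ π).card ≤ s) → L.card ≤ s ^ 2 → P.Nonempty →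
      (∀ p ∈ P, K ≤ (L.filter fun l => p ∈ l).card) →
      (∀ l ∈ L, h ≤ (P.filter fun p => p ∈ l).card) → P.card ≤ 3 * L.card * h →
      A ^ 2 * P.card * s ≤ h ^ 2 * L.card → A ≤ h → False := by
  obtain ⟨A, K, hA, hK, hpart⟩ := exists_small_partition (ε := 1 / 400) (by norm_num) (by norm_num)
  refine ⟨max A 16, max K 3, le_max_of_le_left hA, le_max_right _ _, ?_⟩
  intro P L s h hL hs hns hP hk hl hm hh hAh
  have hAh0 : A ≤ h := (le_max_left _ _).trans hAh
  have h16 : 16 ≤ h := (le_max_right _ _).trans hAh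
  have hms : (0 : ℝ) ≤ P.card * s := by positivity
  have hh0 : A ^ 2 * P.card * s ≤ h ^ 2 * L.card := by
    refine le_trans ?_ hh
    gcongr
    exact le_max_left _ _
  have hh16 : 256 * (P.card * s : ℝ) ≤ h ^ 2 * L.card := by
    refine le_trans ?_ hh
    have : (16 : ℝ) ^ 2 ≤ max A 16 ^ 2 := by gcongr; exact le_max_right _ _
    nlinarith
  have hk3 : ∀ p ∈ P, 3 ≤ (L.filter fun l => p ∈ l).card := fun p hp => by
    exact_mod_cast (le_max_right K 3).trans (hk p hp)
  obtain ⟨g, hg, hD, hDn, hI⟩ := hpart P L s h hL hns hP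
    (fun p hp => (le_max_left _ _).trans (hk p hp)) hm hh0 hAh0
  obtain ⟨Φ, hΦ, h1, hΦg, hhalf⟩ := exists_planes hL hg (by linarith) le_rfl hD hDn hI hl hk3
  have hup := inc_planes_le hΦ h1 hL hs (P := P.filter fun p => ∃ φ ∈ Φ, p ∈ zset φ)
    (fun p hp => (Finset.mem_filter.1 hp).2)
    (fun p hp => by have := hk3 p (Finset.mem_filter.1 hp).1; omega)
  have hn : (0 : ℝ) < L.card := by
    obtain ⟨p, hp⟩ := hP
    have := hk3 p hp
    have h2 := Finset.card_filter_le L fun l => p ∈ l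
    exact_mod_cast (by omega : 0 < L.card)
  have hlow : (L.card : ℝ) / 2 * h ≤ inc (P.filter fun p => ∃ φ ∈ Φ, p ∈ zset φ) L := by
    calc (L.card : ℝ) / 2 * h ≤ (L.filter fun l => ∃ φ ∈ Φ, l ⊆ zset φ).card * h := by gcongr
      _ = ∑ l ∈ L.filter (fun l => ∃ φ ∈ Φ, l ⊆ zset φ), h := by
        rw [Finset.sum_const, nsmul_eq_mul]
      _ ≤ ∑ l ∈ L.filter (fun l => ∃ φ ∈ Φ, l ⊆ zset φ),
          (((P.filter fun p => ∃ φ ∈ Φ, p ∈ zset φ).filter fun p => p ∈ l).card : ℝ) := by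
        refine Finset.sum_le_sum fun l hl' => ?_
        obtain ⟨hlL, φ, hφ, hlφ⟩ := Finset.mem_filter.1 hl'
        refine (hl l hlL).trans ?_
        exact_mod_cast Finset.card_le_card fun p hp => by
          simp only [Finset.mem_filter] at hp ⊢
          exact ⟨⟨hp.1, φ, hφ, hlφ hp.2⟩, hp.2⟩
      _ ≤ inc (P.filter fun p => ∃ φ ∈ Φ, p ∈ zset φ) L := by
        rw [inc_eq_sum_lines]
        push_cast
        exact Finset.sum_le_sum_of_subset_of_nonneg (Finset.filter_subset _ _)
          fun _ _ _ => by positivity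
  have hΦr : (Φ.card : ℝ) ≤ g.totalDegree := by exact_mod_cast hΦg
  have hPc : ((P.filter fun p => ∃ φ ∈ Φ, p ∈ zset φ).card : ℝ) ≤ P.card := by
    exact_mod_cast Finset.card_filter_le _ _
  have hsqrt : √(2 * (P.filter fun p => ∃ φ ∈ Φ, p ∈ zset φ).card *
      (s * (L.card + 3 * (Φ.card : ℝ) ^ 2))) ≤ L.card * h / 8 := by
    refine Real.sqrt_le_iff.2 ⟨by positivity, ?_⟩
    have hΦ2 : (Φ.card : ℝ) ^ 2 ≤ 1 / 400 * L.card := le_trans (by gcongr) hDn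
    calc 2 * ((P.filter fun p => ∃ φ ∈ Φ, p ∈ zset φ).card : ℝ) *
          (s * (L.card + 3 * (Φ.card : ℝ) ^ 2))
        ≤ 2 * P.card * (s * (2 * L.card)) := by gcongr; linarith
      _ ≤ (L.card * h / 8) ^ 2 := by nlinarith
  have : 2 * L.card * (Φ.card : ℝ) ≤ 2 * L.card * (1 / 400 * h) := by
    gcongr; exact hΦr.trans hD
  have : 0 < L.card * h := by positivity
  nlinarith

end SharirSolomon

namespace SharirSolomon

/-- At most `s ^ 2` lines, at most `s` of them in any plane. -/
def Spread (L : Finset (Set (Fin 3 → ℝ))) (s : ℕ) : Prop :=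
  (∀ l ∈ L, IsLine l) ∧ (∀ π, IsPlane π → (L.filter fun l => l ⊆ π).card ≤ s) ∧ L.card ≤ s ^ 2

lemma Spread.mono {L L' : Finset (Set (Fin 3 → ℝ))} {s : ℕ} (h : Spread L s) (hL : L' ⊆ L) :
    Spread L' s :=
  ⟨fun l hl => h.1 l (hL hl), fun π hπ =>
    (Finset.card_le_card (Finset.filter_subset_filter _ hL)).trans (h.2.1 π hπ),
    (Finset.card_le_card hL).trans h.2.2⟩

lemma inc_erase_point {P : Finset (Fin 3 → ℝ)} {p : Fin 3 → ℝ} (hp : p ∈ P)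
    (L : Finset (Set (Fin 3 → ℝ))) :
    inc P L = inc (P.erase p) L + (L.filter fun l => p ∈ l).card := by
  rw [inc_eq_sum_points, inc_eq_sum_points, Finset.sum_erase_add _ _ hp]

lemma inc_erase_line (P : Finset (Fin 3 → ℝ)) {L : Finset (Set (Fin 3 → ℝ))}
    {l : Set (Fin 3 → ℝ)} (hl : l ∈ L) :
    inc P L = inc P (L.erase l) + (P.filter fun p => p ∈ l).card := by
  rw [inc_eq_sum_lines, inc_eq_sum_lines, Finset.sum_erase_add _ _ hl]

/-- The number of points lying on at least `K` lines of a spread family is `O(|L| s)`; the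
constants are shared with the exclusion of rich configurations. -/
theorem exists_card_rich_points_le :
    ∃ A K J : ℝ, 1 ≤ A ∧ 3 ≤ K ∧ 1 ≤ J ∧
      (∀ (P : Finset (Fin 3 → ℝ)) (L : Finset (Set (Fin 3 → ℝ))) (s : ℕ) (h : ℝ), Spread L s →
        P.Nonempty → (∀ p ∈ P, K ≤ (L.filter fun l => p ∈ l).card) →
        (∀ l ∈ L, h ≤ (P.filter fun p => p ∈ l).card) → P.card ≤ 3 * L.card * h →
        A ^ 2 * P.card * s ≤ h ^ 2 * L.card → A ≤ h → False) ∧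
      ∀ (P : Finset (Fin 3 → ℝ)) (L : Finset (Set (Fin 3 → ℝ))) (s : ℕ), Spread L s →
        (∀ p ∈ P, K ≤ (L.filter fun l => p ∈ l).card) → (P.card : ℝ) ≤ J * L.card * s := by
  obtain ⟨A, K, hA, hK, hcore⟩ := not_rich_configuration
  refine ⟨A, K, 2 * A ^ 2, hA, hK, by nlinarith,
    fun P L s h hS => hcore P L s h hS.1 hS.2.1 hS.2.2, ?_⟩
  intro P L s
  induction hN : P.card + L.card using Nat.strong_induction_on generalizing P L with
  | _ N ih =>
  intro hS hk
  by_contra! hlt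
  have hP : P.Nonempty := by
    rw [Finset.nonempty_iff_ne_empty]
    rintro rfl
    rw [Finset.card_empty, Nat.cast_zero] at hlt
    exact absurd hlt (not_lt.2 (by positivity))
  obtain ⟨p, hp⟩ := hP
  have hn : 1 ≤ L.card := by
    have h1 : (1 : ℝ) ≤ L.card := by
      have h2 : ((L.filter fun l => p ∈ l).card : ℝ) ≤ L.card := by
        exact_mod_cast Finset.card_filter_le _ _
      linarith [hk p hp]
    exact_mod_cast h1
  have hs : 1 ≤ s := by
    rcases Nat.eq_zero_or_pos s with rfl | h
    · have := hS.2.2; omega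
    · exact h
  have hnr : (1 : ℝ) ≤ L.card := by exact_mod_cast hn
  have hsr : (1 : ℝ) ≤ s := by exact_mod_cast hs
  have hmpos : 0 < P.card := Finset.card_pos.2 ⟨p, hp⟩
  have hm : (P.card : ℝ) ≤ 2 * A ^ 2 * L.card * s + 1 := by
    have h1 := ih ((P.erase p).card + L.card) (by rw [Finset.card_erase_of_mem hp]; omega)
      (P.erase p) L rfl hS fun q hq => hk q (Finset.mem_of_mem_erase hq)
    rw [Finset.card_erase_of_mem hp, Nat.cast_sub hmpos] at h1
    push_cast at h1
    linarith
  have hl : ∀ l ∈ L, 2 * A ^ 2 * s ≤ (P.filter fun p => p ∈ l).card := by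
    intro l hl
    have hcard : (P.filter fun p => p ∈ l).card + (P.filter fun p => p ∉ l).card = P.card :=
      Finset.card_filter_add_card_filter_not _
    have h1 := ih ((P.filter fun p => p ∉ l).card + (L.erase l).card)
      (by rw [Finset.card_erase_of_mem hl]; omega) (P.filter fun p => p ∉ l) (L.erase l) rfl
      (hS.mono (Finset.erase_subset _ _)) (fun q hq => by
        rw [Finset.mem_filter] at hq
        refine (hk q hq.1).trans ?_
        exact_mod_cast Finset.card_le_card fun k hk' => by
          rw [Finset.mem_filter] at hk' ⊢
          refine ⟨Finset.mem_erase.2 ⟨?_, hk'.1⟩, hk'.2⟩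
          rintro rfl
          exact hq.2 hk'.2)
    rw [Finset.card_erase_of_mem hl, Nat.cast_sub hn] at h1
    have hcard' : ((P.filter fun p => p ∈ l).card : ℝ) + (P.filter fun p => p ∉ l).card =
      P.card := by exact_mod_cast hcard
    push_cast at h1
    linarith
  have hA2 : 1 ≤ A ^ 2 := one_le_pow₀ hA
  have hns : (1 : ℝ) ≤ L.card * s := one_le_mul_of_one_le_of_one_le hnr hsr
  have hJ : 1 ≤ A ^ 2 * (L.card * s) := one_le_mul_of_one_le_of_one_le hA2 hns
  have hm2 : (P.card : ℝ) ≤ 4 * A ^ 2 * L.card * s := by linarith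
  refine hcore P L s (2 * A ^ 2 * s) hS.1 hS.2.1 hS.2.2 ⟨p, hp⟩ hk hl ?_ ?_ ?_
  · nlinarith
  · calc A ^ 2 * (P.card : ℝ) * s ≤ A ^ 2 * (4 * A ^ 2 * L.card * s) * s := by gcongr
      _ = (2 * A ^ 2 * s) ^ 2 * L.card := by ring
  · nlinarith

/-- Incidence bound for at most `s ^ 2` lines with at most `s` of them in any plane. -/
theorem inc_le_of_spread :
    ∃ A : ℝ, 0 < A ∧ ∀ (P : Finset (Fin 3 → ℝ)) (L : Finset (Set (Fin 3 → ℝ))) (s : ℕ),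
      Spread L s → (inc P L : ℝ) ≤ A * (P.card + √(P.card * L.card * s) + L.card) := by
  obtain ⟨A, K, J, hA, hK, hJ, hcore, hcard⟩ := exists_card_rich_points_le
  obtain ⟨a, ha⟩ : ∃ a, a = 2 * A + J := ⟨_, rfl⟩
  suffices H : ∀ (P : Finset (Fin 3 → ℝ)) (L : Finset (Set (Fin 3 → ℝ))) (s : ℕ),
      Spread L s → (inc P L : ℝ) ≤ K * P.card + a * √(P.card * L.card * s) + a * L.card by
    refine ⟨K + a, by linarith, fun P L s hS => (H P L s hS).trans ?_⟩
    have h1 : 0 ≤ a * (P.card : ℝ) := mul_nonneg (by linarith) (by positivity)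
    have h2 : 0 ≤ K * √(P.card * L.card * s) := mul_nonneg (by linarith) (by positivity)
    have h3 : 0 ≤ K * (L.card : ℝ) := mul_nonneg (by linarith) (by positivity)
    linarith
  have ha0 : 0 < a := by linarith
  intro P L s
  induction hN : P.card + L.card using Nat.strong_induction_on generalizing P L with
  | _ N ih =>
  intro hS
  by_contra! hlt
  have hk : ∀ p ∈ P, K ≤ (L.filter fun l => p ∈ l).card := by
    intro p hp
    have hmpos : 0 < P.card := Finset.card_pos.2 ⟨p, hp⟩
    have h1 := ih ((P.erase p).card + L.card) (by rw [Finset.card_erase_of_mem hp]; omega)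
      (P.erase p) L rfl hS
    have h2 : √((P.erase p).card * L.card * s) ≤ √(P.card * L.card * s) := by
      gcongr
      exact Finset.erase_subset _ _
    have h3 : a * √((P.erase p).card * L.card * s) ≤ a * √(P.card * L.card * s) := by gcongr
    rw [inc_erase_point hp] at hlt
    rw [Finset.card_erase_of_mem hp, Nat.cast_sub hmpos] at h1 h3
    push_cast at h1 h3 hlt
    linarith
  have hPne : P.Nonempty := by
    rw [Finset.nonempty_iff_ne_empty]
    rintro rfl
    have : inc ∅ L = 0 := by rw [inc_eq_sum_points, Finset.sum_empty]
    rw [this, Nat.cast_zero] at hlt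
    exact absurd hlt (not_lt.2 (by positivity))
  have hn : 1 ≤ L.card := by
    obtain ⟨p, hp⟩ := hPne
    have h1 : (1 : ℝ) ≤ L.card := by
      have h2 : ((L.filter fun l => p ∈ l).card : ℝ) ≤ L.card := by
        exact_mod_cast Finset.card_filter_le _ _
      linarith [hk p hp]
    exact_mod_cast h1
  have hnr : (1 : ℝ) ≤ L.card := by exact_mod_cast hn
  have hn0 : (0 : ℝ) < L.card := by linarith
  obtain ⟨r, hr⟩ : ∃ r, r = √(P.card * L.card * s) := ⟨_, rfl⟩
  have hr0 : 0 ≤ r := hr ▸ Real.sqrt_nonneg _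
  have hr2 : r ^ 2 = P.card * L.card * s := by rw [hr, Real.sq_sqrt (by positivity)]
  have hl : ∀ l ∈ L, a * r / (2 * L.card) + a ≤ (P.filter fun p => p ∈ l).card := by
    intro l hl
    have h1 := ih (P.card + (L.erase l).card)
      (by rw [Finset.card_erase_of_mem hl]; omega) P (L.erase l) rfl
      (hS.mono (Finset.erase_subset _ _))
    rw [inc_erase_line P hl, ← hr] at hlt
    rw [Finset.card_erase_of_mem hl, Nat.cast_sub hn] at h1
    push_cast at h1 hlt
    have h2 : √(P.card * (L.card - 1) * s) ≤ r - r / (2 * L.card) := by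
      have h3 : r / (2 * L.card) ≤ r := div_le_self hr0 (by linarith)
      refine Real.sqrt_le_iff.2 ⟨by linarith, ?_⟩
      have h4 : (r - r / (2 * L.card)) ^ 2 =
          r ^ 2 - r ^ 2 / L.card + (r / (2 * L.card)) ^ 2 := by
        field_simp; ring
      have h5 : r ^ 2 / L.card = P.card * s := by rw [hr2]; field_simp
      rw [h4, h5, hr2]
      nlinarith [sq_nonneg (r / (2 * L.card))]
    have h6 : a * √(P.card * (L.card - 1) * s) ≤ a * r - a * r / (2 * L.card) := by
      calc a * √(P.card * (L.card - 1) * s) ≤ a * (r - r / (2 * L.card)) := by gcongr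
        _ = _ := by ring
    linarith
  have hm := hcard P L s hS hk
  have hq0 : 0 ≤ a * r / (2 * L.card) := by positivity
  have hmr : (P.card : ℝ) ≤ a * r := by
    refine le_of_sq_le_sq ?_ (by positivity)
    calc (P.card : ℝ) ^ 2 = P.card * P.card := sq _
      _ ≤ P.card * (J * L.card * s) := by gcongr
      _ = J * r ^ 2 := by rw [hr2]; ring
      _ ≤ a ^ 2 * r ^ 2 := by gcongr; nlinarith
      _ = (a * r) ^ 2 := by ring
  refine hcore P L s (a * r / (2 * L.card) + a) hS hPne hk hl ?_ ?_ (by linarith)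
  · have : 3 * L.card * (a * r / (2 * L.card) + a) = 3 / 2 * (a * r) + 3 * L.card * a := by
      field_simp
    rw [this]
    have : 0 ≤ 3 * L.card * a := by positivity
    have : 0 ≤ a * r := by positivity
    linarith
  · calc A ^ 2 * (P.card : ℝ) * s ≤ (a / 2) ^ 2 * P.card * s := by gcongr; linarith
      _ = (a * r / (2 * L.card)) ^ 2 * L.card := by
        have : (a * r / (2 * L.card)) ^ 2 * L.card = (a / 2) ^ 2 * r ^ 2 / L.card := by
          field_simp
        rw [this, hr2]
        field_simp
      _ ≤ (a * r / (2 * L.card) + a) ^ 2 * L.card := by gcongr; linarith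

end SharirSolomon

namespace SharirSolomon

open MvPolynomial

lemma inc_sdiff_add (P : Finset (Fin 3 → ℝ)) {L B : Finset (Set (Fin 3 → ℝ))} (hB : B ⊆ L) :
    inc P L = inc P (L \ B) + inc P B := by
  rw [inc_eq_sum_lines, inc_eq_sum_lines, inc_eq_sum_lines, Finset.sum_sdiff hB]

/-- Lines on a surface without planar components: those along which the control polynomials do not
vanish are handled directly, and the remaining `O(d ^ 2)` lines form a spread family. -/
theorem exists_incidence_bound :
    ∃ C : ℝ, 0 < C ∧ ∀ (f : MvPolynomial (Fin 3) ℝ) (P : Finset (Fin 3 → ℝ))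
      (L : Finset (Set (Fin 3 → ℝ))), f ≠ 0 →
      (∀ g : MvPolynomial (Fin 3) ℝ, g.totalDegree = 1 → ¬ g ∣ f) →
      (∀ l ∈ L, IsLine l ∧ l ⊆ zset f) →
      (∀ π, IsPlane π → (L.filter fun l => l ⊆ π).card ≤ f.totalDegree) →
      (inc P L : ℝ) ≤ C * (√(P.card * L.card * f.totalDegree) + P.card + L.card) := by
  obtain ⟨A, hA, hspread⟩ := inc_le_of_spread
  refine ⟨3 * A + 3, by linarith, ?_⟩
  intro f P L hf hlin hL hplane
  obtain ⟨Φ, hΦ, hdvd, hd, hz⟩ := exists_irrFamily f hf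
  have hLl : ∀ l ∈ L, IsLine l := fun l hl => (hL l hl).1
  have h2 : ∀ φ ∈ Φ, 2 ≤ φ.totalDegree := fun φ hφ => by
    have h1 := one_le_totalDegree_of_irreducible (hΦ.1 φ hφ)
    have h3 : φ.totalDegree ≠ 1 := fun h => hlin φ h (hdvd φ hφ)
    omega
  obtain ⟨G, hG⟩ := exists_familyControl hΦ L hLl
  have hgood := incidences_good hΦ h2 hLl (fun l hl => hz ▸ (hL l hl).2) hG P hd
  have hBL : badLines Φ L G ⊆ L := Finset.filter_subset _ _
  have hbad := hspread P (badLines Φ L G) (8 * f.totalDegree)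
    ⟨fun l hl => hLl l (hBL hl), fun π hπ => by
      have h1 := Finset.card_le_card (Finset.filter_subset_filter (fun l => l ⊆ π) hBL)
      have h3 := hplane π hπ
      omega, (card_badLines_le hΦ hLl hG hd).trans (by nlinarith)⟩
  rw [inc_sdiff_add P hBL]
  push_cast at hbad ⊢
  have hBc : ((badLines Φ L G).card : ℝ) ≤ L.card := by exact_mod_cast Finset.card_le_card hBL
  have hs1 : √(P.card * (L.card * (4 * (f.totalDegree : ℝ)))) ≤
      3 * √(P.card * L.card * f.totalDegree) := by
    refine Real.sqrt_le_iff.2 ⟨by positivity, ?_⟩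
    rw [mul_pow, Real.sq_sqrt (by positivity)]
    have : (0 : ℝ) ≤ P.card * L.card * f.totalDegree := by positivity
    linarith
  have hs2 : √(P.card * (badLines Φ L G).card * (8 * (f.totalDegree : ℝ))) ≤
      3 * √(P.card * L.card * f.totalDegree) := by
    refine Real.sqrt_le_iff.2 ⟨by positivity, ?_⟩
    rw [mul_pow, Real.sq_sqrt (by positivity)]
    have h1 : (0 : ℝ) ≤ P.card * L.card * f.totalDegree := by positivity
    have h3 : (P.card * (badLines Φ L G).card * (8 * (f.totalDegree : ℝ))) ≤
      P.card * L.card * (8 * (f.totalDegree : ℝ)) := by gcongr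
    linarith
  have hbad' : (inc P (badLines Φ L G) : ℝ) ≤
      A * (P.card + 3 * √(P.card * L.card * f.totalDegree) + L.card) := hbad.trans (by gcongr)
  have h4 : 0 ≤ A * (P.card : ℝ) := by positivity
  have h5 : 0 ≤ A * (L.card : ℝ) := by positivity
  have hgood' : (inc P (L \ badLines Φ L G) : ℝ) ≤
    3 * P.card + L.card + √(P.card * (L.card * (4 * f.totalDegree))) := hgood
  nlinarith [Real.sqrt_nonneg (P.card * L.card * (f.totalDegree : ℝ)),
    Nat.cast_nonneg (α := ℝ) P.card, Nat.cast_nonneg (α := ℝ) L.card]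
end SharirSolomon

/-- **Sharir–Solomon incidence bound for lines on a surface.** There is an absolute
constant `C` such that if `f` is a nonzero polynomial of degree `d ≥ 2` in three
variables with no linear factor, `P` a finite set of points and `L` a finite set of
lines in `ℝ³`, all contained in the zero set of `f`, with at most `s ≤ d` lines of `L`
in any affine plane, then
`I(P,L) ≤ C (|P|^{1/2}|L|^{1/2}d^{1/2} + |P|^{2/3}d^{2/3}s^{1/3} + |P| + |L|)`. -/
theorem sharir_solomon_incidence_bound :
    ∃ C : ℝ, 0 < C ∧
      ∀ (f : MvPolynomial (Fin 3) ℝ) (d : ℕ)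
        (P : Finset (Fin 3 → ℝ)) (L : Finset (Set (Fin 3 → ℝ))) (s : ℕ),
        f ≠ 0 → f.totalDegree = d → 2 ≤ d →
        (¬ ∃ g : MvPolynomial (Fin 3) ℝ, g.totalDegree = 1 ∧ g ∣ f) →
        (∀ p ∈ P, MvPolynomial.eval p f = 0) →
        (∀ l ∈ L, IsLine l ∧ l ⊆ {x | MvPolynomial.eval x f = 0}) →
        s ≤ d →
        (∀ π : Set (Fin 3 → ℝ), IsPlane π → (L.filter (fun l => l ⊆ π)).card ≤ s) →
        (((P ×ˢ L).filter (fun pl => pl.1 ∈ pl.2)).card : ℝ) ≤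
          C * ((P.card : ℝ) ^ (1 / 2 : ℝ) * (L.card : ℝ) ^ (1 / 2 : ℝ) * (d : ℝ) ^ (1 / 2 : ℝ) +
            (P.card : ℝ) ^ (2 / 3 : ℝ) * (d : ℝ) ^ (2 / 3 : ℝ) * (s : ℝ) ^ (1 / 3 : ℝ) +
            (P.card : ℝ) + (L.card : ℝ)) := by
  obtain ⟨C, hC, hbound⟩ := SharirSolomon.exists_incidence_bound
  refine ⟨C, hC, ?_⟩
  rintro f _ P L s hf rfl - hlin - hL hs hplane
  refine (hbound f P L hf (fun g h1 h2 => hlin ⟨g, h1, h2⟩) hL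
    fun π hπ => (hplane π hπ).trans hs).trans ?_
  rw [← Real.mul_rpow (by positivity) (by positivity),
    ← Real.mul_rpow (by positivity) (by positivity), ← Real.sqrt_eq_rpow]
  gcongr
  have : (0 : ℝ) ≤ (P.card : ℝ) ^ (2 / 3 : ℝ) * (f.totalDegree : ℝ) ^ (2 / 3 : ℝ) *
    (s : ℝ) ^ (1 / 3 : ℝ) := by positivity
  linarith
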